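/- Spectral part of the main stability theorem for quantum LDPC codes: Fix integers q, q' ≥ 2, reals c_d > 0 and κ₁ > 2/c_d, a real a ≥ 1, and constants c'_f, c''_f, α > 0. Then there exist positive constants ε₀, c₁, c₂, c₃ depending only on q, q', κ₁, a, c'_f, c''_f, α such that the following holds. Let a (q,q')-LDPC stabilizer code on n ≥ c₃ qubits be given, with k logical qubits, code distance d, and (d_c, f)-check-soundness for an increasing bijection f of [0,∞), such that d_s := min(d, d_c) ≥ c_d·log n and the summability condition holds with constants (c'_f, c''_f, α). Let H₀ = Σⱼ λⱼ·(I − P(Cⱼ))/2 be the code Hamiltonian with coefficients λⱼ ∈ [1, a], and let V be a Hermitian 2ⁿ×2ⁿ matrix presented as V = Σ_{S,s} V_{S,s} with each V_{S,s} strongly supported in S with syndrome s, such that ε := ‖V‖_{κ₁} ≤ min(ε₀, 1/(3c₁)). Set ε_* := c₂·n·ε·exp(−κ₁·d_s/2). Then there exists a real number c_* such that every eigenvalue of H₀ + V − c_*·I lies in [−ε_*, ε_*] ∪ [1/2 + ε_*, ∞), and exactly 2^k eigenvalues, counted with multiplicity, lie in [−ε_*, ε_*]. -/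

import Mathlib

open Classical

noncomputable section

/-- Vectors over `F₂` indexed by the `n` qubits. -/
abbrev F2vec (n : ℕ) := Fin n → ZMod 2

/-- Support of a Pauli operator `(x, z)` on `n` qubits. -/
def pSupp {n : ℕ} (p : F2vec n × F2vec n) : Finset (Fin n) :=
  Finset.univ.filter fun i => p.1 i ≠ 0 ∨ p.2 i ≠ 0

/-- Weight of a Pauli operator. -/
def pWeight {n : ℕ} (p : F2vec n × F2vec n) : ℕ := (pSupp p).card

/-- Symplectic form deciding (anti)commutation of two Pauli operators. -/
def sympl {n : ℕ} (p q : F2vec n × F2vec n) : ZMod 2 :=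
  ∑ i, (p.1 i * q.2 i + q.1 i * p.2 i)

/-- The (Hermitian unitary) Pauli matrix of `(x, z)`, acting on `ℂ^(2^n)` with basis
indexed by `F₂ⁿ`:  entry `(a, b)` equals `i^{|{i : xᵢ = zᵢ = 1}|}·(−1)^{Σᵢ zᵢbᵢ}` if
`a = b + x` and `0` otherwise. -/
def pauli {n : ℕ} (p : F2vec n × F2vec n) : Matrix (F2vec n) (F2vec n) ℂ :=
  fun a b =>
    if a = b + p.1 then
      Complex.I ^ (Finset.univ.filter fun i => p.1 i = 1 ∧ p.2 i = 1).card *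
        (-1 : ℂ) ^ (∑ i, (p.2 i).val * (b i).val)
    else 0

/-- The `ℓ² → ℓ²` operator norm of a matrix acting on the `n`-qubit Hilbert space. -/
def opNorm {n : ℕ} (M : Matrix (F2vec n) (F2vec n) ℂ) : ℝ :=
  ‖Matrix.toEuclideanCLM (𝕜 := ℂ) M‖

/-- The syndrome of a Pauli operator: the set of checks that anticommute with it. -/
def syndrome {n m : ℕ} (C : Fin m → F2vec n × F2vec n) (p : F2vec n × F2vec n) :
    Finset (Fin m) :=
  Finset.univ.filter fun j => sympl p (C j) = 1

/-- A matrix is strongly supported in `S` with syndrome `s`: it is a `ℂ`-linear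
combination of Pauli matrices with support inside `S` and syndrome `s`, and every check
in `s` has support inside `S`. -/
def StronglySupported {n m : ℕ} (C : Fin m → F2vec n × F2vec n)
    (M : Matrix (F2vec n) (F2vec n) ℂ) (S : Finset (Fin n)) (s : Finset (Fin m)) : Prop :=
  M ∈ Submodule.span ℂ
      {A : Matrix (F2vec n) (F2vec n) ℂ |
        ∃ p : F2vec n × F2vec n, A = pauli p ∧ pSupp p ⊆ S ∧ syndrome C p = s} ∧
    ∀ j ∈ s, pSupp (C j) ⊆ S

/-- The `κ`-norm (local strength) of a presentation `S, s ↦ V_{S,s}`: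
`max_i Σ_{S ∋ i} Σ_s ‖V_{S,s}‖·e^{κ|S|}`. -/
def kappaNorm {n m : ℕ}
    (VF : Finset (Fin n) → Finset (Fin m) → Matrix (F2vec n) (F2vec n) ℂ) (κ : ℝ) : ℝ :=
  ⨆ i : Fin n, ∑ S ∈ Finset.univ.filter (fun S : Finset (Fin n) => i ∈ S),
    ∑ s : Finset (Fin m), opNorm (VF S s) * Real.exp (κ * S.card)

/-- The code graph: two distinct qubits are adjacent iff some check acts on both. -/
def codeGraph {n m : ℕ} (C : Fin m → F2vec n × F2vec n) : SimpleGraph (Fin n) :=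
  SimpleGraph.fromRel fun i j => ∃ k : Fin m, i ∈ pSupp (C k) ∧ j ∈ pSupp (C k)

/-- Ball of radius `r` around `i` in the code graph (unreachable vertices are at
infinite distance, hence excluded). -/
def gBall {n : ℕ} (G : SimpleGraph (Fin n)) (i : Fin n) (r : ℕ) : Finset (Fin n) :=
  Finset.univ.filter fun j => G.Reachable i j ∧ G.dist i j ≤ r

/-- `γ(r)`: the maximal surface volume of balls of radius `r` (with `γ(0) = 1`). -/
def gammaMax {n : ℕ} (G : SimpleGraph (Fin n)) (r : ℕ) : ℕ :=
  if r = 0 then 1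
  else Finset.univ.sup fun i : Fin n => (gBall G i r).card - (gBall G i (r - 1)).card

/-- A Pauli operator is a logical operator of the code: it commutes with all checks but
is not a product (F₂-sum) of checks. -/
def IsLogical {n m : ℕ} (C : Fin m → F2vec n × F2vec n) (p : F2vec n × F2vec n) : Prop :=
  (∀ j : Fin m, sympl p (C j) = 0) ∧ ¬∃ T : Finset (Fin m), p = ∑ j ∈ T, C j

/-- The recursively defined radius function `f̃`: `f̃(1) = f⁻¹(1)` and
`f̃(r+1) = f⁻¹( f(f̃(r)) + min(cutoff, f̃(r))/Δ )`. -/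
def ftilde (f finv : ℝ → ℝ) (cutoff Δ : ℝ) : ℕ → ℝ
  | 0 => finv 1
  | 1 => finv 1
  | (r + 2) => finv (f (ftilde f finv cutoff Δ (r + 1))
      + min cutoff (ftilde f finv cutoff Δ (r + 1)) / Δ)

/-- The summability condition with constants `(c'_f, c''_f, α)`: for every `δκ > 0`,
every partial sum of `Σ_{r ≥ 1, f̃(r) < d_s} γ(r)·e^{−δκ·f̃(r)}` is at most
`c''_f·e^{c'_f·δκ^{−α}}`. -/
def SummabilityCondition {n : ℕ} (G : SimpleGraph (Fin n)) (f finv : ℝ → ℝ)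
    (ds Δ c'f c''f α : ℝ) : Prop :=
  ∀ δκ : ℝ, 0 < δκ → ∀ R : ℕ,
    (∑ r ∈ Finset.Icc 1 R,
      if ftilde f finv ds Δ r < ds then
        (gammaMax G r : ℝ) * Real.exp (-(δκ * ftilde f finv ds Δ r))
      else 0)
    ≤ c''f * Real.exp (c'f * δκ ^ (-α))


/-! ### Algebra of Pauli matrices -/

/-- The nontrivial additive character of `F₂`. -/
def signChar (t : ZMod 2) : ℂ := if t = 0 then 1 else -1

theorem signChar_zero : signChar 0 = 1 := by simp [signChar]

theorem signChar_one : signChar 1 = -1 := by simp [signChar]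

theorem zmod_two_cases (t : ZMod 2) : t = 0 ∨ t = 1 := by
  revert t; decide

theorem zmod_two_add_self (t : ZMod 2) : t + t = 0 := by
  revert t; decide

theorem f2vec_add_self {n : ℕ} (x : F2vec n) : x + x = 0 := by
  funext i; exact zmod_two_add_self (x i)

theorem pauliLabel_add_self {n : ℕ} (p : F2vec n × F2vec n) : p + p = 0 :=
  Prod.ext (f2vec_add_self _) (f2vec_add_self _)

theorem signChar_add (s t : ZMod 2) : signChar (s + t) = signChar s * signChar t := by
  rcases zmod_two_cases s with rfl | rfl <;> rcases zmod_two_cases t with rfl | rfl <;>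
    simp [signChar, show (1 : ZMod 2) + 1 = 0 from rfl]

theorem signChar_mul_self (t : ZMod 2) : signChar t * signChar t = 1 := by
  rw [← signChar_add, zmod_two_add_self, signChar_zero]

theorem neg_one_pow_eq_signChar (N : ℕ) : (-1 : ℂ) ^ N = signChar (N : ZMod 2) := by
  induction N with
  | zero => simp [signChar]
  | succ N ih => rw [pow_succ, ih, Nat.cast_succ, signChar_add, signChar_one]

theorem pauli_apply {n : ℕ} (p : F2vec n × F2vec n) (a b : F2vec n) :
    pauli p a b = if a = b + p.1 then
      Complex.I ^ (Finset.univ.filter fun i => p.1 i = 1 ∧ p.2 i = 1).card *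
        signChar (∑ i, p.2 i * b i) else 0 := by
  unfold pauli
  rw [neg_one_pow_eq_signChar]
  simp

theorem signChar_sum_mul {n : ℕ} (x z : F2vec n) :
    signChar (∑ i, z i * x i) =
      (-1) ^ (Finset.univ.filter fun i => x i = 1 ∧ z i = 1).card := by
  rw [neg_one_pow_eq_signChar, Finset.card_filter, Nat.cast_sum]
  congr 1
  refine Finset.sum_congr rfl fun i _ => ?_
  rcases zmod_two_cases (x i) with h | h <;> rcases zmod_two_cases (z i) with h' | h' <;>
    simp [h, h']

theorem pauli_mul_apply {n : ℕ} (p q : F2vec n × F2vec n) (a b : F2vec n) :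
    (pauli p * pauli q) a b = if a = b + (p.1 + q.1) then
      Complex.I ^ (Finset.univ.filter fun i => p.1 i = 1 ∧ p.2 i = 1).card *
      Complex.I ^ (Finset.univ.filter fun i => q.1 i = 1 ∧ q.2 i = 1).card *
        (signChar (∑ i, p.2 i * q.1 i) *
        (signChar (∑ i, p.2 i * b i) * signChar (∑ i, q.2 i * b i))) else 0 := by
  rw [Matrix.mul_apply, Finset.sum_eq_single (b + q.1)]
  · rw [pauli_apply, pauli_apply, if_pos rfl]
    have h1 : b + q.1 + p.1 = b + (p.1 + q.1) := by abel
    rw [h1]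
    split_ifs
    · have h2 : ∑ i, p.2 i * (b + q.1) i = ∑ i, p.2 i * b i + ∑ i, p.2 i * q.1 i := by
        simp [mul_add, Finset.sum_add_distrib]
      rw [h2, signChar_add]; ring
    · simp
  · intro c _ hc
    rw [pauli_apply q, if_neg hc, mul_zero]
  · simp

theorem pauli_zero {n : ℕ} : pauli (0 : F2vec n × F2vec n) = 1 := by
  ext a b
  rw [pauli_apply]
  simp [signChar_zero, Matrix.one_apply]

theorem pauli_mul_pauli {n : ℕ} (p q : F2vec n × F2vec n) :
    ∃ w : ℂ, pauli p * pauli q = w • pauli (p + q) := by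
  refine ⟨Complex.I ^ (Finset.univ.filter fun i => p.1 i = 1 ∧ p.2 i = 1).card *
      Complex.I ^ (Finset.univ.filter fun i => q.1 i = 1 ∧ q.2 i = 1).card *
      signChar (∑ i, p.2 i * q.1 i) *
      (Complex.I ^ (Finset.univ.filter fun i => (p + q).1 i = 1 ∧ (p + q).2 i = 1).card)⁻¹, ?_⟩
  ext a b
  rw [pauli_mul_apply, Matrix.smul_apply, pauli_apply]
  simp only [Prod.fst_add]
  split_ifs
  · have h : signChar (∑ i, (p + q).2 i * b i) =
        signChar (∑ i, p.2 i * b i) * signChar (∑ i, q.2 i * b i) := by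
      rw [← signChar_add]; simp [add_mul, Finset.sum_add_distrib]
    rw [h, smul_eq_mul]
    field_simp
  · simp

theorem sympl_eq_add {n : ℕ} (p q : F2vec n × F2vec n) :
    sympl p q = ∑ i, p.2 i * q.1 i + ∑ i, q.2 i * p.1 i := by
  unfold sympl
  rw [← Finset.sum_add_distrib]
  refine Finset.sum_congr rfl fun i _ => by ring

theorem pauli_mul_comm {n : ℕ} (p q : F2vec n × F2vec n) :
    pauli p * pauli q = signChar (sympl p q) • (pauli q * pauli p) := by
  ext a b
  rw [Matrix.smul_apply, pauli_mul_apply, pauli_mul_apply, add_comm q.1 p.1, sympl_eq_add,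
    signChar_add]
  split_ifs
  · have h := signChar_mul_self (∑ i, q.2 i * p.1 i)
    rw [smul_eq_mul]
    linear_combination (-1) * Complex.I ^ (Finset.univ.filter fun i => p.1 i = 1 ∧ p.2 i = 1).card *
      Complex.I ^ (Finset.univ.filter fun i => q.1 i = 1 ∧ q.2 i = 1).card *
        (signChar (∑ i, p.2 i * q.1 i) *
        (signChar (∑ i, p.2 i * b i) * signChar (∑ i, q.2 i * b i))) * h
  · simp

theorem pauli_mul_self {n : ℕ} (p : F2vec n × F2vec n) : pauli p * pauli p = 1 := by
  ext a b
  rw [pauli_mul_apply, f2vec_add_self, add_zero, signChar_mul_self, signChar_sum_mul,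
    ← mul_pow, Complex.I_mul_I, mul_one, ← mul_pow, Matrix.one_apply]
  simp

theorem pauli_conjTranspose {n : ℕ} (p : F2vec n × F2vec n) :
    (pauli p).conjTranspose = pauli p := by
  ext a b
  rw [Matrix.conjTranspose_apply, pauli_apply, pauli_apply]
  have hab : b = a + p.1 ↔ a = b + p.1 := by
    constructor <;> rintro rfl <;> rw [add_assoc, f2vec_add_self, add_zero]
  by_cases h : a = b + p.1
  · rw [if_pos (hab.2 h), if_pos h, h]
    have h2 : ∑ i, p.2 i * (b + p.1) i = ∑ i, p.2 i * b i + ∑ i, p.2 i * p.1 i := by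
      simp [mul_add, Finset.sum_add_distrib]
    have h3 : ∀ t, star (signChar t) = signChar t := fun t => by
      unfold signChar; split_ifs <;> simp
    rw [h2, signChar_add, signChar_sum_mul p.1]
    simp only [star_mul', star_pow, h3, star_neg, star_one]
    have h4 : star Complex.I = -Complex.I := Complex.conj_I
    rw [h4, mul_comm (signChar _), ← mul_assoc, ← mul_pow]
    simp
  · rw [if_neg h, if_neg (fun h' => h (hab.1 h')), star_zero]

theorem trace_pauli {n : ℕ} (p : F2vec n × F2vec n) (hp : p ≠ 0) : (pauli p).trace = 0 := by
  by_cases hx : p.1 = 0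
  · obtain ⟨i, hi⟩ : ∃ i, p.2 i = 1 := by
      by_contra! h
      refine hp (Prod.ext hx ?_)
      funext i
      rcases zmod_two_cases (p.2 i) with h' | h'
      · exact h'
      · exact absurd h' (h i)
    have key : (pauli p).trace = -(pauli p).trace := by
      unfold Matrix.trace
      rw [← Finset.sum_neg_distrib]
      refine Fintype.sum_equiv (Equiv.addRight (Pi.single i (1 : ZMod 2))) _ _ fun b => ?_
      simp only [Matrix.diag_apply, pauli_apply, hx, add_zero, if_true, Equiv.coe_addRight]
      have h2 : ∑ l, p.2 l * (b + Pi.single i 1 : F2vec n) l = ∑ l, p.2 l * b l + 1 := by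
        simp only [Pi.add_apply, mul_add, Finset.sum_add_distrib]
        congr 1
        rw [Finset.sum_eq_single i] <;> simp +contextual [hi]
      rw [h2, signChar_add, signChar_one]
      ring
    exact self_eq_neg.1 key
  · unfold Matrix.trace
    refine Finset.sum_eq_zero fun b _ => ?_
    rw [Matrix.diag_apply, pauli_apply, if_neg]
    intro h
    exact hx (by simpa using h)

theorem sympl_add_left {n : ℕ} (p p' q : F2vec n × F2vec n) :
    sympl (p + p') q = sympl p q + sympl p' q := by
  unfold sympl
  rw [← Finset.sum_add_distrib]
  refine Finset.sum_congr rfl fun i _ => ?_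
  simp only [Prod.fst_add, Prod.snd_add, Pi.add_apply]
  ring

theorem mem_pSupp {n : ℕ} (p : F2vec n × F2vec n) (i : Fin n) :
    i ∈ pSupp p ↔ p.1 i ≠ 0 ∨ p.2 i ≠ 0 := by simp [pSupp]

theorem notMem_pSupp {n : ℕ} {p : F2vec n × F2vec n} {i : Fin n} :
    i ∉ pSupp p ↔ p.1 i = 0 ∧ p.2 i = 0 := by simp [pSupp]

theorem pSupp_zero {n : ℕ} : pSupp (0 : F2vec n × F2vec n) = ∅ := by simp [pSupp]

theorem pSupp_add_subset {n : ℕ} (p q : F2vec n × F2vec n) :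
    pSupp (p + q) ⊆ pSupp p ∪ pSupp q := by
  intro i hi
  by_contra h
  rw [Finset.mem_union, not_or, notMem_pSupp, notMem_pSupp] at h
  rw [mem_pSupp] at hi
  simp [h.1.1, h.1.2, h.2.1, h.2.2] at hi

theorem sympl_eq_zero_of_disjoint {n : ℕ} {p q : F2vec n × F2vec n}
    (h : Disjoint (pSupp p) (pSupp q)) : sympl p q = 0 := by
  refine Finset.sum_eq_zero fun i _ => ?_
  by_cases hi : i ∈ pSupp p
  · have := notMem_pSupp.1 (Finset.disjoint_left.1 h hi)
    simp [this.1, this.2]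
  · have := notMem_pSupp.1 hi
    simp [this.1, this.2]

theorem mem_syndrome {n m : ℕ} (C : Fin m → F2vec n × F2vec n) (p : F2vec n × F2vec n)
    (j : Fin m) : j ∈ syndrome C p ↔ sympl p (C j) = 1 := by simp [syndrome]

theorem syndrome_add {n m : ℕ} (C : Fin m → F2vec n × F2vec n) (p q : F2vec n × F2vec n) :
    syndrome C (p + q) = symmDiff (syndrome C p) (syndrome C q) := by
  ext j
  rw [Finset.mem_symmDiff, mem_syndrome, mem_syndrome, mem_syndrome, sympl_add_left]
  rcases zmod_two_cases (sympl p (C j)) with h | h <;>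
    rcases zmod_two_cases (sympl q (C j)) with h' | h' <;>
    simp [h, h', show (1 : ZMod 2) + 1 = 0 from rfl]

theorem syndrome_eq_empty {n m : ℕ} (C : Fin m → F2vec n × F2vec n) (p : F2vec n × F2vec n) :
    syndrome C p = ∅ ↔ ∀ j, sympl p (C j) = 0 := by
  constructor
  · intro h j
    rcases zmod_two_cases (sympl p (C j)) with h' | h'
    · exact h'
    · exact absurd ((mem_syndrome C p j).2 h') (by simp [h])
  · intro h
    ext j
    simp [mem_syndrome, h j]

/-! ### Joint eigenprojections of commuting involutions -/

/-- The eigenvalue of the `j`-th check on the sector in which exactly the checks in `σ` are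
violated. -/
def sectorSign {J : Type*} [DecidableEq J] (σ : Finset J) (j : J) : ℂ :=
  if j ∈ σ then -1 else 1

theorem sectorSign_mul_self {J : Type*} [DecidableEq J] (σ : Finset J) (j : J) :
    sectorSign σ j * sectorSign σ j = 1 := by
  unfold sectorSign; split_ifs <;> norm_num

theorem commRing_sectorProj {J R : Type*} [Fintype J] [DecidableEq J] [CommRing R] [Algebra ℂ R]
    (v : J → R) (hs : ∀ j, v j * v j = 1) :
    ∃ proj : Finset J → R, (∑ σ, proj σ = 1) ∧
      (∀ σ j, v j * proj σ = sectorSign σ j • proj σ) ∧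
      (∀ σ, proj σ = ((1 / 2 : ℂ) ^ Fintype.card J) •
        ∑ T, (∏ j ∈ T, sectorSign σ j) • ∏ j ∈ T, v j) := by
  refine ⟨fun σ => ∏ j, (1 / 2 : ℂ) • (1 + sectorSign σ j • v j), ?_, ?_, ?_⟩
  · have h := Finset.prod_add (fun j => (1 / 2 : ℂ) • (1 - v j)) (fun j => (1 / 2 : ℂ) • (1 + v j))
      Finset.univ
    have h1 : ∀ j, (1 / 2 : ℂ) • (1 - v j) + (1 / 2 : ℂ) • (1 + v j) = 1 := fun j => by
      rw [← smul_add, show (1 - v j) + (1 + v j) = (2 : ℂ) • (1 : R) by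
        rw [two_smul]; ring, smul_smul]
      norm_num
    simp only [h1, Finset.prod_const_one, Finset.powerset_univ] at h
    refine Eq.trans (Finset.sum_congr rfl fun σ _ => ?_) h.symm
    beta_reduce
    rw [← Finset.prod_mul_prod_compl σ, ← Finset.compl_eq_univ_sdiff]
    congr 1
    · refine Finset.prod_congr rfl fun j hj => ?_
      rw [sectorSign, if_pos hj, neg_one_smul, ← sub_eq_add_neg]
    · refine Finset.prod_congr rfl fun j hj => ?_
      rw [sectorSign, if_neg (Finset.mem_compl.1 hj), one_smul]
  · intro σ j
    beta_reduce
    rw [← Finset.mul_prod_erase Finset.univ _ (Finset.mem_univ j), ← mul_assoc, ← smul_mul_assoc]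
    congr 1
    rw [mul_smul_comm, mul_add, mul_smul_comm, hs, mul_one, smul_comm (sectorSign σ j),
      smul_add (sectorSign σ j), smul_smul (sectorSign σ j),
      sectorSign_mul_self, one_smul, add_comm]
  · intro σ
    simp only
    rw [Finset.prod_smul, Finset.prod_const, Finset.card_univ, Finset.prod_one_add,
      Finset.powerset_univ]
    simp only [Finset.prod_smul]

theorem exists_sectorProj {J A : Type*} [Fintype J] [DecidableEq J] [Ring A] [Algebra ℂ A]
    (u : J → A) (hc : ∀ i j, u i * u j = u j * u i) (hs : ∀ j, u j * u j = 1) :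
    ∃ proj g : Finset J → A, (∑ σ, proj σ = 1) ∧
      (∀ σ j, u j * proj σ = sectorSign σ j • proj σ) ∧
      (∀ σ j, proj σ * u j = sectorSign σ j • proj σ) ∧
      (∀ σ, proj σ = ((1 / 2 : ℂ) ^ Fintype.card J) • ∑ T, (∏ j ∈ T, sectorSign σ j) • g T) ∧
      g ∅ = 1 ∧ ∀ T j, j ∉ T → g (insert j T) = u j * g T := by
  have hcomm : ∀ a ∈ Set.range u, ∀ b ∈ Set.range u, a * b = b * a := by
    rintro _ ⟨i, rfl⟩ _ ⟨j, rfl⟩; exact hc i j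
  let _ : CommRing (Algebra.adjoin ℂ (Set.range u)) :=
    { (inferInstance : Ring (Algebra.adjoin ℂ (Set.range u))) with
      mul_comm := (Algebra.isMulCommutative_adjoin ℂ hcomm).is_comm.comm }
  let v : J → Algebra.adjoin ℂ (Set.range u) := fun j =>
    ⟨u j, Algebra.subset_adjoin ⟨j, rfl⟩⟩
  obtain ⟨proj, h1, h2, h3⟩ := commRing_sectorProj v (fun j => Subtype.ext (hs j))
  let φ : Algebra.adjoin ℂ (Set.range u) →ₐ[ℂ] A := (Algebra.adjoin ℂ (Set.range u)).val
  refine ⟨fun σ => φ (proj σ), fun T => φ (∏ j ∈ T, v j), ?_, ?_, ?_, ?_, ?_, ?_⟩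
  · rw [← map_sum, h1, map_one]
  · intro σ j
    rw [← map_smul, ← h2, map_mul]; rfl
  · intro σ j
    rw [← map_smul, ← h2, mul_comm, map_mul]; rfl
  · intro σ
    simp only
    rw [h3 σ, map_smul, map_sum]
    simp only [map_smul]
  · simp
  · intro T j hj
    simp only
    rw [Finset.prod_insert hj, map_mul]; rfl

/-- The data of joint eigenprojections of a family of commuting involutions. -/
structure SectorProj {J A : Type*} [Fintype J] [DecidableEq J] [Ring A] [Algebra ℂ A]
    (u : J → A) where
  /-- The eigenprojections. -/
  proj : Finset J → A
  sum_proj : ∑ σ, proj σ = 1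
  mul_proj : ∀ σ j, u j * proj σ = sectorSign σ j • proj σ
  proj_mul : ∀ σ j, proj σ * u j = sectorSign σ j • proj σ

namespace SectorProj

variable {J A : Type*} [Fintype J] [DecidableEq J] [Ring A] [Algebra ℂ A] {u : J → A}

theorem sandwich_eq_zero (P : SectorProj u) {x : A} {s σ τ : Finset J}
    (hx : ∀ j, u j * x = sectorSign s j • (x * u j)) (h : τ ≠ symmDiff σ s) :
    P.proj τ * x * P.proj σ = 0 := by
  obtain ⟨j, hj⟩ : ∃ j, ¬ (j ∈ τ ↔ j ∈ symmDiff σ s) := by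
    by_contra! h'; exact h (Finset.ext h')
  have h1 : P.proj τ * (u j * x) * P.proj σ = sectorSign τ j • (P.proj τ * x * P.proj σ) := by
    rw [← mul_assoc, P.proj_mul, smul_mul_assoc, smul_mul_assoc]
  have h2 : P.proj τ * (u j * x) * P.proj σ =
      (sectorSign s j * sectorSign σ j) • (P.proj τ * x * P.proj σ) := by
    rw [hx, mul_smul_comm, smul_mul_assoc, mul_assoc, mul_assoc x, P.mul_proj, mul_smul_comm,
      mul_smul_comm, smul_smul, ← mul_assoc]
  rw [h1, ← sub_eq_zero, ← sub_smul] at h2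
  have h3 : sectorSign τ j - sectorSign s j * sectorSign σ j ≠ 0 := by
    rw [Finset.mem_symmDiff] at hj
    unfold sectorSign
    by_cases a1 : j ∈ τ <;> by_cases a2 : j ∈ s <;> by_cases a3 : j ∈ σ <;>
      simp [a1, a2, a3] at hj ⊢ <;> norm_num
  have h4 := congrArg (fun y => (sectorSign τ j - sectorSign s j * sectorSign σ j)⁻¹ • y) h2
  simpa [smul_smul, inv_mul_cancel₀ h3] using h4

theorem intertwine (P : SectorProj u) {x : A} {s : Finset J}
    (hx : ∀ j, u j * x = sectorSign s j • (x * u j)) (σ : Finset J) :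
    x * P.proj σ = P.proj (symmDiff σ s) * x := by
  have h1 : x * P.proj σ = P.proj (symmDiff σ s) * x * P.proj σ := by
    calc x * P.proj σ = ∑ τ, P.proj τ * x * P.proj σ := by
          rw [← Finset.sum_mul, ← Finset.sum_mul, P.sum_proj, one_mul]
      _ = _ := Finset.sum_eq_single _ (fun τ _ h => P.sandwich_eq_zero hx h) (by simp)
  have h2 : P.proj (symmDiff σ s) * x = P.proj (symmDiff σ s) * x * P.proj σ := by
    calc P.proj (symmDiff σ s) * x = ∑ τ, P.proj (symmDiff σ s) * x * P.proj τ := by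
          rw [← Finset.mul_sum, P.sum_proj, mul_one]
      _ = _ := Finset.sum_eq_single _ (fun τ _ h => P.sandwich_eq_zero hx (by
          intro h'; exact h (symmDiff_left_injective s h').symm)) (by simp)
  exact h1.trans h2.symm

theorem mul_proj_of_ne (P : SectorProj u) {σ τ : Finset J} (h : σ ≠ τ) :
    P.proj σ * P.proj τ = 0 := by
  have := P.sandwich_eq_zero (x := 1) (s := ∅) (σ := τ) (τ := σ)
    (fun j => by simp [sectorSign]) (by simpa [← Finset.bot_eq_empty] using h)
  simpa using this

theorem proj_mul_self (P : SectorProj u) (σ : Finset J) : P.proj σ * P.proj σ = P.proj σ := by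
  calc P.proj σ * P.proj σ = ∑ τ, P.proj σ * P.proj τ :=
        (Finset.sum_eq_single _ (fun τ _ h => P.mul_proj_of_ne h.symm) (by simp)).symm
    _ = P.proj σ := by rw [← Finset.mul_sum, P.sum_proj, mul_one]

theorem star_proj [StarRing A] [StarModule ℂ A] (P : SectorProj u) (hu : ∀ j, star (u j) = u j)
    (σ : Finset J) : star (P.proj σ) = P.proj σ := by
  have hsign : ∀ (ρ : Finset J) j, star (sectorSign ρ j) = sectorSign ρ j := fun ρ j => by
    unfold sectorSign; split_ifs <;> simp
  let P' : SectorProj u :=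
    { proj := fun τ => star (P.proj τ)
      sum_proj := by rw [← star_sum, P.sum_proj, star_one]
      mul_proj := fun τ j => by
        rw [← hsign, ← star_smul, ← P.proj_mul, star_mul, hu]
      proj_mul := fun τ j => by
        rw [← hsign, ← star_smul, ← P.mul_proj, star_mul, hu] }
  have key : ∀ τ, τ ≠ σ → star (P.proj σ) * P.proj τ = 0 := by
    intro τ hτ
    obtain ⟨j, hj⟩ : ∃ j, ¬ (j ∈ τ ↔ j ∈ σ) := by
      by_contra! h'; exact hτ (Finset.ext h')
    have h1 : star (P.proj σ) * u j * P.proj τ = sectorSign σ j • (star (P.proj σ) * P.proj τ) := by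
      rw [P'.proj_mul σ j, smul_mul_assoc]
    have h2 : star (P.proj σ) * u j * P.proj τ = sectorSign τ j • (star (P.proj σ) * P.proj τ) := by
      rw [mul_assoc, P.mul_proj, mul_smul_comm]
    rw [h1, ← sub_eq_zero, ← sub_smul] at h2
    have h3 : sectorSign σ j - sectorSign τ j ≠ 0 := by
      unfold sectorSign
      by_cases a1 : j ∈ τ <;> by_cases a3 : j ∈ σ <;>
        simp [a1, a3] at hj ⊢ <;> norm_num
    have h4 := congrArg (fun y => (sectorSign σ j - sectorSign τ j)⁻¹ • y) h2
    simpa [smul_smul, inv_mul_cancel₀ h3] using h4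
  have h : star (P.proj σ) = star (P.proj σ) * P.proj σ := by
    calc star (P.proj σ) = ∑ τ, star (P.proj σ) * P.proj τ := by
          rw [← Finset.mul_sum, P.sum_proj, mul_one]
      _ = _ := Finset.sum_eq_single _ (fun τ _ h => key τ h) (by simp)
  calc star (P.proj σ) = star (P.proj σ) * P.proj σ := h
    _ = star (star (P.proj σ) * P.proj σ) := by rw [star_mul, star_star]
    _ = P.proj σ := by rw [← h, star_star]

end SectorProj

/-! ### Families of operators indexed by regions and syndromes -/

/-- A region of qubits together with a set of checks. -/
abbrev PatchLabel (n m : ℕ) := Finset (Fin n) × Finset (Fin m)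

/-- The label of a product of two operators. -/
def PatchLabel.join {n m : ℕ} (a b : PatchLabel n m) : PatchLabel n m :=
  (a.1 ∪ b.1, symmDiff a.2 b.2)

/-- Two labels meet if their regions intersect. -/
def PatchLabel.Meets {n m : ℕ} (a b : PatchLabel n m) : Prop := ∃ i ∈ a.1, i ∈ b.1

/-- The sum of `f` over all labels whose region contains `i`. -/
def siteSum {n m : ℕ} (f : PatchLabel n m → ℝ) (i : Fin n) : ℝ :=
  ∑ a, if i ∈ a.1 then f a else 0

/-- The exponentially weighted norm of one member of a family. -/
def wnorm {n m : ℕ} {A : Type*} [NormedRing A] (κ : ℝ) (X : PatchLabel n m → A)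
    (a : PatchLabel n m) : ℝ :=
  ‖X a‖ * Real.exp (κ * a.1.card)

/-- The local strength of the family `X` at decay rate `κ` is at most `x`. -/
def LocLe {n m : ℕ} {A : Type*} [NormedRing A] (κ : ℝ) (X : PatchLabel n m → A) (x : ℝ) : Prop :=
  ∀ i, siteSum (wnorm κ X) i ≤ x

section Families

variable {n m : ℕ} {A : Type*} [NormedRing A]

theorem siteSum_mono {f g : PatchLabel n m → ℝ} (h : ∀ a, f a ≤ g a) (i : Fin n) :
    siteSum f i ≤ siteSum g i := by
  refine Finset.sum_le_sum fun a _ => ?_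
  split_ifs
  · exact h a
  · exact le_rfl

theorem siteSum_nonneg {f : PatchLabel n m → ℝ} (h : ∀ a, 0 ≤ f a) (i : Fin n) :
    0 ≤ siteSum f i :=
  Finset.sum_nonneg fun a _ => by split_ifs; exacts [h a, le_rfl]

theorem siteSum_add (f g : PatchLabel n m → ℝ) (i : Fin n) :
    siteSum (fun a => f a + g a) i = siteSum f i + siteSum g i := by
  unfold siteSum
  rw [← Finset.sum_add_distrib]
  refine Finset.sum_congr rfl fun a _ => ?_
  split_ifs <;> simp

theorem siteSum_const_mul (c : ℝ) (f : PatchLabel n m → ℝ) (i : Fin n) :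
    siteSum (fun a => c * f a) i = c * siteSum f i := by
  unfold siteSum
  rw [Finset.mul_sum]
  refine Finset.sum_congr rfl fun a _ => ?_
  split_ifs <;> simp

theorem le_siteSum {f : PatchLabel n m → ℝ} (h : ∀ a, 0 ≤ f a) {a : PatchLabel n m} {i : Fin n}
    (hi : i ∈ a.1) : f a ≤ siteSum f i := by
  have := Finset.single_le_sum (f := fun a : PatchLabel n m => if i ∈ a.1 then f a else 0)
    (fun b _ => by split_ifs; exacts [h b, le_rfl]) (Finset.mem_univ a)
  simpa [hi, siteSum] using this

theorem wnorm_nonneg (κ : ℝ) (X : PatchLabel n m → A) (a : PatchLabel n m) : 0 ≤ wnorm κ X a :=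
  mul_nonneg (norm_nonneg _) (Real.exp_pos _).le

theorem wnorm_le_of_norm_le {B : Type*} [NormedRing B] {κ : ℝ} {X : PatchLabel n m → A}
    {Y : PatchLabel n m → B} {a : PatchLabel n m} {c : ℝ} (h : ‖X a‖ ≤ c * ‖Y a‖) :
    wnorm κ X a ≤ c * wnorm κ Y a := by
  unfold wnorm
  rw [← mul_assoc]
  exact mul_le_mul_of_nonneg_right h (Real.exp_pos _).le

theorem LocLe.of_norm_le {κ c y : ℝ} {X Y : PatchLabel n m → A} (hY : LocLe κ Y y) (hc : 0 ≤ c)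
    (h : ∀ a, ‖X a‖ ≤ c * ‖Y a‖) : LocLe κ X (c * y) := fun i =>
  calc siteSum (wnorm κ X) i ≤ siteSum (fun a => c * wnorm κ Y a) i :=
        siteSum_mono (fun a => wnorm_le_of_norm_le (h a)) i
    _ = c * siteSum (wnorm κ Y) i := siteSum_const_mul _ _ _
    _ ≤ c * y := mul_le_mul_of_nonneg_left (hY i) hc

theorem LocLe.of_norm_le' {κ y : ℝ} {X Y : PatchLabel n m → A} (hY : LocLe κ Y y)
    (h : ∀ a, ‖X a‖ ≤ ‖Y a‖) : LocLe κ X y := by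
  have := hY.of_norm_le (X := X) zero_le_one (fun a => by rw [one_mul]; exact h a)
  rwa [one_mul] at this

theorem LocLe.mono {κ x y : ℝ} {X : PatchLabel n m → A} (h : LocLe κ X x) (hxy : x ≤ y) :
    LocLe κ X y := fun i => (h i).trans hxy

theorem LocLe.mono_rate {κ κ' x : ℝ} {X : PatchLabel n m → A} (h : LocLe κ X x) (hκ : κ' ≤ κ) :
    LocLe κ' X x := fun i => le_trans (siteSum_mono (fun a => by
  unfold wnorm
  gcongr) i) (h i)

theorem LocLe.add {κ x y : ℝ} {X Y : PatchLabel n m → A} (hX : LocLe κ X x) (hY : LocLe κ Y y) :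
    LocLe κ (X + Y) (x + y) := fun i =>
  calc siteSum (wnorm κ (X + Y)) i ≤ siteSum (fun a => wnorm κ X a + wnorm κ Y a) i :=
        siteSum_mono (fun a => by
          unfold wnorm
          rw [← add_mul]
          exact mul_le_mul_of_nonneg_right (norm_add_le _ _) (Real.exp_pos _).le) i
    _ = siteSum (wnorm κ X) i + siteSum (wnorm κ Y) i := siteSum_add _ _ _
    _ ≤ x + y := add_le_add (hX i) (hY i)

theorem LocLe.neg {κ x : ℝ} {X : PatchLabel n m → A} (hX : LocLe κ X x) : LocLe κ (-X) x :=
  hX.of_norm_le' fun a => by simp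

theorem LocLe.sub {κ x y : ℝ} {X Y : PatchLabel n m → A} (hX : LocLe κ X x) (hY : LocLe κ Y y) :
    LocLe κ (X - Y) (x + y) := by
  rw [sub_eq_add_neg]
  exact hX.add hY.neg

theorem sum_mul_wnorm_add_le {κ μ μ' : ℝ} {X Y : PatchLabel n m → A}
    {g : PatchLabel n m → ℝ} (hg : ∀ a, 0 ≤ g a)
    (hX : (∑ a, g a * wnorm κ X a) ≤ μ) (hY : (∑ a, g a * wnorm κ Y a) ≤ μ') :
    (∑ a, g a * wnorm κ (X + Y) a) ≤ μ + μ' := by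
  refine le_trans ?_ (add_le_add hX hY)
  rw [← Finset.sum_add_distrib]
  refine Finset.sum_le_sum fun a _ => ?_
  rw [← mul_add]
  refine mul_le_mul_of_nonneg_left ?_ (hg a)
  unfold wnorm
  rw [← add_mul]
  exact mul_le_mul_of_nonneg_right (norm_add_le _ _) (Real.exp_pos _).le

theorem wnorm_mono_rate {κ κ' : ℝ} (h : κ' ≤ κ) (X : PatchLabel n m → A) (a : PatchLabel n m) :
    wnorm κ' X a ≤ wnorm κ X a := by
  unfold wnorm
  gcongr

theorem card_le_exp_div {δ : ℝ} (hδ : 0 < δ) (N : ℕ) : (N : ℝ) ≤ Real.exp (δ * N) / δ := by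
  rw [le_div_iff₀ hδ]
  have := Real.add_one_le_exp (δ * N)
  nlinarith

theorem siteSum_card_mul_le {κ δ x : ℝ} {X : PatchLabel n m → A} (hδ : 0 < δ)
    (hX : LocLe κ X x) (i : Fin n) :
    siteSum (fun a => (a.1.card : ℝ) * wnorm (κ - δ) X a) i ≤ x / δ := by
  calc siteSum (fun a => (a.1.card : ℝ) * wnorm (κ - δ) X a) i
      ≤ siteSum (fun a => δ⁻¹ * wnorm κ X a) i := siteSum_mono (fun a => by
        unfold wnorm
        have h := card_le_exp_div hδ a.1.card
        calc (a.1.card : ℝ) * (‖X a‖ * Real.exp ((κ - δ) * a.1.card))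
            ≤ (Real.exp (δ * a.1.card) / δ) * (‖X a‖ * Real.exp ((κ - δ) * a.1.card)) := by
              gcongr
          _ = δ⁻¹ * (‖X a‖ * (Real.exp (δ * a.1.card) * Real.exp ((κ - δ) * a.1.card))) := by
              ring
          _ = _ := by rw [← Real.exp_add]; ring_nf) i
    _ = δ⁻¹ * siteSum (wnorm κ X) i := siteSum_const_mul _ _ _
    _ ≤ δ⁻¹ * x := mul_le_mul_of_nonneg_left (hX i) (by positivity)
    _ = x / δ := by ring

/-- Summing `g` over all labels meeting the region of a fixed label. -/
theorem sum_meets_le {g : PatchLabel n m → ℝ} {G : ℝ} (hg : ∀ b, 0 ≤ g b)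
    (hG : ∀ i, siteSum g i ≤ G) (a : PatchLabel n m) :
    (∑ b, if a.Meets b then g b else 0) ≤ (a.1.card : ℝ) * G := by
  calc (∑ b, if a.Meets b then g b else 0)
      ≤ ∑ b : PatchLabel n m, ∑ i ∈ a.1, if i ∈ b.1 then g b else 0 := by
        refine Finset.sum_le_sum fun b _ => ?_
        have hnn : ∀ i ∈ a.1, 0 ≤ if i ∈ b.1 then g b else 0 := fun i _ => by
          split_ifs; exacts [hg b, le_rfl]
        split_ifs with h
        · obtain ⟨i, hi, hi'⟩ := h
          have := Finset.single_le_sum hnn hi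
          simpa [hi'] using this
        · exact Finset.sum_nonneg hnn
    _ = ∑ i ∈ a.1, siteSum g i := Finset.sum_comm
    _ ≤ ∑ _i ∈ a.1, G := Finset.sum_le_sum fun i _ => hG i
    _ = _ := by rw [Finset.sum_const, nsmul_eq_mul]

theorem sum_site_sum_meets_le {f g : PatchLabel n m → ℝ} {G : ℝ} (hf : ∀ a, 0 ≤ f a)
    (hg : ∀ b, 0 ≤ g b) (hG : ∀ i, siteSum g i ≤ G) (i : Fin n) :
    (∑ a : PatchLabel n m, ∑ b, if i ∈ a.1 ∧ a.Meets b then f a * g b else 0) ≤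
      siteSum (fun a => (a.1.card : ℝ) * f a) i * G := by
  unfold siteSum
  rw [Finset.sum_mul]
  refine Finset.sum_le_sum fun a _ => ?_
  by_cases hi : i ∈ a.1
  · simp only [hi, true_and, if_true]
    calc (∑ b, if a.Meets b then f a * g b else 0) = f a * ∑ b, if a.Meets b then g b else 0 := by
          rw [Finset.mul_sum]
          exact Finset.sum_congr rfl fun b _ => by split_ifs <;> simp
      _ ≤ f a * ((a.1.card : ℝ) * G) :=
          mul_le_mul_of_nonneg_left (sum_meets_le hg hG a) (hf a)
      _ = _ := by ring
  · simp [hi]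

theorem PatchLabel.Meets.symm {a b : PatchLabel n m} (h : a.Meets b) : b.Meets a := by
  obtain ⟨i, h1, h2⟩ := h
  exact ⟨i, h2, h1⟩

theorem exp_join_le {κ : ℝ} (hκ : 0 ≤ κ) (a b : PatchLabel n m) :
    Real.exp (κ * (a.join b).1.card) ≤ Real.exp (κ * a.1.card) * Real.exp (κ * b.1.card) := by
  rw [← Real.exp_add, ← mul_add]
  refine Real.exp_le_exp.2 (mul_le_mul_of_nonneg_left ?_ hκ)
  exact_mod_cast Finset.card_union_le a.1 b.1

/-- The commutator of two families, keeping only the pairs selected by `χ`. -/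
def bracket (χ : PatchLabel n m → PatchLabel n m → Prop) (X Y : PatchLabel n m → A)
    (c : PatchLabel n m) : A :=
  ∑ a, ∑ b, if a.join b = c ∧ χ a b then X a * Y b - Y b * X a else 0

theorem norm_commutator_le (x y : A) : ‖x * y - y * x‖ ≤ 2 * (‖x‖ * ‖y‖) :=
  calc ‖x * y - y * x‖ ≤ ‖x * y‖ + ‖y * x‖ := norm_sub_le _ _
    _ ≤ ‖x‖ * ‖y‖ + ‖y‖ * ‖x‖ := add_le_add (norm_mul_le _ _) (norm_mul_le _ _)
    _ = _ := by ring

theorem norm_bracket_le (χ : PatchLabel n m → PatchLabel n m → Prop) (X Y : PatchLabel n m → A)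
    (c : PatchLabel n m) :
    ‖bracket χ X Y c‖ ≤
      ∑ a, ∑ b, if a.join b = c ∧ χ a b then 2 * (‖X a‖ * ‖Y b‖) else 0 := by
  refine (norm_sum_le _ _).trans (Finset.sum_le_sum fun a _ => (norm_sum_le _ _).trans
    (Finset.sum_le_sum fun b _ => ?_))
  split_ifs
  · exact norm_commutator_le _ _
  · simp

theorem siteSum_bracket_le {κ : ℝ} (hκ : 0 ≤ κ) (χ : PatchLabel n m → PatchLabel n m → Prop)
    (X Y : PatchLabel n m → A) (i : Fin n) :
    siteSum (wnorm κ (bracket χ X Y)) i ≤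
      2 * ((∑ a : PatchLabel n m, ∑ b, if i ∈ a.1 ∧ χ a b then wnorm κ X a * wnorm κ Y b else 0) +
        ∑ a : PatchLabel n m, ∑ b : PatchLabel n m,
          if i ∈ b.1 ∧ χ a b then wnorm κ X a * wnorm κ Y b else 0) := by
  calc siteSum (wnorm κ (bracket χ X Y)) i
      ≤ ∑ c : PatchLabel n m, ∑ a, ∑ b, if a.join b = c ∧ χ a b then
          (if i ∈ (a.join b).1 then
            2 * (‖X a‖ * ‖Y b‖) * Real.exp (κ * (a.join b).1.card) else 0) else 0 := by
        refine Finset.sum_le_sum fun c _ => ?_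
        by_cases hi : i ∈ c.1
        · rw [if_pos hi]
          unfold wnorm
          refine (mul_le_mul_of_nonneg_right (norm_bracket_le χ X Y c) (Real.exp_pos _).le).trans ?_
          rw [Finset.sum_mul]
          refine Finset.sum_le_sum fun a _ => ?_
          rw [Finset.sum_mul]
          refine Finset.sum_le_sum fun b _ => ?_
          split_ifs with h1 h2
          · rw [h1.1]
          · rw [h1.1] at h2; exact absurd hi h2
          · simp
        · rw [if_neg hi]
          refine Finset.sum_nonneg fun a _ => Finset.sum_nonneg fun b _ => ?_
          split_ifs <;> positivity
    _ = ∑ a : PatchLabel n m, ∑ b : PatchLabel n m, if χ a b then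
          (if i ∈ (a.join b).1 then
            2 * (‖X a‖ * ‖Y b‖) * Real.exp (κ * (a.join b).1.card) else 0) else 0 := by
        rw [Finset.sum_comm]
        refine Finset.sum_congr rfl fun a _ => ?_
        rw [Finset.sum_comm]
        refine Finset.sum_congr rfl fun b _ => ?_
        rw [Finset.sum_eq_single (a.join b)]
        · simp
        · intro c _ hc
          rw [if_neg fun h => hc h.1.symm]
        · simp
    _ ≤ _ := by
        rw [← Finset.sum_add_distrib, Finset.mul_sum]
        refine Finset.sum_le_sum fun a _ => ?_
        rw [← Finset.sum_add_distrib, Finset.mul_sum]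
        refine Finset.sum_le_sum fun b _ => ?_
        by_cases hχ : χ a b
        · have hw : 2 * (‖X a‖ * ‖Y b‖) * Real.exp (κ * (a.join b).1.card) ≤
              2 * (wnorm κ X a * wnorm κ Y b) := by
            unfold wnorm
            calc 2 * (‖X a‖ * ‖Y b‖) * Real.exp (κ * (a.join b).1.card)
                ≤ 2 * (‖X a‖ * ‖Y b‖) *
                    (Real.exp (κ * a.1.card) * Real.exp (κ * b.1.card)) :=
                  mul_le_mul_of_nonneg_left (exp_join_le hκ a b) (by positivity)
              _ = _ := by ring
          have hnn := mul_nonneg (wnorm_nonneg κ X a) (wnorm_nonneg κ Y b)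
          have hmem : i ∈ (a.join b).1 ↔ i ∈ a.1 ∨ i ∈ b.1 := by simp [PatchLabel.join]
          simp only [hχ, and_true, if_true, hmem]
          by_cases h1 : i ∈ a.1 <;> by_cases h2 : i ∈ b.1 <;> simp [h1, h2] <;> linarith
        · simp [hχ]

theorem LocLe.bracket {κ δ x y : ℝ} {X Y : PatchLabel n m → A}
    {χ : PatchLabel n m → PatchLabel n m → Prop} (hχ : ∀ a b, χ a b → a.Meets b)
    (hδ : 0 < δ) (hκ : 0 ≤ κ - δ) (hx : 0 ≤ x) (hy : 0 ≤ y)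
    (hX : LocLe κ X x) (hY : LocLe κ Y y) :
    LocLe (κ - δ) (bracket χ X Y) (4 / δ * (x * y)) := fun i => by
  have hX' : LocLe (κ - δ) X x := hX.mono_rate (by linarith)
  have hY' : LocLe (κ - δ) Y y := hY.mono_rate (by linarith)
  have key : ∀ (F G : PatchLabel n m → A) (f g : ℝ), 0 ≤ g → LocLe κ F f → LocLe (κ - δ) G g →
      (∑ a : PatchLabel n m, ∑ b,
        if i ∈ a.1 ∧ a.Meets b then wnorm (κ - δ) F a * wnorm (κ - δ) G b else 0) ≤
        f * g / δ := fun F G f g hg hF hG => by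
    refine (sum_site_sum_meets_le (wnorm_nonneg _ F) (wnorm_nonneg _ G) hG i).trans ?_
    refine (mul_le_mul_of_nonneg_right (siteSum_card_mul_le hδ hF i) hg).trans (le_of_eq ?_)
    ring
  refine (siteSum_bracket_le hκ χ X Y i).trans ?_
  have h1 : (∑ a : PatchLabel n m, ∑ b,
      if i ∈ a.1 ∧ χ a b then wnorm (κ - δ) X a * wnorm (κ - δ) Y b else 0) ≤ x * y / δ := by
    refine le_trans ?_ (key X Y x y hy hX hY')
    refine Finset.sum_le_sum fun a _ => Finset.sum_le_sum fun b _ => ?_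
    have hnn := mul_nonneg (wnorm_nonneg (κ - δ) X a) (wnorm_nonneg (κ - δ) Y b)
    split_ifs with h1 h2
    · exact le_rfl
    · exact absurd ⟨h1.1, hχ _ _ h1.2⟩ h2
    · exact hnn
    · exact le_rfl
  have h2 : (∑ a : PatchLabel n m, ∑ b : PatchLabel n m,
      if i ∈ b.1 ∧ χ a b then wnorm (κ - δ) X a * wnorm (κ - δ) Y b else 0) ≤ x * y / δ := by
    rw [Finset.sum_comm, mul_comm x y]
    refine le_trans ?_ (key Y X y x hx hY hX')
    refine Finset.sum_le_sum fun a _ => Finset.sum_le_sum fun b _ => ?_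
    have hnn := mul_nonneg (wnorm_nonneg (κ - δ) X b) (wnorm_nonneg (κ - δ) Y a)
    rw [mul_comm (wnorm (κ - δ) Y a)]
    split_ifs with h1 h2
    · exact le_rfl
    · exact absurd ⟨h1.1, (hχ _ _ h1.2).symm⟩ h2
    · exact hnn
    · exact le_rfl
  calc _ ≤ 2 * (x * y / δ + x * y / δ) := by gcongr
    _ = _ := by ring

end Families

/-! ### Conjugation by an exponential as a series of iterated commutators -/

section Conjugation

variable {A : Type*} [NormedRing A]

/-- The commutator `x * t - t * x`. -/
def rightAd (t x : A) : A := x * t - t * x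

variable [NormedAlgebra ℂ A] [CompleteSpace A]

theorem exp_neg_mul_exp (t : A) : NormedSpace.exp (-t) * NormedSpace.exp t = 1 := by
  let _ : NormedAlgebra ℚ A := NormedAlgebra.restrictScalars ℚ ℂ A
  rw [← NormedSpace.exp_add_of_commute (Commute.neg_left (Commute.refl t)), neg_add_cancel,
    NormedSpace.exp_zero]

theorem exp_mul_exp_neg (t : A) : NormedSpace.exp t * NormedSpace.exp (-t) = 1 := by
  simpa using exp_neg_mul_exp (-t)

theorem hasSum_conj_exp (t h : A) :
    HasSum (fun j : ℕ => ((j.factorial : ℂ)⁻¹) • (rightAd t)^[j] h)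
      (NormedSpace.exp (-t) * h * NormedSpace.exp t) := by
  let _ : NormedAlgebra ℚ (A →L[ℂ] A) := NormedAlgebra.restrictScalars ℚ ℂ _
  let L : A →L[ℂ] A := ContinuousLinearMap.mul ℂ A (-t)
  let R : A →L[ℂ] A := (ContinuousLinearMap.mul ℂ A).flip t
  have hL : ∀ x, L x = -t * x := fun x => rfl
  have hR : ∀ x, R x = x * t := fun x => rfl
  have hcomm : Commute L R := by
    refine ContinuousLinearMap.ext fun x => ?_
    change L (R x) = R (L x)
    rw [hL, hR, hL, hR, mul_assoc]
  have hLj : ∀ (j : ℕ) x, (L ^ j) x = (-t) ^ j * x := by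
    intro j
    induction j with
    | zero => intro x; simp
    | succ j ih => intro x; rw [pow_succ, mul_apply_eq_comp, ih, hL, pow_succ, mul_assoc]
  have hRj : ∀ (j : ℕ) x, (R ^ j) x = x * t ^ j := by
    intro j
    induction j with
    | zero => intro x; simp
    | succ j ih =>
      intro x
      rw [pow_succ, mul_apply_eq_comp, ih, hR, pow_succ', mul_assoc]
  have hadj : ∀ (j : ℕ) x, ((L + R) ^ j) x = (rightAd t)^[j] x := by
    intro j
    induction j with
    | zero => intro x; simp
    | succ j ih =>
      intro x
      rw [pow_succ, mul_apply_eq_comp, ih, Function.iterate_succ_apply]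
      congr 1
      rw [add_apply, hL, hR, rightAd, neg_mul, add_comm, sub_eq_add_neg]
  have eval : ∀ (M : A →L[ℂ] A) x,
      HasSum (fun j : ℕ => ((j.factorial : ℂ)⁻¹) • (M ^ j) x) (NormedSpace.exp M x) := by
    intro M x
    exact (NormedSpace.exp_series_hasSum_exp' (𝕂 := ℂ) M).mapL (ContinuousLinearMap.apply ℂ A x)
  have hexpL : ∀ x, NormedSpace.exp L x = NormedSpace.exp (-t) * x := fun x => by
    refine (eval L x).unique ?_
    have := (NormedSpace.exp_series_hasSum_exp' (𝕂 := ℂ) (-t)).mul_right x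
    simpa only [hLj, smul_mul_assoc] using this
  have hexpR : ∀ x, NormedSpace.exp R x = x * NormedSpace.exp t := fun x => by
    refine (eval R x).unique ?_
    have := (NormedSpace.exp_series_hasSum_exp' (𝕂 := ℂ) t).mul_left x
    simpa only [hRj, mul_smul_comm] using this
  have h1 := eval (L + R) h
  rw [NormedSpace.exp_add_of_commute hcomm, mul_apply_eq_comp, hexpR, hexpL,
    ← mul_assoc] at h1
  simpa only [hadj] using h1

end Conjugation

/-! ### Series of iterated brackets -/

section Series

variable {n m : ℕ} {A : Type*} [NormedRing A]

/-- The sum of all members of a family. -/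
def total (X : PatchLabel n m → A) : A := ∑ a, X a

theorem total_add (X Y : PatchLabel n m → A) : total (X + Y) = total X + total Y :=
  Finset.sum_add_distrib

theorem total_sub (X Y : PatchLabel n m → A) : total (X - Y) = total X - total Y :=
  Finset.sum_sub_distrib _ _

/-- Restricting a family to the labels satisfying a predicate. -/
def famRestrict (p : PatchLabel n m → Prop) (X : PatchLabel n m → A) (a : PatchLabel n m) : A :=
  if p a then X a else 0

theorem norm_famRestrict_le (p : PatchLabel n m → Prop) (X : PatchLabel n m → A)
    (a : PatchLabel n m) : ‖famRestrict p X a‖ ≤ ‖X a‖ := by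
  unfold famRestrict
  split_ifs <;> simp

/-- The bracket with a fixed family on the right. -/
def famAd (T X : PatchLabel n m → A) : PatchLabel n m → A := bracket PatchLabel.Meets X T

theorem total_bracket (χ : PatchLabel n m → PatchLabel n m → Prop) (X Y : PatchLabel n m → A) :
    total (bracket χ X Y) = ∑ a, ∑ b, if χ a b then X a * Y b - Y b * X a else 0 := by
  unfold total bracket
  rw [Finset.sum_comm]
  refine Finset.sum_congr rfl fun a _ => ?_
  rw [Finset.sum_comm]
  refine Finset.sum_congr rfl fun b _ => ?_
  rw [Finset.sum_eq_single (a.join b)]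
  · simp
  · intro c _ hc
    rw [if_neg fun h => hc h.1.symm]
  · simp

theorem total_famAd {T X : PatchLabel n m → A}
    (h : ∀ a b, ¬ a.Meets b → X a * T b = T b * X a) :
    total (famAd T X) = rightAd (total T) (total X) := by
  rw [famAd, total_bracket, rightAd, total, total, Finset.sum_mul_sum, Finset.sum_mul_sum,
    Finset.sum_comm (f := fun a b => T a * X b), ← Finset.sum_sub_distrib]
  refine Finset.sum_congr rfl fun a _ => ?_
  rw [← Finset.sum_sub_distrib]
  refine Finset.sum_congr rfl fun b _ => ?_
  split_ifs with hab
  · rfl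
  · rw [h a b hab, sub_self]

theorem bracket_apply_empty {χ : PatchLabel n m → PatchLabel n m → Prop}
    (hχ : ∀ a b, χ a b → a.Meets b) (X Y : PatchLabel n m → A) {c : PatchLabel n m}
    (hc : c.1 = ∅) : bracket χ X Y c = 0 := by
  refine Finset.sum_eq_zero fun a _ => Finset.sum_eq_zero fun b _ => ?_
  rw [if_neg]
  rintro ⟨h1, h2⟩
  obtain ⟨i, hi, -⟩ := hχ a b h2
  rw [← h1] at hc
  have : i ∈ (a.join b).1 := Finset.mem_union_left _ hi
  rw [hc] at this
  simp at this

theorem LocLe.famAd_iterate {κ η t x : ℝ} {T X : PatchLabel n m → A} (hη : 0 < η) (ht : 0 ≤ t)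
    (hx : 0 ≤ x) (hT : LocLe κ T t) (hX : LocLe κ X x) (j : ℕ) (hκ : 0 ≤ κ - j * η) :
    LocLe (κ - j * η) ((famAd T)^[j] X) ((4 / η * t) ^ j * x) := by
  induction j with
  | zero => simpa using hX
  | succ j ih =>
    push_cast at hκ ⊢
    have hκ' : 0 ≤ κ - j * η := by linarith
    have h1 := ih hκ'
    rw [Function.iterate_succ_apply']
    have hT' : LocLe (κ - j * η) T t := hT.mono_rate (by
      have : 0 ≤ (j : ℝ) * η := by positivity
      linarith)
    have h2 := LocLe.bracket (χ := PatchLabel.Meets) (fun _ _ h => h) hη (by linarith)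
      (by positivity) ht h1 hT'
    have e1 : κ - (j + 1) * η = κ - j * η - η := by ring
    rw [e1]
    refine LocLe.mono h2 (le_of_eq ?_)
    ring

theorem LocLe.famAd_iterate_div_factorial {κ δ t x : ℝ} {T X : PatchLabel n m → A} (hδ : 0 < δ)
    (ht : 0 ≤ t) (hx : 0 ≤ x) (hκ : 0 ≤ κ - δ) (hT : LocLe κ T t) (hX : LocLe κ X x) (j : ℕ) :
    LocLe (κ - δ) ((famAd T)^[j] X) (j.factorial * ((12 * t / δ) ^ j * x)) := by
  rcases Nat.eq_zero_or_pos j with rfl | hj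
  · simpa using hX.mono_rate (by linarith)
  have hj' : (0 : ℝ) < j := by exact_mod_cast hj
  have e : (j : ℝ) * (δ / j) = δ := by field_simp
  have h := LocLe.famAd_iterate (η := δ / j) (by positivity) ht hx hT hX j (by rw [e]; exact hκ)
  rw [e] at h
  refine h.mono ?_
  have h1 : (j : ℝ) ^ j ≤ j.factorial * 3 ^ j := by
    have h2 := Real.pow_div_factorial_le_exp (x := (j : ℝ)) hj'.le j
    rw [div_le_iff₀ (by positivity)] at h2
    have h3 : Real.exp (j : ℝ) ≤ 3 ^ j := by
      rw [show (j : ℝ) = j * 1 by ring, Real.exp_nat_mul]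
      exact pow_le_pow_left₀ (Real.exp_pos _).le Real.exp_one_lt_three.le j
    calc (j : ℝ) ^ j ≤ Real.exp j * j.factorial := h2
      _ ≤ 3 ^ j * j.factorial := by gcongr
      _ = _ := by ring
  calc (4 / (δ / j) * t) ^ j * x = (j : ℝ) ^ j * ((4 * t / δ) ^ j * x) := by
        rw [show 4 / (δ / j) * t = j * (4 * t / δ) by field_simp, mul_pow]; ring
    _ ≤ (j.factorial * 3 ^ j) * ((4 * t / δ) ^ j * x) := by gcongr
    _ = _ := by
        rw [show 12 * t / δ = 3 * (4 * t / δ) by ring, mul_pow]; ring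

theorem sum_geometric_tail_le {ρ : ℝ} (h0 : 0 ≤ ρ) (h1 : ρ ≤ 1 / 2) (p N : ℕ) :
    (∑ j ∈ Finset.range N, if j < p then 0 else ρ ^ j) ≤ 2 * ρ ^ p - 2 * ρ ^ max p N := by
  induction N with
  | zero => simp
  | succ N ih =>
    rw [Finset.sum_range_succ]
    split_ifs with h
    · rw [max_eq_left (by omega)] at ih ⊢
      linarith
    · rw [max_eq_right (by omega)] at ih ⊢
      have : 0 ≤ ρ ^ N := by positivity
      rw [pow_succ]
      nlinarith

theorem LocLe.of_tendsto {κ x : ℝ} {F : ℕ → PatchLabel n m → A} {X : PatchLabel n m → A}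
    (hF : ∀ N, LocLe κ (F N) x)
    (h : ∀ c, Filter.Tendsto (fun N => F N c) Filter.atTop (nhds (X c))) : LocLe κ X x := by
  intro i
  refine le_of_tendsto' (x := Filter.atTop) (f := fun N => siteSum (wnorm κ (F N)) i) ?_
    fun N => hF N i
  unfold siteSum wnorm
  refine tendsto_finsetSum _ fun c _ => ?_
  split_ifs
  · exact (h c).norm.mul_const _
  · exact tendsto_const_nhds

theorem famAd_iterate_apply_empty (T X : PatchLabel n m → A) {c : PatchLabel n m} (hc : c.1 = ∅)
    {j : ℕ} (hj : j ≠ 0) : (famAd T)^[j] X c = 0 := by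
  obtain ⟨k, rfl⟩ := Nat.exists_eq_succ_of_ne_zero hj
  rw [Function.iterate_succ_apply']
  exact bracket_apply_empty (fun _ _ h => h) _ _ hc

variable [NormedAlgebra ℂ A]

/-- The weighted series of iterated brackets. -/
def adSeries (w : ℕ → ℝ) (T X : PatchLabel n m → A) (c : PatchLabel n m) : A :=
  ∑' j : ℕ, (w j : ℂ) • (famAd T)^[j] X c

variable [CompleteSpace A]

theorem summable_adSeries {κ δ t x : ℝ} {w : ℕ → ℝ} {T X : PatchLabel n m → A} (hδ : 0 < δ)
    (ht : 0 ≤ t) (hx : 0 ≤ x) (hκ : 0 ≤ κ - δ) (hT : LocLe κ T t) (hX : LocLe κ X x)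
    (hρ : 12 * t / δ ≤ 1 / 2) (hw0 : ∀ j, 0 ≤ w j) (hw : ∀ j, w j ≤ (j.factorial : ℝ)⁻¹)
    (c : PatchLabel n m) : Summable fun j : ℕ => (w j : ℂ) • (famAd T)^[j] X c := by
  rcases Finset.eq_empty_or_nonempty c.1 with hc | ⟨i, hi⟩
  · refine summable_of_ne_finset_zero (s := {0}) fun j hj => ?_
    rw [famAd_iterate_apply_empty T X hc (by simpa using hj), smul_zero]
  · have hg : Summable fun j : ℕ => (12 * t / δ) ^ j * x :=
      (summable_geometric_of_lt_one (by positivity) (by linarith)).mul_right x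
    refine Summable.of_norm_bounded hg fun j => ?_
    have h := LocLe.famAd_iterate_div_factorial hδ ht hx hκ hT hX j i
    have h1 := (le_siteSum (wnorm_nonneg (κ - δ) ((famAd T)^[j] X)) hi).trans h
    have h2 : ‖(famAd T)^[j] X c‖ ≤ wnorm (κ - δ) ((famAd T)^[j] X) c :=
      le_mul_of_one_le_right (norm_nonneg _) (Real.one_le_exp (by positivity))
    rw [norm_smul, Complex.norm_real, Real.norm_of_nonneg (hw0 j)]
    have hfac : (0 : ℝ) < j.factorial := by exact_mod_cast j.factorial_pos
    calc w j * ‖(famAd T)^[j] X c‖ ≤ (j.factorial : ℝ)⁻¹ * ‖(famAd T)^[j] X c‖ := by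
          gcongr; exact hw j
      _ ≤ (j.factorial : ℝ)⁻¹ * (j.factorial * ((12 * t / δ) ^ j * x)) := by
          gcongr; exact h2.trans h1
      _ = _ := by field_simp

theorem LocLe.adSeries {κ δ t x : ℝ} {w : ℕ → ℝ} {T X : PatchLabel n m → A} (p : ℕ) (hδ : 0 < δ)
    (ht : 0 ≤ t) (hx : 0 ≤ x) (hκ : 0 ≤ κ - δ) (hT : LocLe κ T t) (hX : LocLe κ X x)
    (hρ : 12 * t / δ ≤ 1 / 2) (hw0 : ∀ j, 0 ≤ w j) (hw : ∀ j, w j ≤ (j.factorial : ℝ)⁻¹)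
    (hp : ∀ j, j < p → w j = 0) :
    LocLe (κ - δ) (adSeries w T X) (2 * (12 * t / δ) ^ p * x) := by
  have hpart : ∀ N : ℕ, LocLe (κ - δ) (∑ j ∈ Finset.range N, (w j : ℂ) • (famAd T)^[j] X)
      ((∑ j ∈ Finset.range N, if j < p then 0 else (12 * t / δ) ^ j) * x) := by
    intro N
    induction N with
    | zero =>
      intro i
      simp [siteSum, wnorm]
    | succ N ih =>
      rw [Finset.sum_range_succ, Finset.sum_range_succ, add_mul]
      refine ih.add ?_
      have hfac : (0 : ℝ) < N.factorial := by exact_mod_cast N.factorial_pos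
      have h := (LocLe.famAd_iterate_div_factorial hδ ht hx hκ hT hX N).of_norm_le
        (X := (w N : ℂ) • (famAd T)^[N] X) (c := w N) (hw0 N) (fun a => by
          rw [Pi.smul_apply, norm_smul, Complex.norm_real, Real.norm_of_nonneg (hw0 N)])
      refine h.mono ?_
      split_ifs with hNp
      · rw [hp N hNp]; simp
      · calc w N * (N.factorial * ((12 * t / δ) ^ N * x))
            ≤ (N.factorial : ℝ)⁻¹ * (N.factorial * ((12 * t / δ) ^ N * x)) := by
              gcongr; exact hw N
          _ = _ := by field_simp
  refine LocLe.of_tendsto (F := fun N => ∑ j ∈ Finset.range N, (w j : ℂ) • (famAd T)^[j] X)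
    (fun N => (hpart N).mono ?_) fun c => ?_
  · refine mul_le_mul_of_nonneg_right ((sum_geometric_tail_le (by positivity) hρ p N).trans ?_) hx
    have : 0 ≤ (12 * t / δ) ^ max p N := by positivity
    linarith
  · have := (summable_adSeries hδ ht hx hκ hT hX hρ hw0 hw c).hasSum.tendsto_sum_nat
    simp only [Finset.sum_apply, Pi.smul_apply]
    exact this

end Series

/-! ### The algebraic frame of a stabilizer code -/

/-- The structural facts about a stabilizer code used by the flow: spaces of supported operators,
syndrome sectors, the code Hamiltonian, and the range of checks touched by a region. -/
structure StabFrame (n m : ℕ) (A : Type*) [NormedRing A] [NormedAlgebra ℂ A] where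
  /-- Operators with a given support and syndrome. -/
  supp : PatchLabel n m → Submodule ℂ A
  /-- Projections onto the syndrome sectors. -/
  proj : Finset (Fin m) → A
  /-- The code Hamiltonian. -/
  ham : A
  /-- The energies of the single checks. -/
  lam : Fin m → ℝ
  /-- The size below which regions are correctable. -/
  ds : ℝ
  /-- The checks that can influence operators in a given region. -/
  touch : Finset (Fin n) → Finset (Fin m)
  /-- The constant in the touching estimate. -/
  Theta : ℝ → ℝ
  one_le_lam : ∀ j, 1 ≤ lam j
  norm_one_le : ‖(1 : A)‖ ≤ 1
  one_mem : ∀ S, (1 : A) ∈ supp (S, ∅)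
  mul_mem : ∀ {a b x y}, x ∈ supp a → y ∈ supp b → x * y ∈ supp (a.join b)
  commute : ∀ {a b x y}, ¬ a.Meets b → x ∈ supp a → y ∈ supp b → x * y = y * x
  mul_proj : ∀ {a x} (σ : Finset (Fin m)), x ∈ supp a →
    x * proj σ = proj (symmDiff σ a.2) * x
  ham_proj : ∀ σ, ham * proj σ = ((∑ j ∈ σ, lam j : ℝ) : ℂ) • proj σ
  ham_mem : ∀ {a x}, x ∈ supp a → ham * x - x * ham ∈ supp a
  ham_norm : ∀ {a x}, x ∈ supp a → ‖ham * x - x * ham‖ ≤ (∑ j ∈ a.2, lam j) * ‖x‖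
  scalar : ∀ {S x}, (S.card : ℝ) < ds → x ∈ supp (S, ∅) →
    ∃ c : ℂ, ‖c‖ ≤ ‖x‖ ∧ x * proj ∅ = c • proj ∅
  kill : ∀ {a x σ}, (a.1.card : ℝ) < ds → x ∈ supp a → x * proj ∅ = 0 →
    (∀ j ∈ σ, j ∉ touch a.1) → x * proj σ = 0
  Theta_nonneg : ∀ δ, 0 < δ → 0 ≤ Theta δ
  touch_sum : ∀ {δ B : ℝ} {y : PatchLabel n m → ℝ}, 0 < δ → 0 ≤ B → (∀ a, 0 ≤ y a) →
    (∀ i, siteSum (fun a => y a * Real.exp (δ * a.1.card)) i ≤ B) →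
    ∀ j, (∑ a : PatchLabel n m, if (a.1.Nonempty ∧ (a.1.card : ℝ) < ds) ∧ j ∈ touch a.1 then y a
      else 0) ≤ Theta δ * B

namespace StabFrame

variable {n m : ℕ} {A : Type*} [NormedRing A] [NormedAlgebra ℂ A] (F : StabFrame n m A)

/-- The energy of a syndrome. -/
def energy (σ : Finset (Fin m)) : ℝ := ∑ j ∈ σ, F.lam j

/-- Nonempty correctable regions. -/
def Small (a : PatchLabel n m) : Prop := a.1.Nonempty ∧ (a.1.card : ℝ) < F.ds

/-- Nonempty regions that are not correctable. -/
def Large (a : PatchLabel n m) : Prop := a.1.Nonempty ∧ F.ds ≤ (a.1.card : ℝ)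

theorem card_le_energy (σ : Finset (Fin m)) : (σ.card : ℝ) ≤ F.energy σ := by
  unfold energy
  calc (σ.card : ℝ) = ∑ _j ∈ σ, (1 : ℝ) := by simp
    _ ≤ _ := Finset.sum_le_sum fun j _ => F.one_le_lam j

theorem energy_nonneg (σ : Finset (Fin m)) : 0 ≤ F.energy σ :=
  (Nat.cast_nonneg _).trans (F.card_le_energy σ)

theorem one_le_energy {σ : Finset (Fin m)} (h : σ.Nonempty) : 1 ≤ F.energy σ :=
  le_trans (by exact_mod_cast h.card_pos) (F.card_le_energy σ)

theorem join_comm (a b : PatchLabel n m) : a.join b = b.join a := by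
  unfold PatchLabel.join
  rw [Finset.union_comm, symmDiff_comm]

theorem commutator_mem {a b : PatchLabel n m} {x y : A} (hx : x ∈ F.supp a) (hy : y ∈ F.supp b) :
    x * y - y * x ∈ F.supp (a.join b) :=
  sub_mem (F.mul_mem hx hy) (by rw [join_comm]; exact F.mul_mem hy hx)

theorem bracket_mem {X Y : PatchLabel n m → A} (hX : ∀ a, X a ∈ F.supp a)
    (hY : ∀ a, Y a ∈ F.supp a) (χ : PatchLabel n m → PatchLabel n m → Prop) (c : PatchLabel n m) :
    bracket χ X Y c ∈ F.supp c := by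
  refine Submodule.sum_mem _ fun a _ => Submodule.sum_mem _ fun b _ => ?_
  split_ifs with h
  · rw [← h.1]
    exact F.commutator_mem (hX a) (hY b)
  · exact zero_mem _

theorem famAd_iterate_mem {X T : PatchLabel n m → A} (hX : ∀ a, X a ∈ F.supp a)
    (hT : ∀ a, T a ∈ F.supp a) (j : ℕ) : ∀ c, (famAd T)^[j] X c ∈ F.supp c := by
  induction j with
  | zero => exact hX
  | succ j ih =>
    rw [Function.iterate_succ_apply']
    exact F.bracket_mem ih hT _

theorem total_famAd_iterate {X T : PatchLabel n m → A} (hX : ∀ a, X a ∈ F.supp a)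
    (hT : ∀ a, T a ∈ F.supp a) (j : ℕ) :
    total ((famAd T)^[j] X) = (rightAd (total T))^[j] (total X) := by
  induction j with
  | zero => rfl
  | succ j ih =>
    rw [Function.iterate_succ_apply', Function.iterate_succ_apply', ← ih]
    exact total_famAd fun a b hab => F.commute hab (F.famAd_iterate_mem hX hT j a) (hT b)

theorem famRestrict_mem {X : PatchLabel n m → A} (hX : ∀ a, X a ∈ F.supp a)
    (p : PatchLabel n m → Prop) (a : PatchLabel n m) : famRestrict p X a ∈ F.supp a := by
  unfold famRestrict
  split_ifs
  exacts [hX a, zero_mem _]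

section Series

theorem adSeries_mem [FiniteDimensional ℂ A] {X T : PatchLabel n m → A} (hX : ∀ a, X a ∈ F.supp a)
    (hT : ∀ a, T a ∈ F.supp a) (w : ℕ → ℝ) (c : PatchLabel n m) :
    adSeries w T X c ∈ F.supp c := by
  have hcl : IsClosed (F.supp c : Set A) := (F.supp c).closed_of_finiteDimensional
  unfold adSeries
  by_cases hs : Summable fun j : ℕ => (w j : ℂ) • (famAd T)^[j] X c
  · refine hcl.mem_of_tendsto hs.hasSum.tendsto_sum_nat (Filter.Eventually.of_forall fun N => ?_)
    exact Submodule.sum_mem _ fun j _ => Submodule.smul_mem _ _ (F.famAd_iterate_mem hX hT j c)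
  · rw [tsum_eq_zero_of_not_summable hs]
    exact zero_mem _

variable [CompleteSpace A]

theorem hasSum_total_adSeries {κ δ t x : ℝ} {w : ℕ → ℝ} {T X : PatchLabel n m → A} (hδ : 0 < δ)
    (ht : 0 ≤ t) (hx : 0 ≤ x) (hκ : 0 ≤ κ - δ) (hT : LocLe κ T t) (hX : LocLe κ X x)
    (hρ : 12 * t / δ ≤ 1 / 2) (hw0 : ∀ j, 0 ≤ w j) (hw : ∀ j, w j ≤ (j.factorial : ℝ)⁻¹)
    (hXm : ∀ a, X a ∈ F.supp a) (hTm : ∀ a, T a ∈ F.supp a) :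
    HasSum (fun j => (w j : ℂ) • (rightAd (total T))^[j] (total X)) (total (adSeries w T X)) := by
  have h := hasSum_sum (s := Finset.univ) fun c (_ : c ∈ Finset.univ) =>
    (summable_adSeries hδ ht hx hκ hT hX hρ hw0 hw c).hasSum
  refine HasSum.congr_fun h fun j => ?_
  rw [← F.total_famAd_iterate hXm hTm j, total, Finset.smul_sum]

end Series

/-- A subtraction of multiples of the identity turns a family of diagonal terms into terms
annihilating the code space. -/
theorem exists_scalar_split {Y : PatchLabel n m → A} (hY : ∀ a, Y a ∈ F.supp a)
    (hsmall : ∀ a, ¬ F.Small a → Y a = 0) (hdiag : ∀ a, a.2 = ∅ ∨ Y a * F.proj ∅ = 0) :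
    ∃ (c : ℂ) (Y' : PatchLabel n m → A), total Y = c • 1 + total Y' ∧ (∀ a, Y' a ∈ F.supp a) ∧
      (∀ a, ¬ F.Small a → Y' a = 0) ∧ (∀ a, Y' a * F.proj ∅ = 0) ∧
      ∀ a, ‖Y' a‖ ≤ 2 * ‖Y a‖ := by
  have hex : ∀ a, ∃ c : ℂ, ‖c‖ ≤ ‖Y a‖ ∧ Y a * F.proj ∅ = c • F.proj ∅ ∧
      c • (1 : A) ∈ F.supp a := by
    intro a
    by_cases ha : a.2 = ∅ ∧ F.Small a
    · have hYa := hY a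
      rw [show a = (a.1, ∅) from Prod.ext rfl ha.1] at hYa
      obtain ⟨c, h1, h2⟩ := F.scalar ha.2.2 hYa
      rw [show ((a.1, ∅) : PatchLabel n m) = a from Prod.ext rfl ha.1.symm] at h1 h2
      refine ⟨c, h1, h2, ?_⟩
      rw [show a = (a.1, ∅) from Prod.ext rfl ha.1]
      exact Submodule.smul_mem _ _ (F.one_mem _)
    · refine ⟨0, by simp, ?_, by simp⟩
      rw [zero_smul]
      by_cases hs : F.Small a
      · exact (hdiag a).resolve_left fun h => ha ⟨h, hs⟩
      · rw [hsmall a hs, zero_mul]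
  choose c hc1 hc2 hc3 using hex
  refine ⟨∑ a, c a, fun a => Y a - c a • 1, ?_, ?_, ?_, ?_, ?_⟩
  · unfold total
    rw [Finset.sum_sub_distrib, Finset.sum_smul]
    abel
  · exact fun a => sub_mem (hY a) (hc3 a)
  · intro a ha
    have h1 := hc1 a
    rw [hsmall a ha, norm_zero] at h1
    beta_reduce
    rw [hsmall a ha, norm_le_zero_iff.1 h1]
    simp
  · intro a
    rw [sub_mul, hc2, smul_mul_assoc, one_mul, sub_self]
  · intro a
    calc ‖Y a - c a • 1‖ ≤ ‖Y a‖ + ‖c a • (1 : A)‖ := norm_sub_le _ _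
      _ ≤ ‖Y a‖ + ‖c a‖ * 1 := by
          rw [norm_smul]
          gcongr
          exact F.norm_one_le
      _ ≤ _ := by linarith [hc1 a]

/-- The energy-weighted family. -/
def energyMul (T : PatchLabel n m → A) (a : PatchLabel n m) : A := (F.energy a.2 : ℂ) • T a

/-- The commutators of the code Hamiltonian with a family. -/
def hamAd (T : PatchLabel n m → A) (a : PatchLabel n m) : A := F.ham * T a - T a * F.ham

theorem total_hamAd (T : PatchLabel n m → A) : total (F.hamAd T) = rightAd (total T) F.ham := by
  unfold total hamAd rightAd
  rw [Finset.sum_sub_distrib, Finset.mul_sum, Finset.sum_mul]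

theorem norm_energyMul (T : PatchLabel n m → A) (a : PatchLabel n m) :
    ‖F.energyMul T a‖ = F.energy a.2 * ‖T a‖ := by
  rw [energyMul, norm_smul, Complex.norm_real, Real.norm_of_nonneg (F.energy_nonneg _)]

theorem hamAd_mul_proj {T : PatchLabel n m → A} (hT : ∀ a, T a ∈ F.supp a) (a : PatchLabel n m) :
    F.hamAd T a * F.proj ∅ = F.energyMul T a * F.proj ∅ := by
  have h0 : F.ham * F.proj ∅ = 0 := by rw [F.ham_proj]; simp
  have h1 : T a * F.proj ∅ = F.proj a.2 * T a := by
    rw [F.mul_proj ∅ (hT a), ← Finset.bot_eq_empty, bot_symmDiff]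
  rw [hamAd, sub_mul, mul_assoc, mul_assoc, h0, mul_zero, sub_zero, h1, ← mul_assoc, F.ham_proj,
    energyMul, smul_mul_assoc, smul_mul_assoc, h1]
  rfl

/-- The pairs for which the commutator of a term of `D` with a term of `T` creates an excitation
from the code space. -/
def Flagged (a b : PatchLabel n m) : Prop :=
  a.Meets b ∧ (∃ j ∈ b.2, j ∈ F.touch a.1) ∧ F.Small (a.join b) ∧ (a.join b).2.Nonempty

/-- The terms creating an excitation on a small region. -/
def creation : Submodule ℂ (PatchLabel n m → A) where
  carrier := {X | (∀ a, X a ∈ F.supp a) ∧ ∀ a, ¬ (F.Small a ∧ a.2.Nonempty) → X a = 0}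
  add_mem' := fun {X Y} hX hY => ⟨fun a => add_mem (hX.1 a) (hY.1 a), fun a ha => by
    rw [Pi.add_apply, hX.2 a ha, hY.2 a ha, add_zero]⟩
  zero_mem' := ⟨fun a => zero_mem _, fun a _ => rfl⟩
  smul_mem' := fun c X hX => ⟨fun a => Submodule.smul_mem _ _ (hX.1 a), fun a ha => by
    rw [Pi.smul_apply, hX.2 a ha, smul_zero]⟩

theorem flagged_bracket_loc {κ μ x : ℝ} {D T : PatchLabel n m → A} (hκ : 0 ≤ κ) (hx : 0 ≤ x)
    (hμ : 0 ≤ μ)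
    (hD1 : ∀ j, (∑ a : PatchLabel n m, if j ∈ F.touch a.1 then wnorm κ D a else 0) ≤ μ)
    (hD2 : ∀ i, siteSum (fun a => (a.1.card : ℝ) * wnorm κ D a) i ≤ μ)
    (hT : T ∈ F.creation) (hx' : LocLe κ (F.energyMul T) x) :
    LocLe κ (bracket F.Flagged D T) (4 * μ * x) := by
  intro i
  have hwT : ∀ b, wnorm κ (F.energyMul T) b = F.energy b.2 * wnorm κ T b := fun b => by
    unfold wnorm
    rw [F.norm_energyMul, mul_assoc]
  have hTle : LocLe κ T x := hx'.of_norm_le' fun a => by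
    rw [F.norm_energyMul]
    by_cases ha : a.2.Nonempty
    · exact le_mul_of_one_le_left (norm_nonneg _) (F.one_le_energy ha)
    · rw [hT.2 a fun h => ha h.2, norm_zero, mul_zero]
  have h1 : (∑ a : PatchLabel n m, ∑ b,
      if i ∈ a.1 ∧ F.Flagged a b then wnorm κ D a * wnorm κ T b else 0) ≤ μ * x := by
    have h := sum_site_sum_meets_le (wnorm_nonneg κ D) (wnorm_nonneg κ T) hTle i
    refine le_trans ?_ (h.trans (mul_le_mul_of_nonneg_right (hD2 i) hx))
    refine Finset.sum_le_sum fun a _ => Finset.sum_le_sum fun b _ => ?_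
    have hnn := mul_nonneg (wnorm_nonneg κ D a) (wnorm_nonneg κ T b)
    split_ifs with h1 h2
    · exact le_rfl
    · exact absurd ⟨h1.1, h1.2.1⟩ h2
    · exact hnn
    · exact le_rfl
  have h2 : (∑ a : PatchLabel n m, ∑ b : PatchLabel n m,
      if i ∈ b.1 ∧ F.Flagged a b then wnorm κ D a * wnorm κ T b else 0) ≤ μ * x := by
    rw [Finset.sum_comm]
    calc _ ≤ ∑ b : PatchLabel n m, if i ∈ b.1 then μ * wnorm κ (F.energyMul T) b else 0 := by
          refine Finset.sum_le_sum fun b _ => ?_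
          by_cases hi : i ∈ b.1
          · simp only [hi, true_and, if_true]
            have hnT := wnorm_nonneg κ T b
            calc (∑ a, if F.Flagged a b then wnorm κ D a * wnorm κ T b else 0)
                ≤ ∑ a : PatchLabel n m, ∑ j ∈ b.2,
                    if j ∈ F.touch a.1 then wnorm κ D a * wnorm κ T b else 0 := by
                  refine Finset.sum_le_sum fun a _ => ?_
                  have hnn : ∀ j ∈ b.2,
                      0 ≤ if j ∈ F.touch a.1 then wnorm κ D a * wnorm κ T b else 0 := fun j _ => by
                    split_ifs
                    exacts [mul_nonneg (wnorm_nonneg κ D a) hnT, le_rfl]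
                  split_ifs with hf
                  · obtain ⟨j, hj, hj'⟩ := hf.2.1
                    have := Finset.single_le_sum hnn hj
                    simpa [hj'] using this
                  · exact Finset.sum_nonneg hnn
              _ = ∑ j ∈ b.2, (∑ a : PatchLabel n m,
                    if j ∈ F.touch a.1 then wnorm κ D a else 0) * wnorm κ T b := by
                  rw [Finset.sum_comm]
                  refine Finset.sum_congr rfl fun j _ => ?_
                  rw [Finset.sum_mul]
                  exact Finset.sum_congr rfl fun a _ => by split_ifs <;> simp
              _ ≤ ∑ _j ∈ b.2, μ * wnorm κ T b :=
                  Finset.sum_le_sum fun j _ => mul_le_mul_of_nonneg_right (hD1 j) hnT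
              _ = (b.2.card : ℝ) * (μ * wnorm κ T b) := by rw [Finset.sum_const, nsmul_eq_mul]
              _ ≤ F.energy b.2 * (μ * wnorm κ T b) :=
                  mul_le_mul_of_nonneg_right (F.card_le_energy _) (mul_nonneg hμ hnT)
              _ = μ * wnorm κ (F.energyMul T) b := by rw [hwT]; ring
          · simp [hi]
      _ = μ * siteSum (wnorm κ (F.energyMul T)) i := siteSum_const_mul _ _ _
      _ ≤ μ * x := mul_le_mul_of_nonneg_left (hx' i) hμ
  refine (siteSum_bracket_le hκ _ _ _ i).trans ?_
  linarith

theorem flagged_bracket_mem {D T : PatchLabel n m → A} (hD : ∀ a, D a ∈ F.supp a)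
    (hT : ∀ a, T a ∈ F.supp a) : bracket F.Flagged D T ∈ F.creation := by
  refine ⟨F.bracket_mem hD hT _, fun c hc => ?_⟩
  refine Finset.sum_eq_zero fun a _ => Finset.sum_eq_zero fun b _ => ?_
  rw [if_neg]
  rintro ⟨h1, h2⟩
  rw [← h1] at hc
  exact hc ⟨h2.2.2.1, h2.2.2.2⟩

theorem energyMul_mem {T : PatchLabel n m → A} (hT : T ∈ F.creation) :
    F.energyMul T ∈ F.creation :=
  ⟨fun a => Submodule.smul_mem _ _ (hT.1 a), fun a ha => by rw [energyMul, hT.2 a ha, smul_zero]⟩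

theorem locLe_of_homological {κ μ v : ℝ} {D T V : PatchLabel n m → A} (hκ : 0 ≤ κ) (hμ : 0 ≤ μ)
    (hμ' : μ ≤ 1 / 8) (hv : 0 ≤ v)
    (hD1 : ∀ j, (∑ a : PatchLabel n m, if j ∈ F.touch a.1 then wnorm κ D a else 0) ≤ μ)
    (hD2 : ∀ i, siteSum (fun a => (a.1.card : ℝ) * wnorm κ D a) i ≤ μ)
    (hT : T ∈ F.creation) (hV : LocLe κ V v)
    (heq : F.energyMul T + bracket F.Flagged D T = -V) : LocLe κ (F.energyMul T) (2 * v) := by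
  set x : ℝ := ⨆ i, siteSum (wnorm κ (F.energyMul T)) i with hxdef
  have hle : LocLe κ (F.energyMul T) x := fun i => le_ciSup (Finite.bddAbove_range _) i
  have hx : 0 ≤ x := Real.iSup_nonneg fun i => siteSum_nonneg (wnorm_nonneg _ _) i
  have hb := F.flagged_bracket_loc hκ hx hμ hD1 hD2 hT hle
  have h2 : LocLe κ (F.energyMul T) (v + 4 * μ * x) := by
    rw [eq_sub_of_add_eq heq]
    exact hV.neg.sub hb
  have h3 : x ≤ v + 4 * μ * x := Real.iSup_le h2 (by positivity)
  have h4 : μ * x ≤ 1 / 8 * x := mul_le_mul_of_nonneg_right hμ' hx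
  exact hle.mono (by linarith)

theorem exists_homological [FiniteDimensional ℂ A] {κ μ v : ℝ} {D V : PatchLabel n m → A}
    (hκ : 0 ≤ κ) (hμ : 0 ≤ μ) (hμ' : μ ≤ 1 / 8) (hv : 0 ≤ v)
    (hD1 : ∀ j, (∑ a : PatchLabel n m, if j ∈ F.touch a.1 then wnorm κ D a else 0) ≤ μ)
    (hD2 : ∀ i, siteSum (fun a => (a.1.card : ℝ) * wnorm κ D a) i ≤ μ)
    (hD : ∀ a, D a ∈ F.supp a) (hVm : V ∈ F.creation) (hV : LocLe κ V v) :
    ∃ T ∈ F.creation, F.energyMul T + bracket F.Flagged D T = -V ∧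
      LocLe κ (F.energyMul T) (2 * v) := by
  let M : F.creation →ₗ[ℂ] F.creation :=
    { toFun := fun T => ⟨F.energyMul T.1 + bracket F.Flagged D T.1,
        add_mem (F.energyMul_mem T.2) (F.flagged_bracket_mem hD T.2.1)⟩
      map_add' := fun T T' => by
        refine Subtype.ext (funext fun c => ?_)
        change (F.energy c.2 : ℂ) • (T.1 c + T'.1 c) + bracket F.Flagged D (T.1 + T'.1) c =
          ((F.energy c.2 : ℂ) • T.1 c + bracket F.Flagged D T.1 c) +
            ((F.energy c.2 : ℂ) • T'.1 c + bracket F.Flagged D T'.1 c)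
        have : bracket F.Flagged D (T.1 + T'.1) c =
            bracket F.Flagged D T.1 c + bracket F.Flagged D T'.1 c := by
          unfold bracket
          rw [← Finset.sum_add_distrib]
          refine Finset.sum_congr rfl fun a _ => ?_
          rw [← Finset.sum_add_distrib]
          refine Finset.sum_congr rfl fun b _ => ?_
          split_ifs
          · rw [Pi.add_apply]; noncomm_ring
          · simp
        rw [this, smul_add]
        abel
      map_smul' := fun z T => by
        refine Subtype.ext (funext fun c => ?_)
        change (F.energy c.2 : ℂ) • (z • T.1 c) + bracket F.Flagged D (z • T.1) c =
          z • ((F.energy c.2 : ℂ) • T.1 c + bracket F.Flagged D T.1 c)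
        have : bracket F.Flagged D (z • T.1) c = z • bracket F.Flagged D T.1 c := by
          unfold bracket
          rw [Finset.smul_sum]
          refine Finset.sum_congr rfl fun a _ => ?_
          rw [Finset.smul_sum]
          refine Finset.sum_congr rfl fun b _ => ?_
          split_ifs
          · rw [Pi.smul_apply, mul_smul_comm, smul_mul_assoc, smul_sub]
          · simp
        rw [this, smul_add, smul_comm] }
  have hinj : Function.Injective M := by
    rw [← LinearMap.ker_eq_bot, LinearMap.ker_eq_bot']
    intro T hT
    have h0 : F.energyMul T.1 + bracket F.Flagged D T.1 = -(0 : PatchLabel n m → A) := by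
      rw [neg_zero]; exact congrArg Subtype.val hT
    have hz : LocLe κ (0 : PatchLabel n m → A) 0 := fun i => by simp [siteSum, wnorm]
    have h1 := F.locLe_of_homological hκ hμ hμ' le_rfl hD1 hD2 T.2 hz h0
    refine Subtype.ext (funext fun a => ?_)
    change T.1 a = 0
    by_cases ha : F.Small a ∧ a.2.Nonempty
    · obtain ⟨i, hi⟩ := ha.1.1
      have h2 := (le_siteSum (wnorm_nonneg κ (F.energyMul T.1)) hi).trans (h1 i)
      have h3 : ‖F.energyMul T.1 a‖ * Real.exp (κ * a.1.card) ≤ 0 := by simpa [wnorm] using h2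
      have h4 : ‖F.energyMul T.1 a‖ ≤ 0 := by
        by_contra! h; exact absurd h3 (not_le.2 (mul_pos h (Real.exp_pos _)))
      rw [F.norm_energyMul] at h4
      have h5 := F.one_le_energy ha.2
      exact norm_le_zero_iff.1 (by nlinarith [norm_nonneg (T.1 a)])
    · exact T.2.2 a ha
  obtain ⟨T, hT⟩ := LinearMap.injective_iff_surjective.1 hinj (-⟨V, hVm⟩)
  have heq : F.energyMul T.1 + bracket F.Flagged D T.1 = -V := congrArg Subtype.val hT
  exact ⟨T.1, T.2, heq, F.locLe_of_homological hκ hμ hμ' hv hD1 hD2 T.2 hV heq⟩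

end StabFrame

namespace StabFrame

variable {n m : ℕ} {A : Type*} [NormedRing A] [NormedAlgebra ℂ A]

/-- A Hamiltonian written as the code Hamiltonian plus a constant, terms `D` annihilating the code
space, terms `V` creating excitations, and terms `R` on large regions, with bounds on their local
strengths. -/
structure FlowForm (F : StabFrame n m A) (H : A) (c : ℂ) (D V R : PatchLabel n m → A)
    (κ μ v r : ℝ) : Prop where
  eq : H = F.ham + c • 1 + total D + total V + total R
  D_mem : ∀ a, D a ∈ F.supp a
  D_small : ∀ a, ¬ F.Small a → D a = 0
  D_proj : ∀ a, D a * F.proj ∅ = 0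
  V_mem : V ∈ F.creation
  R_mem : ∀ a, R a ∈ F.supp a
  R_large : ∀ a, ¬ F.Large a → R a = 0
  D_touch : ∀ j, (∑ a : PatchLabel n m, if j ∈ F.touch a.1 then wnorm κ D a else 0) ≤ μ
  D_site : ∀ i, siteSum (fun a => (a.1.card : ℝ) * wnorm κ D a) i ≤ μ
  V_loc : LocLe κ V v
  R_loc : LocLe κ R r

theorem FlowForm.D_loc {F : StabFrame n m A} {H : A} {c : ℂ} {D V R : PatchLabel n m → A}
    {κ μ v r : ℝ} (h : F.FlowForm H c D V R κ μ v r) : LocLe κ D μ := fun i =>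
  (Finset.sum_le_sum fun a _ => by
    split_ifs with hi
    · have : (1 : ℝ) ≤ a.1.card := by exact_mod_cast Finset.card_pos.2 ⟨i, hi⟩
      exact le_mul_of_one_le_left (wnorm_nonneg κ D a) this
    · exact le_rfl).trans (h.D_site i)

variable (F : StabFrame n m A)

/-- Local strength of small terms controls the two mean-field bounds at a smaller decay rate. -/
theorem meanField_of_locLe {κ δ y : ℝ} {Y : PatchLabel n m → A} (hδ : 0 < δ) (hy : 0 ≤ y)
    (hsmall : ∀ a, ¬ F.Small a → Y a = 0) (hY : LocLe κ Y y) :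
    (∀ j, (∑ a : PatchLabel n m, if j ∈ F.touch a.1 then wnorm (κ - δ) Y a else 0) ≤
      F.Theta δ * y) ∧
    ∀ i, siteSum (fun a => (a.1.card : ℝ) * wnorm (κ - δ) Y a) i ≤ y / δ := by
  refine ⟨fun j => ?_, siteSum_card_mul_le hδ hY⟩
  have h := F.touch_sum (y := wnorm (κ - δ) Y) hδ hy (wnorm_nonneg _ _) (fun i => by
    refine le_trans (le_of_eq ?_) (hY i)
    congr 1
    funext a
    unfold wnorm
    rw [mul_assoc, ← Real.exp_add]
    ring_nf) j
  refine le_trans (Finset.sum_le_sum fun a _ => ?_) h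
  by_cases ha : F.Small a
  · have ha' : a.1.Nonempty ∧ (a.1.card : ℝ) < F.ds := ha
    simp only [ha', true_and, and_self]
    exact le_rfl
  · have : wnorm (κ - δ) Y a = 0 := by rw [wnorm, hsmall a ha, norm_zero, zero_mul]
    rw [this]
    simp

/-- The loss constant of one step of the flow. -/
def stepConst (δ : ℝ) : ℝ := 288 * (1 + F.Theta δ) / δ ^ 2

theorem large_iff_of_nonempty {a : PatchLabel n m} (h : a.1.Nonempty) :
    F.Large a ↔ ¬ F.Small a := by
  unfold Large Small
  simp [h]

theorem adSeries_large {R T : PatchLabel n m → A} (hR : ∀ a, ¬ F.Large a → R a = 0) (w : ℕ → ℝ)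
    (c : PatchLabel n m) (hc : ¬ F.Large c) : adSeries w T R c = 0 := by
  have key : ∀ j : ℕ, ∀ c, ¬ F.Large c → (famAd T)^[j] R c = 0 := by
    intro j
    induction j with
    | zero => exact hR
    | succ j ih =>
      intro c hc
      rw [Function.iterate_succ_apply']
      refine Finset.sum_eq_zero fun a _ => Finset.sum_eq_zero fun b _ => ?_
      split_ifs with h
      · rw [ih a, zero_mul, mul_zero, sub_self]
        intro ha
        rw [← h.1] at hc
        refine hc ⟨ha.1.mono Finset.subset_union_left, ha.2.trans ?_⟩
        exact_mod_cast Finset.card_le_card Finset.subset_union_left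
      · rfl
  unfold adSeries
  simp [key _ c hc]

/-- The commutators of non-flagged pairs annihilate the code space. -/
theorem commutator_mul_proj_of_not_flagged {a b : PatchLabel n m} {x y : A} (hx : x ∈ F.supp a)
    (hy : y ∈ F.supp b) (ha : (a.1.card : ℝ) < F.ds) (hxP : x * F.proj ∅ = 0)
    (h : ¬ ∃ j ∈ b.2, j ∈ F.touch a.1) : (x * y - y * x) * F.proj ∅ = 0 := by
  have h1 : y * F.proj ∅ = F.proj b.2 * y := by
    rw [F.mul_proj ∅ hy, ← Finset.bot_eq_empty, bot_symmDiff]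
  rw [sub_mul, mul_assoc, mul_assoc, hxP, mul_zero, sub_zero, h1, ← mul_assoc,
    F.kill ha hx hxP (fun j hj hj' => h ⟨j, hj, hj'⟩), zero_mul]

/-- A commutator pair with small joint region that is not flagged. -/
def Unflagged (a b : PatchLabel n m) : Prop :=
  a.Meets b ∧ F.Small (a.join b) ∧ ¬ F.Flagged a b

/-- A commutator pair whose joint region is not small. -/
def Spread (a b : PatchLabel n m) : Prop := a.Meets b ∧ ¬ F.Small (a.join b)

theorem famAd_eq_add (D T : PatchLabel n m → A) :
    famAd T D = bracket F.Flagged D T + bracket F.Unflagged D T + bracket F.Spread D T := by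
  funext c
  simp only [Pi.add_apply, famAd, bracket]
  rw [← Finset.sum_add_distrib, ← Finset.sum_add_distrib]
  refine Finset.sum_congr rfl fun a _ => ?_
  rw [← Finset.sum_add_distrib, ← Finset.sum_add_distrib]
  refine Finset.sum_congr rfl fun b _ => ?_
  by_cases h1 : a.join b = c
  · by_cases h2 : a.Meets b
    · by_cases h3 : F.Small (a.join b)
      · by_cases h4 : F.Flagged a b
        · simp [h1, h2, h4, Unflagged, Spread, h1 ▸ h3]
        · simp [h1, h2, h4, Unflagged, Spread, h1 ▸ h3]
      · have h4 : ¬ F.Flagged a b := fun h => h3 h.2.2.1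
        rw [h1] at h3
        simp [h1, h2, h3, h4, Unflagged, Spread]
    · have h4 : ¬ F.Flagged a b := fun h => h2 h.1
      simp [h2, h4, Unflagged, Spread]
  · simp [h1]

theorem unflagged_small (D T : PatchLabel n m → A) {c : PatchLabel n m} (hc : ¬ F.Small c) :
    bracket F.Unflagged D T c = 0 := by
  refine Finset.sum_eq_zero fun a _ => Finset.sum_eq_zero fun b _ => ?_
  rw [if_neg]
  rintro ⟨h1, h2⟩
  rw [← h1] at hc
  exact hc h2.2.1

theorem spread_large (D T : PatchLabel n m → A) {c : PatchLabel n m} (hc : ¬ F.Large c) :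
    bracket F.Spread D T c = 0 := by
  refine Finset.sum_eq_zero fun a _ => Finset.sum_eq_zero fun b _ => ?_
  rw [if_neg]
  rintro ⟨h1, ⟨i, hi, hi'⟩, h3⟩
  rw [h1] at h3
  refine hc ((F.large_iff_of_nonempty ?_).2 h3)
  rw [← h1]
  exact ⟨i, Finset.mem_union_left _ hi⟩

theorem unflagged_mul_proj {D T : PatchLabel n m → A} (hD : ∀ a, D a ∈ F.supp a)
    (hDs : ∀ a, ¬ F.Small a → D a = 0) (hDP : ∀ a, D a * F.proj ∅ = 0)
    (hT : ∀ a, T a ∈ F.supp a) (c : PatchLabel n m) :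
    c.2 = ∅ ∨ bracket F.Unflagged D T c * F.proj ∅ = 0 := by
  by_cases hc : c.2 = ∅
  · exact Or.inl hc
  refine Or.inr ?_
  unfold bracket
  rw [Finset.sum_mul]
  refine Finset.sum_eq_zero fun a _ => ?_
  rw [Finset.sum_mul]
  refine Finset.sum_eq_zero fun b _ => ?_
  split_ifs with h
  · obtain ⟨h1, h2, h3, h4⟩ := h
    by_cases ha : F.Small a
    · refine F.commutator_mul_proj_of_not_flagged (hD a) (hT b) ha.2 (hDP a) fun h5 => ?_
      refine h4 ⟨h2, h5, h3, ?_⟩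
      rw [h1]
      exact Finset.nonempty_iff_ne_empty.2 hc
    · rw [hDs a ha]; simp
  · rw [zero_mul]

end StabFrame

/-- The coefficients of the exponential series from order `p` on. -/
def expTail (p j : ℕ) : ℝ := if j < p then 0 else (j.factorial : ℝ)⁻¹

theorem expTail_nonneg (p j : ℕ) : 0 ≤ expTail p j := by
  unfold expTail
  split_ifs <;> positivity

theorem expTail_le (p j : ℕ) : expTail p j ≤ (j.factorial : ℝ)⁻¹ := by
  unfold expTail
  split_ifs
  · positivity
  · exact le_rfl

/-- The coefficients `1 / (j + 1)!` from order one on. -/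
def shiftTail (j : ℕ) : ℝ := if j < 1 then 0 else ((j + 1).factorial : ℝ)⁻¹

theorem shiftTail_nonneg (j : ℕ) : 0 ≤ shiftTail j := by
  unfold shiftTail
  split_ifs <;> positivity

theorem shiftTail_le (j : ℕ) : shiftTail j ≤ (j.factorial : ℝ)⁻¹ := by
  unfold shiftTail
  split_ifs
  · positivity
  · have h1 : (0 : ℝ) < j.factorial := by exact_mod_cast j.factorial_pos
    have h2 : (j.factorial : ℝ) ≤ (j + 1).factorial := by
      exact_mod_cast Nat.factorial_le (Nat.le_succ j)
    gcongr

namespace StabFrame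

variable {n m : ℕ} {A : Type*} [NormedRing A] [NormedAlgebra ℂ A] (F : StabFrame n m A)

theorem total_trichotomy {Y : PatchLabel n m → A} (hY : ∀ a, a.1 = ∅ → Y a = 0) :
    total Y = total (famRestrict (fun a => F.Small a ∧ a.2 = ∅) Y) +
      total (famRestrict (fun a => F.Small a ∧ a.2.Nonempty) Y) +
      total (famRestrict F.Large Y) := by
  unfold total famRestrict
  rw [← Finset.sum_add_distrib, ← Finset.sum_add_distrib]
  refine Finset.sum_congr rfl fun a _ => ?_
  rcases Finset.eq_empty_or_nonempty a.1 with h | h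
  · simp [hY a h]
  · simp only [F.large_iff_of_nonempty h]
    by_cases h1 : F.Small a <;> rcases Finset.eq_empty_or_nonempty a.2 with h2 | h2
    · simp [h1, h2]
    · simp [h1, h2, h2.ne_empty]
    · simp [h1]
    · simp [h1]

variable [CompleteSpace A]

theorem conj_total {κ δ t x : ℝ} {T X : PatchLabel n m → A} (hδ : 0 < δ)
    (ht : 0 ≤ t) (hx : 0 ≤ x) (hκ : 0 ≤ κ - δ) (hT : LocLe κ T t) (hX : LocLe κ X x)
    (hρ : 12 * t / δ ≤ 1 / 2) (hXm : ∀ a, X a ∈ F.supp a) (hTm : ∀ a, T a ∈ F.supp a) (p : ℕ) :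
    NormedSpace.exp (-total T) * total X * NormedSpace.exp (total T) =
      (∑ j ∈ Finset.range p, ((j.factorial : ℂ)⁻¹) • total ((famAd T)^[j] X)) +
        total (adSeries (expTail p) T X) := by
  have h1 := hasSum_conj_exp (total T) (total X)
  have h2 := F.hasSum_total_adSeries hδ ht hx hκ hT hX hρ (expTail_nonneg p) (expTail_le p) hXm hTm
  have h3 : HasSum (fun j : ℕ => ((j.factorial : ℂ)⁻¹) • (rightAd (total T))^[j] (total X) -
      (expTail p j : ℂ) • (rightAd (total T))^[j] (total X))
      (∑ j ∈ Finset.range p, ((j.factorial : ℂ)⁻¹) • total ((famAd T)^[j] X)) := by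
    have h4 := hasSum_sum_of_ne_finset_zero (s := Finset.range p)
      (f := fun j : ℕ => ((j.factorial : ℂ)⁻¹) • (rightAd (total T))^[j] (total X) -
        (expTail p j : ℂ) • (rightAd (total T))^[j] (total X)) (fun j hj => by
        rw [expTail, if_neg (by simpa using hj)]
        push_cast
        rw [sub_self]) (L := SummationFilter.unconditional ℕ)
    convert h4 using 1
    refine Finset.sum_congr rfl fun j hj => ?_
    rw [F.total_famAd_iterate hXm hTm, expTail, if_pos (Finset.mem_range.1 hj)]
    simp
  exact sub_eq_iff_eq_add.1 ((h1.sub h2).unique h3)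

theorem conj_ham {κ δ t x : ℝ} {T : PatchLabel n m → A} (hδ : 0 < δ)
    (ht : 0 ≤ t) (hx : 0 ≤ x) (hκ : 0 ≤ κ - δ) (hT : LocLe κ T t) (hX : LocLe κ (F.hamAd T) x)
    (hρ : 12 * t / δ ≤ 1 / 2) (hTm : ∀ a, T a ∈ F.supp a) :
    NormedSpace.exp (-total T) * F.ham * NormedSpace.exp (total T) =
      F.ham + total (F.hamAd T) + total (adSeries shiftTail T (F.hamAd T)) := by
  have hBm : ∀ a, F.hamAd T a ∈ F.supp a := fun a => F.ham_mem (hTm a)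
  have h1 := (hasSum_nat_add_iff' 1).2 (hasSum_conj_exp (total T) F.ham)
  have h2 := F.hasSum_total_adSeries hδ ht hx hκ hT hX hρ shiftTail_nonneg shiftTail_le hBm hTm
  have h3 : HasSum (fun j : ℕ => (((j + 1).factorial : ℂ)⁻¹) • (rightAd (total T))^[j + 1] F.ham -
      (shiftTail j : ℂ) • (rightAd (total T))^[j] (total (F.hamAd T))) (total (F.hamAd T)) := by
    have h4 := hasSum_sum_of_ne_finset_zero (s := Finset.range 1)
      (f := fun j : ℕ => (((j + 1).factorial : ℂ)⁻¹) • (rightAd (total T))^[j + 1] F.ham -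
        (shiftTail j : ℂ) • (rightAd (total T))^[j] (total (F.hamAd T))) (fun j hj => by
        rw [shiftTail, if_neg (by simpa using hj), Function.iterate_succ_apply, F.total_hamAd]
        push_cast
        rw [sub_self]) (L := SummationFilter.unconditional ℕ)
    simpa [shiftTail, ← F.total_hamAd] using h4
  have h5 := (h1.sub h2).unique h3
  simp only [Finset.sum_range_one, Nat.factorial_zero, Nat.cast_one, inv_one, one_smul,
    Function.iterate_zero, id_eq] at h5
  rw [sub_sub, sub_eq_iff_eq_add] at h5
  rw [h5]
  abel

theorem FlowForm.step [FiniteDimensional ℂ A] {F : StabFrame n m A} {H : A} {c : ℂ}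
    {D V R : PatchLabel n m → A} {κ μ v r δ : ℝ} (h : F.FlowForm H c D V R κ μ v r) (hμ0 : 0 ≤ μ)
    (hμ : μ ≤ 1 / 8) (hv : 0 ≤ v) (hr : 0 ≤ r) (hδ : 0 < δ) (hδ1 : δ ≤ 1) (hκ : 0 ≤ κ - 2 * δ)
    (hK : F.stepConst δ * v ≤ 1) :
    ∃ Ω Ω' : A, Ω' * Ω = 1 ∧ Ω * Ω' = 1 ∧ ∃ (c' : ℂ) (D' V' R' : PatchLabel n m → A),
      F.FlowForm (Ω' * H * Ω) c' D' V' R' (κ - 2 * δ) (μ + F.stepConst δ * v)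
        (F.stepConst δ * v ^ 2) (r + F.stepConst δ * v * (1 + r)) := by
  have hΘ := F.Theta_nonneg δ hδ
  have hδ2 : 0 < δ ^ 2 := by positivity
  have hδ2' : δ ^ 2 ≤ δ := by nlinarith
  set u : ℝ := v / δ ^ 2 with hu
  have hu0 : 0 ≤ u := by positivity
  have hKu : F.stepConst δ * v = 288 * (1 + F.Theta δ) * u := by
    rw [stepConst, hu]; ring
  have hu288 : 288 * u ≤ 1 := by
    rw [hKu] at hK
    nlinarith [mul_nonneg hΘ hu0]
  have hvδ : v / δ ≤ u := by
    rw [hu]; gcongr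
  have hvu : v ≤ u := by
    rw [hu, le_div_iff₀ hδ2]; nlinarith
  have hvδ0 : 0 ≤ v / δ := by positivity
  have hκ1 : 0 ≤ κ - δ := by linarith
  have hκ0 : 0 ≤ κ := by linarith
  obtain ⟨T, hTc, hTeq, hET⟩ := F.exists_homological hκ0 hμ0 hμ hv h.D_touch h.D_site h.D_mem
    h.V_mem h.V_loc
  have hTm := hTc.1
  have hT : LocLe κ T (2 * v) := hET.of_norm_le' fun a => by
    rw [F.norm_energyMul]
    by_cases ha : a.2.Nonempty
    · exact le_mul_of_one_le_left (norm_nonneg _) (F.one_le_energy ha)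
    · rw [hTc.2 a fun h' => ha h'.2, norm_zero, mul_zero]
  have hB : LocLe κ (F.hamAd T) (2 * v) := hET.of_norm_le' fun a => by
    rw [F.norm_energyMul]
    exact F.ham_norm (hTm a)
  have hBm : ∀ a, F.hamAd T a ∈ F.supp a := fun a => F.ham_mem (hTm a)
  have hD : LocLe κ D (1 / 8) := h.D_loc.mono hμ
  have hρ : 12 * (2 * v) / δ ≤ 1 / 2 := by
    rw [show 12 * (2 * v) / δ = 24 * (v / δ) by ring]; linarith
  have hρ0 : 0 ≤ 12 * (2 * v) / δ := by positivity
  have h2v : 0 ≤ 2 * v := by positivity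
  -- the second-order remainder
  set Y : PatchLabel n m → A := adSeries (expTail 1) T V + adSeries shiftTail T (F.hamAd T) +
    adSeries (expTail 2) T D with hYdef
  have hY : LocLe (κ - δ) Y (288 * u * v) := by
    have e1 := LocLe.adSeries (w := expTail 1) 1 hδ h2v hv hκ1 hT h.V_loc hρ (expTail_nonneg 1)
      (expTail_le 1) (fun j hj => if_pos hj)
    have e2 := LocLe.adSeries (w := shiftTail) 1 hδ h2v h2v hκ1 hT hB hρ shiftTail_nonneg
      shiftTail_le (fun j hj => if_pos hj)
    have e3 := LocLe.adSeries (w := expTail 2) 2 hδ h2v (by norm_num) hκ1 hT hD hρ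
      (expTail_nonneg 2) (expTail_le 2) (fun j hj => if_pos hj)
    refine ((e1.add e2).add e3).mono ?_
    have e4 : 2 * (12 * (2 * v) / δ) ^ 1 * v + 2 * (12 * (2 * v) / δ) ^ 1 * (2 * v) +
        2 * (12 * (2 * v) / δ) ^ 2 * (1 / 8) = 144 * (v / δ) * v + 144 * u * v := by
      rw [hu]; field_simp; ring
    rw [e4]
    nlinarith [mul_le_mul_of_nonneg_right hvδ hv]
  have hYm : ∀ a, Y a ∈ F.supp a := fun a =>
    add_mem (add_mem (F.adSeries_mem h.V_mem.1 hTm _ a) (F.adSeries_mem hBm hTm _ a))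
      (F.adSeries_mem h.D_mem hTm _ a)
  have hD_empty : ∀ a : PatchLabel n m, a.1 = ∅ → ¬ F.Small a := fun a ha hs => by
    have := hs.1; rw [ha] at this; simp at this
  have hTzero : ∀ a : PatchLabel n m, a.1 = ∅ → T a = 0 := fun a ha =>
    hTc.2 a fun h' => hD_empty a ha h'.1
  have hadzero : ∀ (w : ℕ → ℝ) (X : PatchLabel n m → A), (∀ a, a.1 = ∅ → X a = 0) →
      ∀ a, a.1 = ∅ → adSeries w T X a = 0 := by
    intro w X hX a ha
    unfold adSeries
    have : ∀ j, (famAd T)^[j] X a = 0 := fun j => by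
      rcases Nat.eq_zero_or_pos j with rfl | hj
      · exact hX a ha
      · exact famAd_iterate_apply_empty T X ha hj.ne'
    simp [this]
  have hYzero : ∀ a, a.1 = ∅ → Y a = 0 := fun a ha => by
    rw [hYdef, Pi.add_apply, Pi.add_apply,
      hadzero _ V (fun a ha => h.V_mem.2 a fun h' => hD_empty a ha h'.1) a ha,
      hadzero _ (F.hamAd T) (fun a ha => by rw [hamAd, hTzero a ha, mul_zero, zero_mul, sub_zero])
        a ha,
      hadzero _ D (fun a ha => h.D_small a (hD_empty a ha)) a ha]
    simp
  -- first-order brackets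
  have hbr : ∀ χ : PatchLabel n m → PatchLabel n m → Prop, (∀ a b, χ a b → a.Meets b) →
      LocLe (κ - δ) (bracket χ D T) (v / δ) := fun χ hχ => by
    refine (LocLe.bracket hχ hδ hκ1 (by norm_num) h2v hD hT).mono (le_of_eq ?_)
    ring
  have hN := hbr F.Unflagged fun a b hab => hab.1
  have hL := hbr F.Spread fun a b hab => hab.1
  -- the new diagonal terms
  set Z : PatchLabel n m → A := (F.hamAd T - F.energyMul T) + bracket F.Unflagged D T +
    famRestrict (fun a => F.Small a ∧ a.2 = ∅) Y with hZdef
  have hZm : ∀ a, Z a ∈ F.supp a := fun a =>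
    add_mem (add_mem (sub_mem (hBm a) ((F.energyMul_mem hTc).1 a))
      (F.bracket_mem h.D_mem hTm _ a)) (F.famRestrict_mem hYm _ a)
  have hTsmall : ∀ a, ¬ F.Small a → T a = 0 := fun a ha => hTc.2 a fun h' => ha h'.1
  have hZs : ∀ a, ¬ F.Small a → Z a = 0 := fun a ha => by
    simp only [hZdef, Pi.add_apply, Pi.sub_apply, hamAd, energyMul, hTsmall a ha,
      F.unflagged_small D T ha, famRestrict, ha, false_and, if_false]
    simp
  have hZd : ∀ a, a.2 = ∅ ∨ Z a * F.proj ∅ = 0 := fun a => by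
    rcases F.unflagged_mul_proj h.D_mem h.D_small h.D_proj hTm a with h1 | h1
    · exact Or.inl h1
    by_cases h2 : a.2 = ∅
    · exact Or.inl h2
    refine Or.inr ?_
    simp only [hZdef, Pi.add_apply, Pi.sub_apply, add_mul, sub_mul, h1, F.hamAd_mul_proj hTm,
      famRestrict, h2, and_false, if_false]
    simp
  have hZ : LocLe (κ - δ) Z (6 * (v / δ)) := by
    have e1 : LocLe (κ - δ) (F.hamAd T - F.energyMul T) (2 * v + 2 * v) :=
      (hB.sub hET).mono_rate (by linarith)
    have e2 := (e1.add hN).add (hY.of_norm_le' (norm_famRestrict_le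
      (fun a => F.Small a ∧ a.2 = ∅) Y))
    refine e2.mono ?_
    have e3 : v ≤ v / δ := by rw [le_div_iff₀ hδ]; nlinarith
    have e4 := mul_le_mul_of_nonneg_right hu288 hv
    linarith
  obtain ⟨c', Z', hZ1, hZ2, hZ3, hZ4, hZ5⟩ := F.exists_scalar_split hZm hZs hZd
  have hZ' : LocLe (κ - δ) Z' (2 * (6 * (v / δ))) := hZ.of_norm_le (by norm_num) hZ5
  obtain ⟨hZt, hZsite⟩ := F.meanField_of_locLe hδ (by positivity) hZ3 hZ'
  rw [show κ - δ - δ = κ - 2 * δ by ring] at hZt hZsite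
  -- the new remote terms
  have hRs := LocLe.adSeries (w := expTail 1) 1 hδ h2v hr hκ1 hT h.R_loc hρ (expTail_nonneg 1)
    (expTail_le 1) (fun j hj => if_pos hj)
  refine ⟨NormedSpace.exp (total T), NormedSpace.exp (-total T), exp_neg_mul_exp _,
    exp_mul_exp_neg _, c + c', D + Z', famRestrict (fun a => F.Small a ∧ a.2.Nonempty) Y,
    R + adSeries (expTail 1) T R + bracket F.Spread D T + famRestrict F.Large Y, ?_⟩
  constructor
  · have t1 := F.conj_ham hδ h2v h2v hκ1 hT hB hρ hTm
    have t2 := F.conj_total hδ h2v (by norm_num) hκ1 hT hD hρ h.D_mem hTm 2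
    have t3 := F.conj_total hδ h2v hv hκ1 hT h.V_loc hρ h.V_mem.1 hTm 1
    have t4 := F.conj_total hδ h2v hr hκ1 hT h.R_loc hρ h.R_mem hTm 1
    have t5 : NormedSpace.exp (-total T) * (c • 1) * NormedSpace.exp (total T) = c • (1 : A) := by
      rw [mul_smul_comm, mul_one, smul_mul_assoc, exp_neg_mul_exp]
    simp only [Finset.sum_range_succ, Finset.sum_range_zero, zero_add, Nat.factorial_zero,
      Nat.factorial_one, Nat.cast_one, inv_one, one_smul, Function.iterate_zero, id_eq,
      Function.iterate_one] at t2 t3 t4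
    rw [h.eq]
    simp only [mul_add, add_mul]
    rw [t1, t2, t3, t4, t5]
    have hV : total V = -(total (F.energyMul T) + total (bracket F.Flagged D T)) := by
      rw [← total_add, hTeq]
      simp [total]
    have hYt : total (adSeries (expTail 1) T V) + total (adSeries shiftTail T (F.hamAd T)) +
        total (adSeries (expTail 2) T D) =
        total (famRestrict (fun a => F.Small a ∧ a.2 = ∅) Y) +
      total (famRestrict (fun a => F.Small a ∧ a.2.Nonempty) Y) +
      total (famRestrict F.Large Y) := by
      rw [← F.total_trichotomy hYzero, hYdef, total_add, total_add]
    have hZtot : total (F.hamAd T) - total (F.energyMul T) + total (bracket F.Unflagged D T) +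
        total (famRestrict (fun a => F.Small a ∧ a.2 = ∅) Y) = c' • 1 + total Z' := by
      rw [← hZ1, hZdef, total_add, total_add, total_sub]
    rw [F.famAd_eq_add D T]
    simp only [total_add, add_smul]
    rw [hV]
    have e1 := eq_sub_of_add_eq' hYt
    have e2 := eq_sub_of_add_eq' hZtot.symm
    rw [e1, e2]
    abel
  · exact fun a => add_mem (h.D_mem a) (hZ2 a)
  · intro a ha
    rw [Pi.add_apply, h.D_small a ha, hZ3 a ha, add_zero]
  · intro a
    rw [Pi.add_apply, add_mul, h.D_proj, hZ4, add_zero]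
  · exact ⟨F.famRestrict_mem hYm _, fun a ha => if_neg ha⟩
  · exact fun a => add_mem (add_mem (add_mem (h.R_mem a) (F.adSeries_mem h.R_mem hTm _ a))
      (F.bracket_mem h.D_mem hTm _ a)) (F.famRestrict_mem hYm _ a)
  · intro a ha
    simp only [Pi.add_apply, h.R_large a ha, F.adSeries_large h.R_large _ a ha,
      F.spread_large D T ha, famRestrict, if_neg ha, add_zero]
  · intro j
    have e1 := sum_mul_wnorm_add_le (κ := κ - 2 * δ) (X := D) (Y := Z') (μ := μ)
      (μ' := F.Theta δ * (2 * (6 * (v / δ)))) (g := fun a => if j ∈ F.touch a.1 then 1 else 0)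
      (fun a => by positivity) (by
        refine le_trans (Finset.sum_le_sum fun a _ => ?_) (h.D_touch j)
        have := wnorm_mono_rate (show κ - 2 * δ ≤ κ by linarith) D a
        split_ifs <;> simp [this]) (by simpa using hZt j)
    simp only [ite_mul, one_mul, zero_mul] at e1
    refine e1.trans ?_
    rw [hKu]
    nlinarith [mul_nonneg hΘ hu0, mul_le_mul_of_nonneg_left hvδ hΘ]
  · intro i
    have e1 := sum_mul_wnorm_add_le (κ := κ - 2 * δ) (X := D) (Y := Z') (μ := μ)
      (μ' := 2 * (6 * (v / δ)) / δ) (g := fun a => if i ∈ a.1 then (a.1.card : ℝ) else 0)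
      (fun a => by positivity) (by
        refine le_trans (Finset.sum_le_sum fun a _ => ?_) (h.D_site i)
        have := mul_le_mul_of_nonneg_left
          (wnorm_mono_rate (show κ - 2 * δ ≤ κ by linarith) D a) (Nat.cast_nonneg (α := ℝ) a.1.card)
        split_ifs <;> simp [this]) (by simpa [siteSum] using hZsite i)
    simp only [ite_mul, zero_mul] at e1
    refine e1.trans ?_
    rw [hKu, show 2 * (6 * (v / δ)) / δ = 12 * u by rw [hu]; field_simp; ring]
    nlinarith [mul_nonneg hΘ hu0]
  · refine ((hY.of_norm_le' (norm_famRestrict_le _ Y)).mono_rate (by linarith)).mono ?_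
    rw [pow_two, ← mul_assoc, hKu]
    nlinarith [mul_nonneg (mul_nonneg hΘ hu0) hv]
  · have e1 := ((h.R_loc.mono_rate (show κ - δ ≤ κ by linarith)).add hRs).add hL
    have e2 := (e1.add (hY.of_norm_le' (norm_famRestrict_le F.Large Y))).mono_rate
      (show κ - 2 * δ ≤ κ - δ by linarith)
    refine e2.mono ?_
    rw [hKu]
    have e3 : 2 * (12 * (2 * v) / δ) ^ 1 * r = 48 * (v / δ) * r := by ring
    rw [e3]
    have e4 := mul_le_mul_of_nonneg_right hvδ hr
    have e5 : 288 * u * v ≤ u := by nlinarith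
    nlinarith [mul_nonneg (mul_nonneg hΘ hu0) hr, mul_nonneg hΘ hu0, mul_nonneg hu0 hr]

end StabFrame

/-- The growth of the loss constants of the flow under the summability condition. -/
def flowLoss (b c c' α δ : ℝ) : ℝ := 288 * (1 + b * (1 + c * Real.exp (c' * δ ^ (-α)))) / δ ^ 2

theorem half_add_one_le_three_halves_pow (k : ℕ) : 1 + (k : ℝ) / 2 ≤ (3 / 2 : ℝ) ^ k := by
  have := one_add_mul_le_pow (a := (1 / 2 : ℝ)) (by norm_num) k
  norm_num at this
  linarith

/-- Along a geometric sequence of widths the losses grow at most like a tower of base `3 / 2`. -/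
theorem exists_flowLoss_le {b c c' α δ₀ : ℝ} (hb : 0 ≤ b) (hc : 0 ≤ c) (hc' : 0 ≤ c')
    (hα : 0 < α) (hδ₀ : 0 < δ₀) :
    ∃ B : ℝ, 0 < B ∧ ∀ k : ℕ,
      flowLoss b c c' α (δ₀ * ((2 / 3 : ℝ) ^ (1 / α)) ^ k) ≤ Real.exp (B / 2 * (3 / 2) ^ k) := by
  set ρ : ℝ := (2 / 3 : ℝ) ^ (1 / α) with hρ
  have hρ0 : 0 < ρ := by positivity
  set A : ℝ := 288 * (1 + b * (1 + c)) / δ₀ ^ 2 with hA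
  have hA0 : 0 < A := by positivity
  set L : ℝ := |Real.log A| + c' * δ₀ ^ (-α) + 4 * |Real.log ρ| + 1 with hL
  have hL0 : 0 < L := by positivity
  refine ⟨2 * L, by positivity, fun k => ?_⟩
  set t : ℝ := (3 / 2 : ℝ) ^ k with ht
  have ht1 : 1 + (k : ℝ) / 2 ≤ t := half_add_one_le_three_halves_pow k
  have hk0 : (0 : ℝ) ≤ k := Nat.cast_nonneg k
  have ht0 : 1 ≤ t := by linarith
  have e1 : (δ₀ * ρ ^ k) ^ (-α) = δ₀ ^ (-α) * t := by
    rw [Real.mul_rpow hδ₀.le (by positivity), ← Real.rpow_natCast ρ k, ← Real.rpow_mul hρ0.le,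
      hρ, ← Real.rpow_mul (by norm_num), ht]
    congr 1
    rw [show 1 / α * ((k : ℝ) * -α) = -(k : ℝ) by field_simp, Real.rpow_neg (by norm_num),
      Real.rpow_natCast, ← inv_pow]
    norm_num
  have e2 : 1 ≤ Real.exp (c' * (δ₀ ^ (-α) * t)) := Real.one_le_exp (by positivity)
  have e3 : flowLoss b c c' α (δ₀ * ρ ^ k) ≤
      A * Real.exp (c' * (δ₀ ^ (-α) * t)) * Real.exp (4 * |Real.log ρ| * t) := by
    have h1 : ((ρ ^ k) ^ 2)⁻¹ ≤ Real.exp (4 * |Real.log ρ| * t) := by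
      have h2 : ((ρ ^ k) ^ 2)⁻¹ = Real.exp (-(2 * k * Real.log ρ)) := by
        rw [Real.exp_neg, ← pow_mul, mul_comm k 2]
        congr 1
        rw [show 2 * (k : ℝ) * Real.log ρ = ((2 * k : ℕ) : ℝ) * Real.log ρ by push_cast; ring,
          Real.exp_nat_mul, Real.exp_log hρ0]
      rw [h2]
      apply Real.exp_le_exp.2
      have h3 := neg_abs_le (Real.log ρ)
      have h4 := abs_nonneg (Real.log ρ)
      nlinarith
    have h5 : flowLoss b c c' α (δ₀ * ρ ^ k) =
        288 * (1 + b * (1 + c * Real.exp (c' * (δ₀ ^ (-α) * t)))) / δ₀ ^ 2 * ((ρ ^ k) ^ 2)⁻¹ := by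
      rw [flowLoss, e1, mul_pow]
      field_simp
    rw [h5]
    have hδ2 : 0 < δ₀ ^ 2 := by positivity
    refine mul_le_mul ?_ h1 (by positivity) (by positivity)
    rw [hA, div_mul_eq_mul_div]
    refine div_le_div_of_nonneg_right ?_ hδ2.le
    nlinarith [mul_nonneg hb hc, mul_nonneg hb (sub_nonneg.2 e2)]
  refine e3.trans ?_
  have e4 : A ≤ Real.exp (|Real.log A| * t) := by
    calc A = Real.exp (Real.log A) := (Real.exp_log hA0).symm
      _ ≤ _ := Real.exp_le_exp.2 ((le_abs_self _).trans
        (le_mul_of_one_le_right (abs_nonneg _) ht0))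
  calc A * Real.exp (c' * (δ₀ ^ (-α) * t)) * Real.exp (4 * |Real.log ρ| * t)
      ≤ Real.exp (|Real.log A| * t) * Real.exp (c' * (δ₀ ^ (-α) * t)) *
        Real.exp (4 * |Real.log ρ| * t) := by gcongr
    _ = Real.exp ((|Real.log A| + c' * δ₀ ^ (-α) + 4 * |Real.log ρ|) * t) := by
        rw [← Real.exp_add, ← Real.exp_add]; ring_nf
    _ ≤ _ := by
        apply Real.exp_le_exp.2
        rw [hL]
        nlinarith

/-- A schedule of widths and strengths along which the flow converges quadratically. -/
structure FlowSchedule (K : ℝ → ℝ) (κ M ε₀ : ℝ) (δ x : ℕ → ℝ) : Prop where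
  width_pos : ∀ k, 0 < δ k
  width_le : ∀ k, δ k ≤ 1
  width_sum : ∀ k, δ 0 + 2 * ∑ i ∈ Finset.range k, δ i ≤ κ / 2
  strength_pos : ∀ k, 0 < x k
  strength_zero : x 0 = 1
  strength_tendsto : Filter.Tendsto x Filter.atTop (nhds 0)
  loss_le : ∀ k, K (δ k) * (ε₀ * x k) ≤ 1
  loss_sq_le : ∀ k, K (δ k) * (ε₀ * x k ^ 2) ≤ x (k + 1)
  loss_sum : ∀ k, ∑ i ∈ Finset.range k, K (δ i) * x i ≤ M

theorem exists_flowSchedule {b c c' α κ : ℝ} (hb : 0 ≤ b) (hc : 0 ≤ c) (hc' : 0 ≤ c')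
    (hα : 0 < α) (hκ : 0 < κ) :
    ∃ (M ε₀ : ℝ) (δ x : ℕ → ℝ), 0 < ε₀ ∧ 0 ≤ M ∧
      FlowSchedule (flowLoss b c c' α) κ M ε₀ δ x := by
  set ρ : ℝ := (2 / 3 : ℝ) ^ (1 / α) with hρ
  have hρ0 : 0 < ρ := by positivity
  have hρ1 : ρ < 1 := Real.rpow_lt_one (by norm_num) (by norm_num) (by positivity)
  set S : ℝ := 1 + 2 * (1 - ρ)⁻¹ with hS
  have hS' : 0 < (1 - ρ)⁻¹ := inv_pos.2 (by linarith)
  have hS1 : 0 < S := by positivity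
  set δ₀ : ℝ := min 1 (κ / 2 / S) with hδ₀
  have hδ₀0 : 0 < δ₀ := lt_min one_pos (by positivity)
  obtain ⟨B, hB, hK⟩ := exists_flowLoss_le hb hc hc' hα hδ₀0
  set t : ℕ → ℝ := fun k => (3 / 2 : ℝ) ^ k with ht
  have ht1 : ∀ k : ℕ, 1 + (k : ℝ) / 2 ≤ t k := half_add_one_le_three_halves_pow
  set x : ℕ → ℝ := fun k => Real.exp (-(B * (t k - 1))) with hx
  set z : ℝ := Real.exp (-(B / 4)) with hz
  have hz0 : 0 < z := Real.exp_pos _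
  have hz1 : z < 1 := Real.exp_lt_one_iff.2 (by linarith)
  have hgeo : ∀ (w : ℝ), 0 < w → w < 1 → ∀ k, ∑ i ∈ Finset.range k, w ^ i ≤ (1 - w)⁻¹ := by
    intro w hw0 hw1 k
    rw [← tsum_geometric_of_lt_one hw0.le hw1]
    exact (summable_geometric_of_lt_one hw0.le hw1).sum_le_tsum _ fun i _ => by positivity
  have hloss : ∀ k, flowLoss b c c' α (δ₀ * ρ ^ k) * x k ≤ Real.exp (B - B / 2 * t k) := by
    intro k
    calc _ ≤ Real.exp (B / 2 * t k) * x k :=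
          mul_le_mul_of_nonneg_right (hK k) (Real.exp_pos _).le
      _ = _ := by rw [hx, ← Real.exp_add]; ring_nf
  refine ⟨Real.exp B * (1 - z)⁻¹, Real.exp (-B), fun k => δ₀ * ρ ^ k, x, Real.exp_pos _, ?_, ?_⟩
  · have : 0 < (1 - z)⁻¹ := inv_pos.2 (by linarith)
    positivity
  constructor
  · intro k; positivity
  · intro k
    calc δ₀ * ρ ^ k ≤ 1 * 1 := by
          gcongr
          · exact min_le_left _ _
          · exact pow_le_one₀ hρ0.le hρ1.le
      _ = 1 := one_mul 1
  · intro k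
    rw [pow_zero, mul_one, ← Finset.mul_sum]
    calc δ₀ + 2 * (δ₀ * ∑ i ∈ Finset.range k, ρ ^ i) =
        δ₀ * (1 + 2 * ∑ i ∈ Finset.range k, ρ ^ i) := by
          ring
      _ ≤ δ₀ * S := by
          rw [hS]
          have := hgeo ρ hρ0 hρ1 k
          gcongr
      _ ≤ κ / 2 / S * S := by
          gcongr
          exact min_le_right _ _
      _ = κ / 2 := by field_simp
  · exact fun k => Real.exp_pos _
  · simp [hx, ht]
  · have h1 : Filter.Tendsto (fun k => (z ^ 2) ^ k) Filter.atTop (nhds 0) :=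
      tendsto_pow_atTop_nhds_zero_of_lt_one (by positivity) (by nlinarith)
    refine squeeze_zero (fun k => (Real.exp_pos _).le) (fun k => ?_) h1
    rw [hx, hz, ← Real.exp_nat_mul, ← Real.exp_nat_mul]
    apply Real.exp_le_exp.2
    push_cast
    nlinarith [ht1 k]
  · intro k
    calc _ = Real.exp (-B) * (flowLoss b c c' α (δ₀ * ρ ^ k) * x k) := by ring
      _ ≤ Real.exp (-B) * Real.exp (B - B / 2 * t k) := by
          gcongr
          exact hloss k
      _ = Real.exp (-(B / 2 * t k)) := by rw [← Real.exp_add]; ring_nf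
      _ ≤ 1 := Real.exp_le_one_iff.2 (by
          have := ht1 k
          have : 0 ≤ t k := by positivity
          nlinarith)
  · intro k
    calc _ = Real.exp (-B) * (flowLoss b c c' α (δ₀ * ρ ^ k) * x k) * x k := by ring
      _ ≤ Real.exp (-B) * Real.exp (B - B / 2 * t k) * x k := by
          have := hloss k
          have : 0 < x k := Real.exp_pos _
          gcongr
      _ = x (k + 1) := by
          rw [hx, ← Real.exp_add, ← Real.exp_add]
          congr 1
          simp only [ht, pow_succ]
          ring
  · intro k
    calc _ ≤ ∑ i ∈ Finset.range k, Real.exp B * z ^ i := by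
          refine Finset.sum_le_sum fun i _ => (hloss i).trans ?_
          rw [hz, ← Real.exp_nat_mul, ← Real.exp_add]
          apply Real.exp_le_exp.2
          nlinarith [ht1 i]
      _ = Real.exp B * ∑ i ∈ Finset.range k, z ^ i := by rw [Finset.mul_sum]
      _ ≤ _ := by
          have := hgeo z hz0 hz1 k
          gcongr

namespace StabFrame

variable {n m : ℕ} {A : Type*} [NormedRing A] [NormedAlgebra ℂ A]

theorem FlowForm.mono {F : StabFrame n m A} {H : A} {c : ℂ} {D V R : PatchLabel n m → A}
    {κ μ v r μ' v' r' : ℝ} (h : F.FlowForm H c D V R κ μ v r) (hμ : μ ≤ μ') (hv : v ≤ v')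
    (hr : r ≤ r') : F.FlowForm H c D V R κ μ' v' r' :=
  { h with
    D_touch := fun j => (h.D_touch j).trans hμ
    D_site := fun i => (h.D_site i).trans hμ
    V_loc := h.V_loc.mono hv
    R_loc := h.R_loc.mono hr }

theorem FlowForm.iterate [FiniteDimensional ℂ A] [CompleteSpace A] {F : StabFrame n m A} {H : A}
    {K : ℝ → ℝ} {κ M ε₀ ε μ : ℝ} {δ x : ℕ → ℝ} (hs : FlowSchedule K κ M ε₀ δ x)
    (hK : ∀ δ', 0 < δ' → F.stepConst δ' ≤ K δ') (hK0 : ∀ δ', 0 < δ' → 0 ≤ K δ')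
    (hε : 0 ≤ ε) (hε₀ : ε ≤ ε₀) (hμ0 : 0 ≤ μ) (hμ : μ + ε * M ≤ 1 / 8) (hr : ε * (1 + 2 * M) ≤ 1)
    (hκ : 0 < κ)
    (h0 : ∃ (c : ℂ) (D V R : PatchLabel n m → A), F.FlowForm H c D V R (κ - δ 0) μ ε ε) (k : ℕ) :
    ∃ Ω Ω' : A, Ω' * Ω = 1 ∧ Ω * Ω' = 1 ∧ ∃ (c : ℂ) (D V R : PatchLabel n m → A),
      F.FlowForm (Ω' * H * Ω) c D V R (κ - δ 0 - 2 * ∑ i ∈ Finset.range k, δ i)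
        (μ + ε * ∑ i ∈ Finset.range k, K (δ i) * x i) (ε * x k)
        (ε * (1 + 2 * ∑ i ∈ Finset.range k, K (δ i) * x i)) := by
  have hsum0 : ∀ k, 0 ≤ ∑ i ∈ Finset.range k, K (δ i) * x i := fun k =>
    Finset.sum_nonneg fun i _ => mul_nonneg (hK0 _ (hs.width_pos i)) (hs.strength_pos i).le
  induction k with
  | zero =>
    obtain ⟨c, D, V, R, h⟩ := h0
    exact ⟨1, 1, one_mul 1, one_mul 1, c, D, V, R, by simpa [hs.strength_zero] using h⟩
  | succ k ih =>
    obtain ⟨Ω, Ω', h1, h2, c, D, V, R, h⟩ := ih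
    have hδ := hs.width_pos k
    have hx := hs.strength_pos k
    have hKk := hK _ hδ
    have hKk0 := hK0 _ hδ
    have hsk := hsum0 k
    have hM := hs.loss_sum k
    have hv0 : 0 ≤ ε * x k := by positivity
    set sk := ∑ i ∈ Finset.range k, K (δ i) * x i with hsk_def
    have hKv : F.stepConst (δ k) * (ε * x k) ≤ K (δ k) * (ε * x k) := by gcongr
    have hK1 : K (δ k) * (ε * x k) ≤ 1 := le_trans (by gcongr) (hs.loss_le k)
    have hεM : ε * sk ≤ ε * M := by gcongr
    have hr0 : 0 ≤ ε * (1 + 2 * sk) := by positivity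
    have hr1 : ε * (1 + 2 * sk) ≤ 1 := by linarith
    obtain ⟨Ω₂, Ω₂', h3, h4, c', D', V', R', h'⟩ := h.step (δ := δ k) (by positivity)
      (by linarith) hv0 hr0 hδ (hs.width_le k) (by
        have := hs.width_sum (k + 1)
        rw [Finset.sum_range_succ] at this
        linarith) (hKv.trans hK1)
    refine ⟨Ω * Ω₂, Ω₂' * Ω', ?_, ?_, c', D', V', R', ?_⟩
    · rw [mul_assoc, ← mul_assoc Ω', h1, one_mul, h3]
    · rw [mul_assoc, ← mul_assoc Ω₂, h4, one_mul, h2]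
    rw [Finset.sum_range_succ, Finset.sum_range_succ, ← hsk_def]
    have e1 : Ω₂' * Ω' * H * (Ω * Ω₂) = Ω₂' * (Ω' * H * Ω) * Ω₂ := by simp only [mul_assoc]
    rw [e1, show κ - δ 0 - 2 * (∑ i ∈ Finset.range k, δ i + δ k) =
      κ - δ 0 - 2 * ∑ i ∈ Finset.range k, δ i - 2 * δ k by ring]
    refine h'.mono ?_ ?_ ?_
    · linarith
    · calc F.stepConst (δ k) * (ε * x k) ^ 2 ≤ K (δ k) * (ε * x k) ^ 2 := by gcongr
        _ = ε * (K (δ k) * (ε * x k ^ 2)) := by ring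
        _ ≤ ε * (K (δ k) * (ε₀ * x k ^ 2)) := by gcongr
        _ ≤ _ := by
          gcongr
          exact hs.loss_sq_le k
    · calc _ ≤ ε * (1 + 2 * sk) + K (δ k) * (ε * x k) * (1 + ε * (1 + 2 * sk)) := by
            gcongr
        _ ≤ ε * (1 + 2 * sk) + K (δ k) * (ε * x k) * (1 + 1) := by gcongr
        _ = _ := by ring

end StabFrame

/-! ### Spectrum of weakly coupled sectors -/

/-- An operator `G` on a space decomposed into sectors `σ` that acts approximately as the energy
`En σ` there, where one sector `o` has energy zero and the others have energy at least one. -/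
structure GappedSectors {ι E : Type*} [Fintype ι] [NormedAddCommGroup E] [NormedSpace ℂ E]
    (p : ι → E →ₗ[ℂ] E) (o : ι) (En : ι → ℝ) (G : E →ₗ[ℂ] E) (τ : ℝ) : Prop where
  sum_apply : ∀ ψ, ∑ σ, p σ ψ = ψ
  apply_self : ∀ ψ, p o (p o ψ) = p o ψ
  energy_zero : En o = 0
  one_le_energy : ∀ σ, σ ≠ o → 1 ≤ En σ
  nonneg : 0 ≤ τ
  le : τ ≤ 1 / 16
  bound : ∀ ψ, ∑ σ, ‖p σ (G ψ) - (En σ : ℂ) • p σ ψ‖ ≤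
    1 / 8 * ∑ σ, En σ * ‖p σ ψ‖ + τ * ∑ σ, ‖p σ ψ‖

namespace GappedSectors

variable {ι E : Type*} [Fintype ι] [NormedAddCommGroup E] [NormedSpace ℂ E]
  {p : ι → E →ₗ[ℂ] E} {o : ι} {En : ι → ℝ} {G : E →ₗ[ℂ] E} {τ : ℝ}

/-- The size of the components of a vector in the excited sectors. -/
def excited (p : ι → E →ₗ[ℂ] E) (o : ι) (ψ : E) : ℝ := ∑ σ ∈ Finset.univ.erase o, ‖p σ ψ‖

/-- The energy carried by a vector. -/
def load (p : ι → E →ₗ[ℂ] E) (o : ι) (En : ι → ℝ) (ψ : E) : ℝ :=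
  ∑ σ ∈ Finset.univ.erase o, En σ * ‖p σ ψ‖

theorem excited_nonneg (ψ : E) : 0 ≤ excited p o ψ := Finset.sum_nonneg fun _ _ => norm_nonneg _

theorem excited_add_le (ψ φ : E) : excited p o (ψ + φ) ≤ excited p o ψ + excited p o φ := by
  unfold excited
  rw [← Finset.sum_add_distrib]
  refine Finset.sum_le_sum fun σ _ => ?_
  rw [map_add]
  exact norm_add_le _ _

theorem excited_smul (z : ℂ) (ψ : E) : excited p o (z • ψ) = ‖z‖ * excited p o ψ := by
  unfold excited
  rw [Finset.mul_sum]
  refine Finset.sum_congr rfl fun σ _ => ?_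
  rw [map_smul, norm_smul]

theorem excited_sum_le {κ : Type*} (s : Finset κ) (ψ : κ → E) :
    excited p o (∑ i ∈ s, ψ i) ≤ ∑ i ∈ s, excited p o (ψ i) := by
  induction s using Finset.induction_on with
  | empty => simp [excited]
  | insert a s ha ih =>
    rw [Finset.sum_insert ha, Finset.sum_insert ha]
    exact (excited_add_le _ _).trans (by linarith)

theorem excited_le_load (h : GappedSectors p o En G τ) (ψ : E) : excited p o ψ ≤ load p o En ψ :=
  Finset.sum_le_sum fun σ hσ =>
    le_mul_of_one_le_left (norm_nonneg _) (h.one_le_energy σ (Finset.ne_of_mem_erase hσ))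

theorem split_bound (h : GappedSectors p o En G τ) (ψ : E) : ‖p o (G ψ)‖ +
      ∑ σ ∈ Finset.univ.erase o, ‖p σ (G ψ) - (En σ : ℂ) • p σ ψ‖ ≤
    1 / 8 * load p o En ψ + τ * (‖p o ψ‖ + excited p o ψ) := by
  have := h.bound ψ
  rw [← Finset.add_sum_erase _ _ (Finset.mem_univ o), ← Finset.add_sum_erase Finset.univ
    (fun σ => En σ * ‖p σ ψ‖) (Finset.mem_univ o), ← Finset.add_sum_erase Finset.univ
    (fun σ => ‖p σ ψ‖) (Finset.mem_univ o), h.energy_zero] at this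
  simpa [load, excited] using this

theorem load_le (h : GappedSectors p o En G τ) (ψ : E) : load p o En ψ ≤ excited p o (G ψ) +
      ∑ σ ∈ Finset.univ.erase o, ‖p σ (G ψ) - (En σ : ℂ) • p σ ψ‖ := by
  unfold load excited
  rw [← Finset.sum_add_distrib]
  refine Finset.sum_le_sum fun σ hσ => ?_
  have h1 := h.one_le_energy σ (Finset.ne_of_mem_erase hσ)
  have h2 : En σ * ‖p σ ψ‖ = ‖(En σ : ℂ) • p σ ψ‖ := by
    rw [norm_smul, Complex.norm_real, Real.norm_of_nonneg (by linarith)]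
  rw [h2]
  have h3 := norm_sub_norm_le ((En σ : ℂ) • p σ ψ) (p σ (G ψ))
  rw [norm_sub_rev] at h3
  linarith

theorem eq_zero_of_components (h : GappedSectors p o En G τ) {ψ : E} (h0 : ‖p o ψ‖ = 0)
    (h1 : excited p o ψ ≤ 0) : ψ = 0 := by
  rw [← h.sum_apply ψ]
  refine Finset.sum_eq_zero fun σ _ => ?_
  by_cases hσ : σ = o
  · rw [hσ]; exact norm_eq_zero.1 h0
  · have h2 := (Finset.sum_eq_zero_iff_of_nonneg fun _ _ => norm_nonneg _).1
      (le_antisymm h1 (excited_nonneg ψ)) σ (Finset.mem_erase.2 ⟨hσ, Finset.mem_univ σ⟩)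
    exact norm_eq_zero.1 h2

/-- An eigenvalue below the gap is close to zero. -/
theorem norm_eigenvalue_le (h : GappedSectors p o En G τ) {z : ℂ} {ψ : E} (hψ : ψ ≠ 0)
    (hz : G ψ = z • ψ) (hre : z.re < 3 / 4) :
    ‖z‖ ≤ τ := by
  have h1 := h.split_bound ψ
  have h2 : 1 / 4 * load p o En ψ ≤
      ∑ σ ∈ Finset.univ.erase o, ‖p σ (G ψ) - (En σ : ℂ) • p σ ψ‖ := by
    unfold load
    rw [Finset.mul_sum]
    refine Finset.sum_le_sum fun σ hσ => ?_
    have h3 := h.one_le_energy σ (Finset.ne_of_mem_erase hσ)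
    rw [hz, map_smul, ← sub_smul, norm_smul, ← mul_assoc]
    refine mul_le_mul_of_nonneg_right ?_ (norm_nonneg _)
    have h4 := (abs_le.1 (Complex.abs_re_le_norm (z - (En σ : ℂ)))).1
    simp only [Complex.sub_re, Complex.ofReal_re] at h4
    linarith
  rw [hz, map_smul, norm_smul, ← hz] at h1
  have h5 := h.excited_le_load ψ
  have h6 := excited_nonneg (p := p) (o := o) ψ
  have h7 := h.nonneg
  have h8 := h.le
  have h9 := norm_nonneg (p o ψ)
  have h10 : τ * excited p o ψ ≤ 1 / 16 * load p o En ψ := by nlinarith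
  have h11 : ‖z‖ * ‖p o ψ‖ + 1 / 16 * load p o En ψ ≤ τ * ‖p o ψ‖ := by linarith
  rcases h9.eq_or_lt with h12 | h12
  · exact absurd (h.eq_zero_of_components h12.symm (by rw [← h12] at h11; linarith)) hψ
  · have : ‖z‖ * ‖p o ψ‖ ≤ τ * ‖p o ψ‖ := by linarith
    exact le_of_mul_le_mul_right this h12

/-- Vectors dominated by their excited part stay so, and their excited part hardly shrinks. -/
theorem cone_invariant (h : GappedSectors p o En G τ) {ψ : E} (hψ : ‖p o ψ‖ ≤ excited p o ψ) :
    ‖p o (G ψ)‖ ≤ excited p o (G ψ) ∧ 3 / 4 * excited p o ψ ≤ excited p o (G ψ) := by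
  have h1 := h.split_bound ψ
  have h2 := h.load_le ψ
  have h3 := h.excited_le_load ψ
  have h4 := h.nonneg
  have h5 := h.le
  have h6 := norm_nonneg (p o (G ψ))
  have h7 : τ * (‖p o ψ‖ + excited p o ψ) ≤ 1 / 8 * load p o En ψ := by
    nlinarith [norm_nonneg (p o ψ), excited_nonneg (p := p) (o := o) ψ]
  have h8 : 0 ≤ ∑ σ ∈ Finset.univ.erase o, ‖p σ (G ψ) - (En σ : ℂ) • p σ ψ‖ :=
    Finset.sum_nonneg fun _ _ => norm_nonneg _
  have h9 := excited_nonneg (p := p) (o := o) ψ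
  constructor <;> linarith

theorem cone_invariant_pow (h : GappedSectors p o En G τ) {ψ : E}
    (hψ : ‖p o ψ‖ ≤ excited p o ψ) (j : ℕ) :
    ‖p o ((G ^ j) ψ)‖ ≤ excited p o ((G ^ j) ψ) ∧
      (3 / 4) ^ j * excited p o ψ ≤ excited p o ((G ^ j) ψ) := by
  induction j with
  | zero => simpa using hψ
  | succ j ih =>
    rw [pow_succ' G, Module.End.mul_apply]
    have h1 := h.cone_invariant ih.1
    refine ⟨h1.1, le_trans (le_trans (le_of_eq ?_)
      (mul_le_mul_of_nonneg_left ih.2 (by norm_num : (0 : ℝ) ≤ 3 / 4))) h1.2⟩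
    ring

/-- Vectors whose image is not dominated by its excited part are strongly contracted. -/
theorem contract_of_not_cone (h : GappedSectors p o En G τ) {ψ : E} (hψ : excited p o ψ ≤ ‖p o ψ‖)
    (hG : excited p o (G ψ) ≤ ‖p o (G ψ)‖) : ‖p o (G ψ)‖ ≤ 1 / 4 * ‖p o ψ‖ := by
  have h1 := h.split_bound ψ
  have h2 := h.load_le ψ
  have h4 := h.nonneg
  have h5 := h.le
  have h7 : τ * (‖p o ψ‖ + excited p o ψ) ≤ 1 / 8 * ‖p o ψ‖ := by
    nlinarith [norm_nonneg (p o ψ), excited_nonneg (p := p) (o := o) ψ]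
  have h8 : 0 ≤ ∑ σ ∈ Finset.univ.erase o, ‖p σ (G ψ) - (En σ : ℂ) • p σ ψ‖ :=
    Finset.sum_nonneg fun _ _ => norm_nonneg _
  linarith [norm_nonneg (p o ψ)]

variable {κ : Type*} [Fintype κ]

theorem pow_apply_sum {b : κ → E} {z : κ → ℂ} (hz : ∀ i, G (b i) = z i • b i) (c : κ → ℂ) (j : ℕ) :
    (G ^ j) (∑ i, c i • b i) = ∑ i, (c i * z i ^ j) • b i := by
  induction j with
  | zero => simp
  | succ j ih =>
    rw [pow_succ' G, Module.End.mul_apply, ih, map_sum]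
    refine Finset.sum_congr rfl fun i _ => ?_
    rw [map_smul, hz, smul_smul, pow_succ, mul_assoc]

/-- Combinations of eigenvectors with small eigenvalues are determined by their component in the
zero-energy sector. -/
theorem eq_zero_of_low (h : GappedSectors p o En G τ) {b : κ → E} {z : κ → ℂ}
    (hz : ∀ i, G (b i) = z i • b i) {c : κ → ℂ}
    (hlow : ∀ i, c i ≠ 0 → ‖z i‖ ≤ 1 / 2) (h0 : p o (∑ i, c i • b i) = 0) :
    ∑ i, c i • b i = 0 := by
  set ψ := ∑ i, c i • b i with hψ
  set C : ℝ := ∑ i, ‖c i‖ * excited p o (b i) with hC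
  have hcone : ‖p o ψ‖ ≤ excited p o ψ := by rw [h0, norm_zero]; exact excited_nonneg ψ
  refine h.eq_zero_of_components (by rw [h0, norm_zero]) ?_
  by_contra! hpos
  have hle : ∀ j : ℕ, (3 / 4) ^ j * excited p o ψ ≤ (1 / 2) ^ j * C := by
    intro j
    refine (h.cone_invariant_pow hcone j).2.trans ?_
    rw [hψ, pow_apply_sum hz, hC, Finset.mul_sum]
    refine (excited_sum_le _ _).trans (Finset.sum_le_sum fun i _ => ?_)
    rw [excited_smul, norm_mul, norm_pow, ← mul_assoc, mul_comm (_ ^ j)]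
    refine mul_le_mul_of_nonneg_right ?_ (excited_nonneg _)
    by_cases hc : c i = 0
    · simp [hc]
    · have := hlow i hc
      gcongr
  have hle' : ∀ j : ℕ, (3 / 2) ^ j * excited p o ψ ≤ C := by
    intro j
    have h1 := mul_le_mul_of_nonneg_left (hle j) (by positivity : (0 : ℝ) ≤ 2 ^ j)
    rw [← mul_assoc, ← mul_assoc, ← mul_pow, ← mul_pow] at h1
    norm_num at h1
    exact h1
  obtain ⟨j, hj⟩ := pow_unbounded_of_one_lt (C / excited p o ψ) (by norm_num : (1 : ℝ) < 3 / 2)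
  rw [div_lt_iff₀ hpos] at hj
  linarith [hle' j]

/-- Combinations of eigenvectors with large eigenvalues are determined by their components in the
excited sectors. -/
theorem eq_zero_of_high (h : GappedSectors p o En G τ) {b : κ → E} {z : κ → ℂ}
    (hz : ∀ i, G (b i) = z i • b i) {c : κ → ℂ}
    (hhigh : ∀ i, c i ≠ 0 → 1 / 2 ≤ ‖z i‖) (h0 : excited p o (∑ i, c i • b i) = 0) :
    ∑ i, c i • b i = 0 := by
  set φ : ℕ → E := fun j => ∑ i, (c i * (z i)⁻¹ ^ j) • b i with hφ
  have hstep : ∀ j k, (G ^ k) (φ (j + k)) = φ j := by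
    intro j k
    rw [hφ]
    simp only
    rw [pow_apply_sum hz]
    refine Finset.sum_congr rfl fun i _ => ?_
    by_cases hc : c i = 0
    · simp [hc]
    · have hz0 : z i ≠ 0 := norm_pos_iff.1 (by linarith [hhigh i hc])
      congr 1
      rw [pow_add, mul_assoc, mul_assoc, ← mul_pow, inv_mul_cancel₀ hz0, one_pow, mul_one]
  have hφ0 : φ 0 = ∑ i, c i • b i := by simp [hφ]
  rw [← hφ0] at h0 ⊢
  by_contra hne
  have hout : ∀ j, excited p o (φ j) ≤ ‖p o (φ j)‖ := by
    intro j
    by_contra! hlt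
    have h1 := (h.cone_invariant_pow hlt.le j).1
    have h2 := hstep 0 j
    rw [zero_add] at h2
    rw [h2, h0] at h1
    exact hne (h.eq_zero_of_components (le_antisymm h1 (norm_nonneg _)) h0.le)
  have hgrow : ∀ j : ℕ, 4 ^ j * ‖p o (φ 0)‖ ≤ ‖p o (φ j)‖ := by
    intro j
    induction j with
    | zero => simp
    | succ j ih =>
      have h1 := hstep j 1
      rw [pow_one] at h1
      have h2 := h.contract_of_not_cone (hout (j + 1)) (by rw [h1]; exact hout j)
      rw [h1] at h2
      rw [pow_succ]
      linarith
  set C : ℝ := ∑ i, ‖c i‖ * ‖p o (b i)‖ with hC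
  have hle : ∀ j : ℕ, ‖p o (φ j)‖ ≤ 2 ^ j * C := by
    intro j
    rw [hφ, hC, Finset.mul_sum]
    simp only
    rw [map_sum]
    refine (norm_sum_le _ _).trans (Finset.sum_le_sum fun i _ => ?_)
    rw [map_smul, norm_smul, norm_mul, norm_pow, norm_inv, ← mul_assoc, mul_comm (2 ^ j)]
    refine mul_le_mul_of_nonneg_right ?_ (norm_nonneg _)
    by_cases hc : c i = 0
    · simp [hc]
    · have h1 := hhigh i hc
      have h2 : ‖z i‖⁻¹ ≤ 2 := by
        rw [inv_le_comm₀ (by linarith) (by norm_num)]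
        linarith
      gcongr
  have hpos : 0 < ‖p o (φ 0)‖ := (norm_nonneg _).lt_of_ne fun h1 =>
    hne (h.eq_zero_of_components h1.symm h0.le)
  have hle' : ∀ j : ℕ, 2 ^ j * ‖p o (φ 0)‖ ≤ C := by
    intro j
    have h1 := (hgrow j).trans (hle j)
    rw [show (4 : ℝ) = 2 * 2 by norm_num, mul_pow, mul_assoc] at h1
    exact le_of_mul_le_mul_left h1 (by positivity)
  obtain ⟨j, hj⟩ := pow_unbounded_of_one_lt (C / ‖p o (φ 0)‖) (by norm_num : (1 : ℝ) < 2)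
  rw [div_lt_iff₀ hpos] at hj
  linarith [hle' j]

/-- The number of eigenvalues below the gap is the dimension of the zero-energy sector. -/
theorem card_low_eq (h : GappedSectors p o En G τ) [FiniteDimensional ℂ E]
    (hortho : ∀ σ, σ ≠ o → ∀ ψ, p σ (p o ψ) = 0)
    (b : Module.Basis κ ℂ E) {z : κ → ℂ} (hz : ∀ i, G (b i) = z i • b i) :
    (Finset.univ.filter fun i => (z i).re < 3 / 4).card =
      Module.finrank ℂ (LinearMap.range (p o)) := by
  have hdim : Module.finrank ℂ E = Fintype.card κ := Module.finrank_eq_card_basis b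
  have hrank := LinearMap.finrank_range_add_finrank_ker (p o)
  have hsplit := Finset.card_filter_add_card_filter_not (s := (Finset.univ : Finset κ))
    (fun i => (z i).re < 3 / 4)
  rw [Finset.card_univ] at hsplit
  set lo := Finset.univ.filter fun i => (z i).re < 3 / 4 with hlo
  set hi := Finset.univ.filter fun i => ¬ (z i).re < 3 / 4 with hhi
  have hext : ∀ (s : Finset κ) (c : s → ℂ), ∑ i : s, c i • b i =
      ∑ i, (if hi : i ∈ s then c ⟨i, hi⟩ else 0) • b i := by
    intro s c
    rw [← Finset.sum_subset (Finset.subset_univ s) fun i _ hi => by rw [dif_neg hi, zero_smul],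
      ← Finset.sum_coe_sort s]
    refine Finset.sum_congr rfl fun i _ => ?_
    rw [dif_pos i.2]
  have hzero : ∀ (s : Finset κ) (c : s → ℂ), ∑ i : s, c i • b i = 0 → ∀ i, c i = 0 := by
    intro s c hc
    have h1 : LinearIndependent ℂ fun i : s => b i :=
      b.linearIndependent.comp _ Subtype.val_injective
    exact Fintype.linearIndependent_iff.1 h1 c hc
  have hcard_lo : lo.card ≤ Module.finrank ℂ (LinearMap.range (p o)) := by
    have hli : LinearIndependent ℂ fun i : lo =>
        (⟨p o (b i), LinearMap.mem_range_self _ _⟩ : LinearMap.range (p o)) := by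
      rw [Fintype.linearIndependent_iff]
      intro c hc
      refine hzero lo c ?_
      have h1 : p o (∑ i : lo, c i • b i) = 0 := by
        have := congrArg Subtype.val hc
        simpa [map_sum] using this
      rw [hext] at h1 ⊢
      refine h.eq_zero_of_low hz (fun i hi => ?_) h1
      by_cases hmem : i ∈ lo
      · have h2 := h.norm_eigenvalue_le (b.ne_zero i) (hz i) (Finset.mem_filter.1 hmem).2
        linarith [h.le]
      · exact absurd (dif_neg hmem) hi
    simpa using hli.fintype_card_le_finrank
  have hcard_hi : hi.card ≤ Module.finrank ℂ (LinearMap.ker (p o)) := by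
    have hli : LinearIndependent ℂ fun i : hi =>
        (⟨b i - p o (b i), by rw [LinearMap.mem_ker, map_sub, h.apply_self, sub_self]⟩ :
          LinearMap.ker (p o)) := by
      rw [Fintype.linearIndependent_iff]
      intro c hc
      refine hzero hi c ?_
      have h1 : ∑ i : hi, c i • b i = p o (∑ i : hi, c i • b i) := by
        have := congrArg Subtype.val hc
        simp only [Submodule.coe_sum, Submodule.coe_smul, smul_sub, Finset.sum_sub_distrib,
          Submodule.coe_zero] at this
        rw [map_sum]
        simp only [map_smul]
        exact sub_eq_zero.1 this
      have h2 : excited p o (∑ i : hi, c i • b i) = 0 := by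
        refine Finset.sum_eq_zero fun σ hσ => ?_
        rw [h1, hortho σ (Finset.ne_of_mem_erase hσ), norm_zero]
      rw [hext] at h2 ⊢
      refine h.eq_zero_of_high hz (fun i hi' => ?_) h2
      by_cases hmem : i ∈ hi
      · have h3 := not_lt.1 (Finset.mem_filter.1 hmem).2
        linarith [Complex.re_le_norm (z i)]
      · exact absurd (dif_neg hmem) hi'
    simpa using hli.fintype_card_le_finrank
  omega

end GappedSectors

namespace StabFrame

variable {n m : ℕ} {E : Type*} [NormedAddCommGroup E] [NormedSpace ℂ E]
  (F : StabFrame n m (E →L[ℂ] E))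

/-- The sector projections form a resolution of the identity. -/
structure Resolved : Prop where
  sum_proj : ∑ σ, F.proj σ = 1
  mul_self : ∀ σ, F.proj σ * F.proj σ = F.proj σ
  mul_of_ne : ∀ σ τ, σ ≠ τ → F.proj σ * F.proj τ = 0

theorem Resolved.proj_ham {F : StabFrame n m (E →L[ℂ] E)} (h : F.Resolved) (σ : Finset (Fin m)) :
    F.proj σ * F.ham = ((F.energy σ : ℝ) : ℂ) • F.proj σ := by
  calc F.proj σ * F.ham = F.proj σ * F.ham * ∑ τ, F.proj τ := by rw [h.sum_proj, mul_one]
    _ = ∑ τ, ((∑ j ∈ τ, F.lam j : ℝ) : ℂ) • (F.proj σ * F.proj τ) := by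
        rw [Finset.mul_sum]
        refine Finset.sum_congr rfl fun τ _ => ?_
        rw [mul_assoc, F.ham_proj, mul_smul_comm]
    _ = _ := by
        rw [Finset.sum_eq_single σ (fun τ _ hτ => by rw [h.mul_of_ne σ τ hτ.symm, smul_zero])
          (fun h => absurd (Finset.mem_univ σ) h), h.mul_self]
        rfl

theorem sum_norm_proj_le {X : PatchLabel n m → E →L[ℂ] E} (hX : ∀ a, X a ∈ F.supp a) (ψ : E) :
    ∑ σ, ‖F.proj σ (total X ψ)‖ ≤ ∑ a, ∑ σ, ‖X a (F.proj σ ψ)‖ := by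
  calc ∑ σ, ‖F.proj σ (total X ψ)‖ ≤ ∑ σ, ∑ a, ‖F.proj σ (X a ψ)‖ := by
        refine Finset.sum_le_sum fun σ _ => ?_
        rw [total, sum_apply, map_sum]
        exact norm_sum_le _ _
    _ = ∑ a, ∑ σ, ‖F.proj σ (X a ψ)‖ := Finset.sum_comm
    _ = _ := by
        refine Finset.sum_congr rfl fun a _ => ?_
        have hinv : Function.Involutive fun σ : Finset (Fin m) => symmDiff σ a.2 := fun σ =>
          symmDiff_symmDiff_cancel_right _ _
        rw [← Equiv.sum_comp hinv.toPerm fun σ => ‖X a (F.proj σ ψ)‖]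
        refine Finset.sum_congr rfl fun σ _ => ?_
        have h1 := F.mul_proj (symmDiff σ a.2) (hX a)
        rw [symmDiff_symmDiff_cancel_right] at h1
        exact congrArg norm (DFunLike.congr_fun h1 ψ).symm

theorem sum_norm_proj_le_of_locLe {X : PatchLabel n m → E →L[ℂ] E} {κ x : ℝ}
    (hX : ∀ a, X a ∈ F.supp a) (hX0 : ∀ a, a.1 = ∅ → X a = 0) (hloc : LocLe κ X x)
    {w : ℝ} (hw : 0 ≤ w) (hw' : ∀ a, X a ≠ 0 → Real.exp (-(κ * a.1.card)) ≤ w) (ψ : E) :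
    ∑ σ, ‖F.proj σ (total X ψ)‖ ≤ n * (x * w) * ∑ σ, ‖F.proj σ ψ‖ := by
  have h1 : ∑ a, ‖X a‖ ≤ n * (x * w) := by
    calc ∑ a, ‖X a‖ ≤ ∑ a, ∑ i, if i ∈ a.1 then w * wnorm κ X a else 0 := by
          refine Finset.sum_le_sum fun a _ => ?_
          by_cases ha : X a = 0
          · rw [ha, norm_zero]
            exact Finset.sum_nonneg fun i _ => by
              split_ifs
              exacts [mul_nonneg hw (wnorm_nonneg _ _ _), le_rfl]
          · obtain ⟨i, hi⟩ := Finset.nonempty_iff_ne_empty.2 fun h => ha (hX0 a h)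
            have h2 : ‖X a‖ ≤ w * wnorm κ X a := by
              calc ‖X a‖ = Real.exp (-(κ * a.1.card)) * wnorm κ X a := by
                    rw [wnorm, mul_left_comm, ← Real.exp_add, neg_add_cancel, Real.exp_zero,
                      mul_one]
                _ ≤ _ := mul_le_mul_of_nonneg_right (hw' a ha) (wnorm_nonneg _ _ _)
            refine h2.trans ?_
            have h3 := Finset.single_le_sum
              (f := fun i => if i ∈ a.1 then w * wnorm κ X a else 0) (fun i _ => by
                split_ifs
                exacts [mul_nonneg hw (wnorm_nonneg _ _ _), le_rfl]) (Finset.mem_univ i)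
            simpa only [if_pos hi] using h3
      _ = ∑ i : Fin n, w * siteSum (wnorm κ X) i := by
          rw [Finset.sum_comm]
          refine Finset.sum_congr rfl fun i _ => ?_
          rw [siteSum, Finset.mul_sum]
          refine Finset.sum_congr rfl fun a _ => ?_
          rw [mul_ite, mul_zero]
      _ ≤ ∑ _i : Fin n, w * x := Finset.sum_le_sum fun i _ =>
          mul_le_mul_of_nonneg_left (hloc i) hw
      _ = _ := by
          rw [Finset.sum_const, Finset.card_univ, Fintype.card_fin, nsmul_eq_mul, mul_comm w x]
  refine (F.sum_norm_proj_le hX ψ).trans ?_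
  calc _ ≤ ∑ a, ∑ σ, ‖X a‖ * ‖F.proj σ ψ‖ := Finset.sum_le_sum fun a _ =>
        Finset.sum_le_sum fun σ _ => (X a).le_opNorm _
    _ = (∑ a, ‖X a‖) * ∑ σ, ‖F.proj σ ψ‖ := by
        rw [Finset.sum_mul]
        exact Finset.sum_congr rfl fun a _ => (Finset.mul_sum _ _ _).symm
    _ ≤ _ := mul_le_mul_of_nonneg_right h1 (Finset.sum_nonneg fun _ _ => norm_nonneg _)

theorem sum_norm_proj_diagonal_le {D : PatchLabel n m → E →L[ℂ] E} {κ μ : ℝ} (hκ : 0 ≤ κ)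
    (hμ : 0 ≤ μ) (hD : ∀ a, D a ∈ F.supp a) (hsmall : ∀ a, ¬ F.Small a → D a = 0)
    (hproj : ∀ a, D a * F.proj ∅ = 0)
    (htouch : ∀ j, (∑ a : PatchLabel n m, if j ∈ F.touch a.1 then wnorm κ D a else 0) ≤ μ)
    (ψ : E) :
    ∑ σ, ‖F.proj σ (total D ψ)‖ ≤ μ * ∑ σ, F.energy σ * ‖F.proj σ ψ‖ := by
  refine (F.sum_norm_proj_le hD ψ).trans ?_
  rw [Finset.sum_comm, Finset.mul_sum]
  refine Finset.sum_le_sum fun σ _ => ?_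
  have h1 : ∀ a, ‖D a (F.proj σ ψ)‖ ≤
      (∑ j ∈ σ, if j ∈ F.touch a.1 then wnorm κ D a else 0) * ‖F.proj σ ψ‖ := by
    intro a
    have hnn : ∀ j ∈ σ, 0 ≤ if j ∈ F.touch a.1 then wnorm κ D a else 0 := fun j _ => by
      split_ifs
      exacts [wnorm_nonneg _ _ _, le_rfl]
    by_cases ha : F.Small a ∧ ∃ j ∈ σ, j ∈ F.touch a.1
    · obtain ⟨-, j, hj, hja⟩ := ha
      refine ((D a).le_opNorm _).trans (mul_le_mul_of_nonneg_right ?_ (norm_nonneg _))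
      have h2 := Finset.single_le_sum hnn hj
      rw [if_pos hja] at h2
      refine le_trans (le_mul_of_one_le_right (norm_nonneg _) ?_) h2
      exact Real.one_le_exp (by positivity)
    · have h3 : D a (F.proj σ ψ) = 0 := by
        by_cases hs : F.Small a
        · have h4 := F.kill (σ := σ) hs.2 (hD a) (hproj a) fun j hj hja => ha ⟨hs, j, hj, hja⟩
          exact DFunLike.congr_fun h4 ψ
        · rw [hsmall a hs]; rfl
      rw [h3, norm_zero]
      exact mul_nonneg (Finset.sum_nonneg hnn) (norm_nonneg _)
  calc _ ≤ ∑ a, (∑ j ∈ σ, if j ∈ F.touch a.1 then wnorm κ D a else 0) * ‖F.proj σ ψ‖ :=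
        Finset.sum_le_sum fun a _ => h1 a
    _ = (∑ j ∈ σ, ∑ a, if j ∈ F.touch a.1 then wnorm κ D a else 0) * ‖F.proj σ ψ‖ := by
        rw [← Finset.sum_mul, Finset.sum_comm]
    _ ≤ (∑ _j ∈ σ, μ) * ‖F.proj σ ψ‖ :=
        mul_le_mul_of_nonneg_right (Finset.sum_le_sum fun j _ => htouch j) (norm_nonneg _)
    _ = μ * (σ.card * ‖F.proj σ ψ‖) := by rw [Finset.sum_const, nsmul_eq_mul]; ring
    _ ≤ _ := by
        have := F.card_le_energy σ
        gcongr

theorem FlowForm.gappedSectors {F : StabFrame n m (E →L[ℂ] E)} {H : E →L[ℂ] E} {c : ℂ}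
    {D V R : PatchLabel n m → E →L[ℂ] E} {κ μ v r τ w : ℝ} (h : F.FlowForm H c D V R κ μ v r)
    (hF : F.Resolved) (hμ0 : 0 ≤ μ) (hμ : μ ≤ 1 / 8) (hκ : 0 ≤ κ) (hv : 0 ≤ v) (hr : 0 ≤ r)
    (hw : Real.exp (-(κ * F.ds)) ≤ w) (hτ : n * (v + r * w) ≤ τ) (hτ' : τ ≤ 1 / 16) :
    GappedSectors (fun σ => (F.proj σ : E →ₗ[ℂ] E)) ∅ F.energy
      ((H - c • (1 : E →L[ℂ] E) : E →L[ℂ] E) : E →ₗ[ℂ] E) τ := by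
  have hw0 : 0 ≤ w := (Real.exp_pos _).le.trans hw
  constructor
  · intro ψ
    have := DFunLike.congr_fun hF.sum_proj ψ
    simpa [sum_apply] using this
  · intro ψ
    exact DFunLike.congr_fun (hF.mul_self ∅) ψ
  · simp [energy]
  · exact fun σ hσ => F.one_le_energy (Finset.nonempty_iff_ne_empty.2 hσ)
  · exact le_trans (by positivity) hτ
  · exact hτ'
  · intro ψ
    have h1 : ∀ σ, F.proj σ ((H - c • (1 : E →L[ℂ] E)) ψ) - (F.energy σ : ℂ) • F.proj σ ψ =
        F.proj σ (total D ψ) + F.proj σ (total V ψ) + F.proj σ (total R ψ) := by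
      intro σ
      have h2 : F.proj σ (F.ham ψ) = (F.energy σ : ℂ) • F.proj σ ψ :=
        DFunLike.congr_fun (hF.proj_ham σ) ψ
      have h3 : (H - c • (1 : E →L[ℂ] E)) ψ = F.ham ψ + total D ψ + total V ψ + total R ψ := by
        rw [h.eq]
        simp only [sub_apply, add_apply]
        abel
      rw [h3, map_add, map_add, map_add, h2]
      abel
    simp only [ContinuousLinearMap.coe_coe, h1]
    have hVs : ∀ a : PatchLabel n m, a.1 = ∅ → V a = 0 := fun a ha =>
      h.V_mem.2 a fun h' => by
        have := h'.1.1
        rw [ha] at this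
        simp at this
    have hRs : ∀ a : PatchLabel n m, a.1 = ∅ → R a = 0 := fun a ha =>
      h.R_large a fun h' => by
        have := h'.1
        rw [ha] at this
        simp at this
    have eD := F.sum_norm_proj_diagonal_le hκ hμ0 h.D_mem h.D_small h.D_proj h.D_touch ψ
    have eV := F.sum_norm_proj_le_of_locLe h.V_mem.1 hVs h.V_loc zero_le_one
      (fun a _ => Real.exp_le_one_iff.2 (by rw [neg_nonpos]; positivity)) ψ
    have eR := F.sum_norm_proj_le_of_locLe h.R_mem hRs h.R_loc hw0 (fun a ha => by
      have hl : F.Large a := by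
        by_contra hl
        exact ha (h.R_large a hl)
      refine le_trans (Real.exp_le_exp.2 (neg_le_neg ?_)) hw
      exact mul_le_mul_of_nonneg_left hl.2 hκ) ψ
    have e1 : 0 ≤ ∑ σ, ‖F.proj σ ψ‖ := Finset.sum_nonneg fun _ _ => norm_nonneg _
    have e2 : 0 ≤ ∑ σ, F.energy σ * ‖F.proj σ ψ‖ :=
      Finset.sum_nonneg fun σ _ => mul_nonneg (F.energy_nonneg σ) (norm_nonneg _)
    calc _ ≤ ∑ σ, (‖F.proj σ (total D ψ)‖ + ‖F.proj σ (total V ψ)‖ + ‖F.proj σ (total R ψ)‖) :=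
          Finset.sum_le_sum fun σ _ => norm_add₃_le
      _ = _ := by rw [Finset.sum_add_distrib, Finset.sum_add_distrib]
      _ ≤ μ * ∑ σ, F.energy σ * ‖F.proj σ ψ‖ + n * (v * 1) * ∑ σ, ‖F.proj σ ψ‖ +
          n * (r * w) * ∑ σ, ‖F.proj σ ψ‖ := add_le_add (add_le_add eD eV) eR
      _ = μ * ∑ σ, F.energy σ * ‖F.proj σ ψ‖ + n * (v + r * w) * ∑ σ, ‖F.proj σ ψ‖ := by ring
      _ ≤ _ := by gcongr

end StabFrame

/-! ### Operators of a stabilizer code -/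

section CodeOperators

variable {n m : ℕ} (C : Fin m → F2vec n × F2vec n)

theorem sympl_comm (p q : F2vec n × F2vec n) : sympl p q = sympl q p := by
  unfold sympl
  exact Finset.sum_congr rfl fun i _ => by ring

/-- The Pauli matrices with support in a region and a given syndrome. -/
def patchPaulis (a : PatchLabel n m) : Set (Matrix (F2vec n) (F2vec n) ℂ) :=
  {A | ∃ p : F2vec n × F2vec n, A = pauli p ∧ pSupp p ⊆ a.1 ∧ syndrome C p = a.2}

/-- The matrices strongly supported in a region with a given syndrome. -/
def patchSpace (a : PatchLabel n m) : Submodule ℂ (Matrix (F2vec n) (F2vec n) ℂ) :=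
  if ∀ j ∈ a.2, pSupp (C j) ⊆ a.1 then Submodule.span ℂ (patchPaulis C a) else ⊥

variable {C}

theorem patchSpace_le_span (a : PatchLabel n m) :
    patchSpace C a ≤ Submodule.span ℂ (patchPaulis C a) := by
  unfold patchSpace
  split_ifs
  exacts [le_rfl, bot_le]

theorem mem_patchSpace_of_stronglySupported {M : Matrix (F2vec n) (F2vec n) ℂ}
    {S : Finset (Fin n)} {s : Finset (Fin m)} (h : M ≠ 0 → StronglySupported C M S s) :
    M ∈ patchSpace C (S, s) := by
  by_cases h0 : M = 0
  · rw [h0]; exact zero_mem _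
  · have h1 := h h0
    unfold patchSpace
    rw [if_pos h1.2]
    exact h1.1

theorem one_mem_patchSpace (S : Finset (Fin n)) : (1 : Matrix _ _ ℂ) ∈ patchSpace C (S, ∅) := by
  unfold patchSpace
  rw [if_pos (by simp)]
  refine Submodule.subset_span ⟨0, pauli_zero.symm, by simp [pSupp_zero], ?_⟩
  rw [syndrome_eq_empty]
  intro j
  simp [sympl]

theorem mul_mem_patchSpace {a b : PatchLabel n m} {x y : Matrix (F2vec n) (F2vec n) ℂ}
    (hx : x ∈ patchSpace C a) (hy : y ∈ patchSpace C b) : x * y ∈ patchSpace C (a.join b) := by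
  by_cases ha : ∀ j ∈ a.2, pSupp (C j) ⊆ a.1
  swap
  · rw [patchSpace, if_neg ha, Submodule.mem_bot] at hx
    rw [hx, zero_mul]
    exact zero_mem _
  by_cases hb : ∀ j ∈ b.2, pSupp (C j) ⊆ b.1
  swap
  · rw [patchSpace, if_neg hb, Submodule.mem_bot] at hy
    rw [hy, mul_zero]
    exact zero_mem _
  have hab : ∀ j ∈ (a.join b).2, pSupp (C j) ⊆ (a.join b).1 := by
    intro j hj
    rcases Finset.mem_symmDiff.1 hj with h | h
    · exact (ha j h.1).trans Finset.subset_union_left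
    · exact (hb j h.1).trans Finset.subset_union_right
  rw [patchSpace, if_pos ha] at hx
  rw [patchSpace, if_pos hb] at hy
  rw [patchSpace, if_pos hab]
  refine Submodule.span_induction₂ (p := fun x y _ _ => x * y ∈ Submodule.span ℂ
    (patchPaulis C (a.join b))) ?_ ?_ ?_ ?_ ?_ ?_ ?_ hx hy
  · rintro _ _ ⟨p, rfl, hp1, hp2⟩ ⟨r, rfl, hr1, hr2⟩
    obtain ⟨w, hw⟩ := pauli_mul_pauli p r
    rw [hw]
    refine Submodule.smul_mem _ _ (Submodule.subset_span ⟨p + r, rfl, ?_, ?_⟩)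
    · exact (pSupp_add_subset p r).trans (Finset.union_subset_union hp1 hr1)
    · rw [syndrome_add, hp2, hr2]
      rfl
  · intro y _; rw [zero_mul]; exact zero_mem _
  · intro x _; rw [mul_zero]; exact zero_mem _
  · intro x y z _ _ _ h1 h2; rw [add_mul]; exact add_mem h1 h2
  · intro x y z _ _ _ h1 h2; rw [mul_add]; exact add_mem h1 h2
  · intro r x y _ _ h1; rw [smul_mul_assoc]; exact Submodule.smul_mem _ _ h1
  · intro r x y _ _ h1; rw [mul_smul_comm]; exact Submodule.smul_mem _ _ h1

theorem commute_of_not_meets {a b : PatchLabel n m} {x y : Matrix (F2vec n) (F2vec n) ℂ}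
    (hab : ¬ a.Meets b) (hx : x ∈ patchSpace C a) (hy : y ∈ patchSpace C b) :
    x * y = y * x := by
  refine Submodule.span_induction₂ (p := fun x y _ _ => x * y = y * x) ?_ ?_ ?_ ?_ ?_ ?_ ?_
    (patchSpace_le_span a hx) (patchSpace_le_span b hy)
  · rintro _ _ ⟨p, rfl, hp1, -⟩ ⟨r, rfl, hr1, -⟩
    have hd : Disjoint (pSupp p) (pSupp r) := by
      rw [Finset.disjoint_left]
      exact fun i hi hi' => hab ⟨i, hp1 hi, hr1 hi'⟩
    rw [pauli_mul_comm, sympl_eq_zero_of_disjoint hd, signChar_zero, one_smul]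
  · intro y _; rw [zero_mul, mul_zero]
  · intro x _; rw [zero_mul, mul_zero]
  · intro x y z _ _ _ h1 h2; rw [add_mul, mul_add, h1, h2]
  · intro x y z _ _ _ h1 h2; rw [add_mul, mul_add, h1, h2]
  · intro r x y _ _ h1; rw [smul_mul_assoc, mul_smul_comm, h1]
  · intro r x y _ _ h1; rw [smul_mul_assoc, mul_smul_comm, h1]

theorem check_mul_patch {a : PatchLabel n m} {x : Matrix (F2vec n) (F2vec n) ℂ}
    (hx : x ∈ patchSpace C a) (j : Fin m) :
    pauli (C j) * x = sectorSign a.2 j • (x * pauli (C j)) := by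
  refine Submodule.span_induction (p := fun x _ => pauli (C j) * x =
    sectorSign a.2 j • (x * pauli (C j))) ?_ ?_ ?_ ?_ (patchSpace_le_span a hx)
  · rintro _ ⟨p, rfl, -, hp⟩
    rw [pauli_mul_comm]
    congr 1
    rw [sympl_comm, ← hp]
    unfold sectorSign
    simp only [mem_syndrome]
    rcases zmod_two_cases (sympl p (C j)) with h | h <;> simp [h, signChar_zero, signChar_one]
  · simp
  · intro x y _ _ h1 h2; rw [mul_add, add_mul, smul_add, h1, h2]
  · intro r x _ h1; rw [mul_smul_comm, smul_mul_assoc, h1, smul_comm]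

theorem pauli_sum_insert {T : Finset (Fin m)} {j : Fin m} (hj : j ∉ T) :
    ∃ w : ℂ, pauli (C j) * pauli (∑ i ∈ T, C i) = w • pauli (∑ i ∈ insert j T, C i) := by
  rw [Finset.sum_insert hj]
  exact pauli_mul_pauli _ _

theorem check_mem_patchSpace (hC : ∀ j j', sympl (C j) (C j') = 0) (j : Fin m) :
    pauli (C j) ∈ patchSpace C (pSupp (C j), ∅) := by
  unfold patchSpace
  rw [if_pos (by simp)]
  exact Submodule.subset_span ⟨C j, rfl, subset_rfl, (syndrome_eq_empty C _).2 (hC j)⟩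

theorem conjTranspose_mem_patchSpace {a : PatchLabel n m} {x : Matrix (F2vec n) (F2vec n) ℂ}
    (hx : x ∈ patchSpace C a) : x.conjTranspose ∈ patchSpace C a := by
  by_cases ha : ∀ j ∈ a.2, pSupp (C j) ⊆ a.1
  swap
  · rw [patchSpace, if_neg ha, Submodule.mem_bot] at hx ⊢
    rw [hx, Matrix.conjTranspose_zero]
  rw [patchSpace, if_pos ha] at hx ⊢
  refine Submodule.span_induction (p := fun x _ => x.conjTranspose ∈ Submodule.span ℂ
    (patchPaulis C a)) ?_ ?_ ?_ ?_ hx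
  · rintro _ ⟨p, rfl, hp⟩
    rw [pauli_conjTranspose]
    exact Submodule.subset_span ⟨p, rfl, hp⟩
  · simp
  · intro x y _ _ h1 h2; rw [Matrix.conjTranspose_add]; exact add_mem h1 h2
  · intro r x _ h1; rw [Matrix.conjTranspose_smul]; exact Submodule.smul_mem _ _ h1

variable (C) in
/-- The syndrome projections of a stabilizer code together with the products `g T` of checks. -/
structure CodeSectors extends SectorProj (fun j => pauli (C j)) where
  /-- The product of the checks in `T`. -/
  g : Finset (Fin m) → Matrix (F2vec n) (F2vec n) ℂ
  proj_eq : ∀ σ, proj σ = ((1 / 2 : ℂ) ^ m) • ∑ T, (∏ j ∈ T, sectorSign σ j) • g T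
  g_empty : g ∅ = 1
  g_insert : ∀ T j, j ∉ T → g (insert j T) = pauli (C j) * g T

theorem nonempty_codeSectors (hC : ∀ j j', sympl (C j) (C j') = 0) : Nonempty (CodeSectors C) := by
  obtain ⟨proj, g, h1, h2, h3, h4, h5, h6⟩ := exists_sectorProj (fun j => pauli (C j))
    (fun i j => by rw [pauli_mul_comm, hC, signChar_zero, one_smul]) (fun j => pauli_mul_self _)
  rw [Fintype.card_fin] at h4
  exact ⟨⟨⟨proj, h1, h2, h3⟩, g, h4, h5, h6⟩⟩

namespace CodeSectors

variable (P : CodeSectors C)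

theorem g_mul_proj (σ T : Finset (Fin m)) :
    P.g T * P.proj σ = (∏ j ∈ T, sectorSign σ j) • P.proj σ := by
  induction T using Finset.induction_on with
  | empty => simp [P.g_empty]
  | insert j T hj ih =>
    rw [P.g_insert T j hj, mul_assoc, ih, Finset.prod_insert hj, mul_smul_comm, P.mul_proj,
      smul_smul, mul_comm]

theorem g_mul_code (T : Finset (Fin m)) : P.g T * P.proj ∅ = P.proj ∅ := by
  rw [P.g_mul_proj]
  simp [sectorSign]

theorem exists_g_eq (T : Finset (Fin m)) : ∃ w : ℂ, P.g T = w • pauli (∑ j ∈ T, C j) := by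
  induction T using Finset.induction_on with
  | empty => exact ⟨1, by simp [P.g_empty, pauli_zero]⟩
  | insert j T hj ih =>
    obtain ⟨w, hw⟩ := ih
    obtain ⟨w', hw'⟩ := pauli_sum_insert (C := C) hj
    exact ⟨w * w', by rw [P.g_insert T j hj, hw, mul_smul_comm, hw', smul_smul]⟩

theorem g_eq_of_sum_eq (hP : P.proj ∅ ≠ 0) {T T' : Finset (Fin m)}
    (h : ∑ j ∈ T', C j = ∑ j ∈ T, C j) : P.g T' = P.g T := by
  obtain ⟨w, hw⟩ := P.exists_g_eq T
  obtain ⟨w', hw'⟩ := P.exists_g_eq T'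
  rw [h] at hw'
  have h1 := P.g_mul_code T
  have h2 := P.g_mul_code T'
  rw [hw, smul_mul_assoc] at h1
  rw [hw', smul_mul_assoc] at h2
  have h3 : (w' - w) • (pauli (∑ j ∈ T, C j) * P.proj ∅) = 0 := by
    rw [sub_smul, h1, h2, sub_self]
  rcases smul_eq_zero.1 h3 with h4 | h4
  · rw [hw, hw', sub_eq_zero.1 h4]
  · rw [h4, smul_zero] at h1
    exact absurd h1.symm hP

/-- Operators with trivial syndrome in correctable regions act as scalars on the code space. -/
theorem exists_scalar {d : ℕ} (hd : ∀ p, IsLogical C p → d ≤ pWeight p) {S : Finset (Fin n)}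
    (hS : S.card < d) {x : Matrix (F2vec n) (F2vec n) ℂ} (hx : x ∈ patchSpace C (S, ∅)) :
    ∃ c : ℂ, x * P.proj ∅ = c • P.proj ∅ := by
  refine Submodule.span_induction (p := fun x _ => ∃ c : ℂ, x * P.proj ∅ = c • P.proj ∅)
    ?_ ?_ ?_ ?_ (patchSpace_le_span _ hx)
  · rintro _ ⟨p, rfl, hp1, hp2⟩
    have h1 : ∃ T : Finset (Fin m), p = ∑ j ∈ T, C j := by
      by_contra h
      have h2 := hd p ⟨(syndrome_eq_empty C p).1 hp2, h⟩
      have h3 : pWeight p ≤ S.card := Finset.card_le_card hp1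
      omega
    obtain ⟨T, rfl⟩ := h1
    obtain ⟨w, hw⟩ := P.exists_g_eq T
    have h2 := P.g_mul_code T
    rw [hw, smul_mul_assoc] at h2
    by_cases hw0 : w = 0
    · rw [hw0, zero_smul] at h2
      exact ⟨0, by rw [← h2, mul_zero, smul_zero]⟩
    · refine ⟨w⁻¹, ?_⟩
      rw [eq_inv_smul_iff₀ hw0, h2]
  · exact ⟨0, by simp⟩
  · rintro x y _ _ ⟨c, hc⟩ ⟨c', hc'⟩
    exact ⟨c + c', by rw [add_mul, hc, hc', add_smul]⟩
  · rintro r x _ ⟨c, hc⟩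
    exact ⟨r * c, by rw [smul_mul_assoc, hc, smul_smul]⟩

theorem trace_mul_g_eq_zero {a : PatchLabel n m} {y : Matrix (F2vec n) (F2vec n) ℂ}
    (hy : y ∈ patchSpace C a) {T : Finset (Fin m)} (hT : ¬ pSupp (∑ j ∈ T, C j) ⊆ a.1) :
    (y * P.g T).trace = 0 := by
  obtain ⟨w, hw⟩ := P.exists_g_eq T
  refine Submodule.span_induction (p := fun y _ => (y * P.g T).trace = 0)
    ?_ ?_ ?_ ?_ (patchSpace_le_span _ hy)
  · rintro _ ⟨p, rfl, hp, -⟩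
    obtain ⟨w', hw'⟩ := pauli_mul_pauli p (∑ j ∈ T, C j)
    rw [hw, mul_smul_comm, hw', Matrix.trace_smul, Matrix.trace_smul, trace_pauli, smul_zero,
      smul_zero]
    intro h0
    refine hT ?_
    have : p = ∑ j ∈ T, C j := by
      calc p = p + (∑ j ∈ T, C j + ∑ j ∈ T, C j) := by rw [pauliLabel_add_self, add_zero]
        _ = _ := by rw [← add_assoc, h0, zero_add]
    rwa [← this]
  · simp
  · intro x y _ _ h1 h2; rw [add_mul, Matrix.trace_add, h1, h2, add_zero]
  · intro r x _ h1; rw [smul_mul_assoc, Matrix.trace_smul, h1, smul_zero]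

end CodeSectors

variable (C) in
/-- A set of checks whose sum is not the sum of fewer checks. -/
def IsMinimalCheckSet (T : Finset (Fin m)) : Prop :=
  ∀ T' : Finset (Fin m), ∑ j ∈ T', C j = ∑ j ∈ T, C j → T.card ≤ T'.card

theorem exists_minimalCheckSet (T : Finset (Fin m)) :
    ∃ T', IsMinimalCheckSet C T' ∧ ∑ j ∈ T', C j = ∑ j ∈ T, C j := by
  obtain ⟨T', hT', hmin⟩ := Finset.exists_min_image
    (Finset.univ.filter fun T' : Finset (Fin m) => ∑ j ∈ T', C j = ∑ j ∈ T, C j) Finset.card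
    ⟨T, by simp⟩
  have h1 := (Finset.mem_filter.1 hT').2
  exact ⟨T', fun T'' h => hmin T'' (by simp [h, h1]), h1⟩

variable (C) in
/-- The checks taking part in a minimal presentation of a stabilizer supported in `S`. -/
def codeTouch (S : Finset (Fin n)) : Finset (Fin m) :=
  Finset.univ.filter fun j => ∃ T, IsMinimalCheckSet C T ∧ pSupp (∑ i ∈ T, C i) ⊆ S ∧ j ∈ T

open scoped ComplexOrder in
/-- An operator annihilating the code space annihilates every sector without excitations touching
its region. -/
theorem CodeSectors.mul_proj_eq_zero (P : CodeSectors C) (hP : P.proj ∅ ≠ 0) {a : PatchLabel n m}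
    {x : Matrix (F2vec n) (F2vec n) ℂ} (hx : x ∈ patchSpace C a) (hxP : x * P.proj ∅ = 0)
    {σ : Finset (Fin m)} (hσ : ∀ j ∈ σ, j ∉ codeTouch C a.1) : x * P.proj σ = 0 := by
  by_cases hσ0 : P.proj σ = 0
  · rw [hσ0, mul_zero]
  set y := x.conjTranspose * x with hy
  have hy_mem : y ∈ patchSpace C (a.join a) :=
    mul_mem_patchSpace (conjTranspose_mem_patchSpace hx) hx
  have hjoin : (a.join a).1 = a.1 := Finset.union_self _
  have htr : ∀ τ, (y * P.proj τ).trace =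
      ((1 / 2 : ℂ) ^ m) * ∑ T, (∏ j ∈ T, sectorSign τ j) * (y * P.g T).trace := by
    intro τ
    rw [P.proj_eq, mul_smul_comm, Matrix.trace_smul, Finset.mul_sum, Matrix.trace_sum, smul_eq_mul]
    simp only [mul_smul_comm, Matrix.trace_smul, smul_eq_mul]
  have hsame : (y * P.proj σ).trace = (y * P.proj ∅).trace := by
    rw [htr, htr]
    congr 1
    refine Finset.sum_congr rfl fun T _ => ?_
    by_cases hT : pSupp (∑ j ∈ T, C j) ⊆ a.1
    · congr 1
      obtain ⟨T', hmin, hsum⟩ := exists_minimalCheckSet (C := C) T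
      have h1 : ∏ j ∈ T', sectorSign σ j = 1 := by
        refine Finset.prod_eq_one fun j hj => ?_
        unfold sectorSign
        refine if_neg fun hjσ => hσ j hjσ ?_
        exact Finset.mem_filter.2 ⟨Finset.mem_univ j, T', hmin, by rwa [hsum], hj⟩
      have h2 := P.g_mul_proj σ T'
      rw [P.g_eq_of_sum_eq hP hsum, P.g_mul_proj, h1, one_smul] at h2
      have h3 : (∏ j ∈ T, sectorSign σ j - 1) • P.proj σ = 0 := by
        rw [sub_smul, one_smul, h2, sub_self]
      rw [sub_eq_zero.1 ((smul_eq_zero.1 h3).resolve_right hσ0)]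
      simp [sectorSign]
    · rw [P.trace_mul_g_eq_zero hy_mem (by rwa [hjoin]), mul_zero, mul_zero]
  have hzero : (y * P.proj σ).trace = 0 := by
    rw [hsame, hy, mul_assoc, hxP, mul_zero, Matrix.trace_zero]
  have hstar : (P.proj σ).conjTranspose = P.proj σ :=
    P.star_proj (fun j => pauli_conjTranspose _) σ
  refine Matrix.trace_conjTranspose_mul_self_eq_zero_iff.1 ?_
  calc ((x * P.proj σ).conjTranspose * (x * P.proj σ)).trace
      = (P.proj σ * (y * P.proj σ)).trace := by
        rw [Matrix.conjTranspose_mul, hstar, hy]; simp only [mul_assoc]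
    _ = (y * P.proj σ).trace := by
        rw [Matrix.trace_mul_comm, mul_assoc, P.proj_mul_self]
    _ = 0 := hzero

end CodeOperators

/-! ### Check soundness and the extent of minimal presentations -/

section Soundness

variable {n m : ℕ} {C : Fin m → F2vec n × F2vec n}

theorem sum_symmDiff_check (T T' : Finset (Fin m)) :
    ∑ j ∈ symmDiff T T', C j = ∑ j ∈ T, C j + ∑ j ∈ T', C j := by
  have h1 : ∑ j ∈ T, C j = ∑ j ∈ T \ T', C j + ∑ j ∈ T ∩ T', C j := by
    rw [add_comm]; exact (Finset.sum_inter_add_sum_sdiff T T' C).symm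
  have h2 : ∑ j ∈ T', C j = ∑ j ∈ T' \ T, C j + ∑ j ∈ T ∩ T', C j := by
    rw [add_comm, Finset.inter_comm]; exact (Finset.sum_inter_add_sum_sdiff T' T C).symm
  have h3 : symmDiff T T' = (T \ T') ∪ (T' \ T) := rfl
  rw [h3, Finset.sum_union disjoint_sdiff_sdiff, h1, h2, add_add_add_comm, pauliLabel_add_self,
    add_zero]

theorem pSupp_sum_subset (T : Finset (Fin m)) :
    pSupp (∑ j ∈ T, C j) ⊆ T.biUnion fun j => pSupp (C j) := by
  induction T using Finset.induction_on with
  | empty => simp [pSupp_zero]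
  | insert j T hj ih =>
    rw [Finset.sum_insert hj, Finset.biUnion_insert]
    exact (pSupp_add_subset _ _).trans (Finset.union_subset_union_right ih)

theorem IsMinimalCheckSet.subset {T T' : Finset (Fin m)} (hT : IsMinimalCheckSet C T)
    (h : T' ⊆ T) : IsMinimalCheckSet C T' := by
  intro T'' hsum
  have h1 : ∑ j ∈ symmDiff T'' (T \ T'), C j = ∑ j ∈ T, C j := by
    rw [sum_symmDiff_check, hsum, add_comm]
    exact Finset.sum_sdiff h
  have h2 := hT _ h1
  have h3 : (symmDiff T'' (T \ T')).card ≤ T''.card + (T \ T').card :=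
    (Finset.card_le_card symmDiff_le_sup).trans (Finset.card_union_le _ _)
  have h4 := Finset.card_sdiff_add_card_eq_card h
  omega

theorem reachable_dist_le_of_mem_check {j : Fin m} {u v i : Fin n} (hu : u ∈ pSupp (C j))
    (hv : v ∈ pSupp (C j)) (h : (codeGraph C).Reachable u i) :
    (codeGraph C).Reachable v i ∧ (codeGraph C).dist v i ≤ (codeGraph C).dist u i + 1 := by
  by_cases huv : v = u
  · subst huv
    exact ⟨h, Nat.le_succ _⟩
  · have hadj : (codeGraph C).Adj v u := by
      rw [codeGraph, SimpleGraph.fromRel_adj]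
      exact ⟨huv, Or.inl ⟨j, hv, hu⟩⟩
    refine ⟨hadj.reachable.trans h, ?_⟩
    have h1 := hadj.reachable.dist_triangle_left i
    rw [SimpleGraph.dist_eq_one_iff_adj.2 hadj] at h1
    omega

variable (C) in
/-- A check acts on a qubit at distance at most `r` from the region `W`. -/
def CheckWithin (W : Finset (Fin n)) (r : ℕ) (j : Fin m) : Prop :=
  ∃ u ∈ pSupp (C j), ∃ i ∈ W, (codeGraph C).Reachable u i ∧ (codeGraph C).dist u i ≤ r

variable (C) in
/-- The members of `T` at distance more than `r` from the support of the sum of `T`. -/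
def farChecks (T : Finset (Fin m)) (r : ℕ) : Finset (Fin m) :=
  T.filter fun j => ¬ CheckWithin C (pSupp (∑ j ∈ T, C j)) r j

theorem farChecks_subset (T : Finset (Fin m)) (r : ℕ) : farChecks C T r ⊆ T :=
  Finset.filter_subset _ _

theorem farChecks_antitone (T : Finset (Fin m)) : Antitone (farChecks C T) := by
  intro r s hrs j hj
  obtain ⟨h1, h2⟩ := Finset.mem_filter.1 hj
  refine Finset.mem_filter.2 ⟨h1, fun ⟨u, hu, i, hi, h3, h4⟩ => h2 ⟨u, hu, i, hi, h3, ?_⟩⟩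
  exact h4.trans hrs

theorem pSupp_sum_farChecks_subset (T : Finset (Fin m)) (r : ℕ) :
    pSupp (∑ j ∈ farChecks C T r, C j) ⊆
      (farChecks C T r \ farChecks C T (r + 1)).biUnion fun j => pSupp (C j) := by
  intro v hv
  obtain ⟨j, hj, hvj⟩ := Finset.mem_biUnion.1 (pSupp_sum_subset _ hv)
  refine Finset.mem_biUnion.2 ⟨j, Finset.mem_sdiff.2 ⟨hj, fun hj' => ?_⟩, hvj⟩
  obtain ⟨-, hfar⟩ := Finset.mem_filter.1 hj'
  have hsum : ∑ j ∈ farChecks C T r, C j =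
      ∑ j ∈ T, C j + ∑ j ∈ T \ farChecks C T r, C j := by
    rw [← Finset.sum_sdiff (farChecks_subset T r), add_right_comm, pauliLabel_add_self, zero_add]
  rw [hsum] at hv
  rcases Finset.mem_union.1 (pSupp_add_subset _ _ hv) with hW | hv'
  · exact hfar ⟨v, hvj, v, hW, SimpleGraph.Reachable.refl v, by simp⟩
  · obtain ⟨i, hi, hvi⟩ := Finset.mem_biUnion.1 (pSupp_sum_subset _ hv')
    obtain ⟨hiT, hin⟩ := Finset.mem_sdiff.1 hi
    have hnear : CheckWithin C (pSupp (∑ j ∈ T, C j)) r i := by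
      by_contra h
      exact hin (Finset.mem_filter.2 ⟨hiT, h⟩)
    obtain ⟨u, hu, w, hw, hr, hd⟩ := hnear
    obtain ⟨hr', hd'⟩ := reachable_dist_le_of_mem_check hu hvi hr
    exact hfar ⟨v, hvj, w, hw, hr', hd'.trans (by omega)⟩

variable (C) in
/-- Check soundness below the cutoff `ds`, together with the weight bound on the checks. -/
structure SoundCode (q : ℕ) (ds : ℝ) (f finv : ℝ → ℝ) : Prop where
  card_le : ∀ j, (pSupp (C j)).card ≤ q
  strictMono : StrictMonoOn f (Set.Ici 0)
  map_nonneg : ∀ x : ℝ, 0 ≤ x → 0 ≤ f x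
  inv_nonneg : ∀ x : ℝ, 0 ≤ x → 0 ≤ finv x
  map_inv : ∀ x : ℝ, 0 ≤ x → f (finv x) = x
  sound : ∀ T : Finset (Fin m), ((pWeight (∑ j ∈ T, C j) : ℝ) < ds) →
    ∃ T' : Finset (Fin m), (∑ j ∈ T', C j) = ∑ j ∈ T, C j ∧
      (T'.card : ℝ) ≤ f (pWeight (∑ j ∈ T, C j))

namespace SoundCode

variable {q : ℕ} {ds : ℝ} {f finv : ℝ → ℝ} (hc : SoundCode C q ds f finv)

theorem inv_le_iff (hc : SoundCode C q ds f finv) {x y : ℝ} (hx : 0 ≤ x) (hy : 0 ≤ y) :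
    finv x ≤ y ↔ x ≤ f y := by
  rw [← hc.strictMono.le_iff_le (hc.inv_nonneg x hx) hy, hc.map_inv x hx]

theorem inv_pos (hc : SoundCode C q ds f finv) {x : ℝ} (hx : 0 < x) : 0 < finv x := by
  refine lt_of_le_of_ne (hc.inv_nonneg x hx.le) fun h => ?_
  have h0 : f 0 ≤ 0 := by
    have h2 := hc.strictMono.monotoneOn (Set.self_mem_Ici) (hc.inv_nonneg 0 le_rfl)
      (hc.inv_nonneg 0 le_rfl)
    rwa [hc.map_inv 0 le_rfl] at h2
  have h3 := hc.map_inv x hx.le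
  rw [← h] at h3
  linarith

theorem card_le_of_minimal (hc : SoundCode C q ds f finv) {T : Finset (Fin m)}
    (hT : IsMinimalCheckSet C T) (h : (pWeight (∑ j ∈ T, C j) : ℝ) < ds) :
    (T.card : ℝ) ≤ f (pWeight (∑ j ∈ T, C j)) := by
  obtain ⟨T', h1, h2⟩ := hc.sound T h
  exact le_trans (by exact_mod_cast hT T' h1) h2

theorem min_le_weight (hc : SoundCode C q ds f finv) {T : Finset (Fin m)}
    (hT : IsMinimalCheckSet C T) : min ds (finv T.card) ≤ pWeight (∑ j ∈ T, C j) := by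
  rcases lt_or_ge (pWeight (∑ j ∈ T, C j) : ℝ) ds with h | h
  · refine (min_le_right _ _).trans ?_
    rw [hc.inv_le_iff (Nat.cast_nonneg _) (Nat.cast_nonneg _)]
    exact hc.card_le_of_minimal hT h
  · exact (min_le_left _ _).trans h

theorem weight_farChecks_le (hc : SoundCode C q ds f finv) (T : Finset (Fin m)) (r : ℕ) :
    (pWeight (∑ j ∈ farChecks C T r, C j) : ℝ) ≤
      q * (((farChecks C T r).card : ℝ) - (farChecks C T (r + 1)).card) := by
  have h1 : pWeight (∑ j ∈ farChecks C T r, C j) ≤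
      (farChecks C T r \ farChecks C T (r + 1)).card * q :=
    (Finset.card_le_card (pSupp_sum_farChecks_subset T r)).trans
      (Finset.card_biUnion_le_card_mul _ _ _ fun j _ => hc.card_le j)
  have h2 := Finset.card_sdiff_add_card_eq_card (farChecks_antitone (C := C) T (Nat.le_succ r))
  have h3 : ((farChecks C T r).card : ℝ) - (farChecks C T (r + 1)).card =
      ((farChecks C T r \ farChecks C T (r + 1)).card : ℝ) := by
    rw [← h2]; push_cast; simp
  rw [h3, mul_comm]
  exact_mod_cast h1

theorem card_farChecks_gain (hc : SoundCode C q ds f finv) (hq : 0 < q) {T : Finset (Fin m)}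
    (hT : IsMinimalCheckSet C T) (r : ℕ) :
    ((farChecks C T (r + 1)).card : ℝ) + min ds (finv (farChecks C T r).card) / q ≤
      (farChecks C T r).card := by
  have h1 := (hc.min_le_weight (hT.subset (farChecks_subset T r))).trans
    (hc.weight_farChecks_le T r)
  have hq' : (0 : ℝ) < q := by exact_mod_cast hq
  have h2 : min ds (finv (farChecks C T r).card) / q ≤
      ((farChecks C T r).card : ℝ) - (farChecks C T (r + 1)).card := by
    rw [div_le_iff₀ hq', mul_comm]; exact h1
  linarith

theorem exists_notMem_farChecks (hc : SoundCode C q ds f finv) (hq : 0 < q) (hds : 0 < ds)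
    {T : Finset (Fin m)} (hT : IsMinimalCheckSet C T) (j : Fin m) : ∃ r, j ∉ farChecks C T r := by
  by_contra! h
  have hlt : ∀ r, (farChecks C T (r + 1)).card < (farChecks C T r).card := by
    intro r
    have h1 := hc.card_farChecks_gain hq hT r
    have h2 : (0 : ℝ) < (farChecks C T r).card := by
      exact_mod_cast Finset.card_pos.2 ⟨j, h r⟩
    have h3 : 0 < min ds (finv (farChecks C T r).card) / q :=
      div_pos (lt_min hds (hc.inv_pos h2)) (by exact_mod_cast hq)
    have h4 : ((farChecks C T (r + 1)).card : ℝ) < (farChecks C T r).card := by linarith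
    exact_mod_cast h4
  have hle : ∀ r, (farChecks C T r).card + r ≤ T.card := by
    intro r
    induction r with
    | zero => exact Finset.card_le_card (farChecks_subset T 0)
    | succ r ih => have := hlt r; omega
  have := hle (T.card + 1)
  omega

theorem ftilde_nonneg (hc : SoundCode C q ds f finv) (hds : 0 ≤ ds) (r : ℕ) :
    0 ≤ ftilde f finv ds q (r + 1) := by
  induction r with
  | zero => exact hc.inv_nonneg 1 zero_le_one
  | succ r ih =>
    refine hc.inv_nonneg _ (add_nonneg (hc.map_nonneg _ ih) (div_nonneg (le_min hds ih) ?_))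
    exact Nat.cast_nonneg q

theorem map_ftilde_le_card (hc : SoundCode C q ds f finv) (hq : 0 < q) (hds : 0 ≤ ds)
    {T : Finset (Fin m)} (hT : IsMinimalCheckSet C T) {j : Fin m} {r : ℕ}
    (hj : j ∈ farChecks C T r) (s : ℕ) (hs : s ≤ r) :
    f (ftilde f finv ds q (s + 1)) ≤ (farChecks C T (r - s)).card := by
  induction s with
  | zero =>
    have h1 : f (ftilde f finv ds q (0 + 1)) = 1 := hc.map_inv 1 zero_le_one
    rw [h1]
    exact_mod_cast Finset.card_pos.2 ⟨j, hj⟩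
  | succ s ih =>
    have ih := ih (by omega)
    set t := ftilde f finv ds q (s + 1) with ht
    have ht0 : 0 ≤ t := hc.ftilde_nonneg hds s
    have h1 : f (ftilde f finv ds q (s + 1 + 1)) = f t + min ds t / q :=
      hc.map_inv _ (add_nonneg (hc.map_nonneg _ ht0)
        (div_nonneg (le_min hds ht0) (Nat.cast_nonneg q)))
    have h2 := hc.card_farChecks_gain hq hT (r - (s + 1))
    have h3 : r - (s + 1) + 1 = r - s := by omega
    rw [h3] at h2
    have h4 : ((farChecks C T (r - s)).card : ℝ) ≤ (farChecks C T (r - (s + 1))).card := by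
      exact_mod_cast Finset.card_le_card (farChecks_antitone T (by omega))
    have h5 : t ≤ finv (farChecks C T (r - (s + 1))).card := by
      rw [← hc.strictMono.le_iff_le ht0 (hc.inv_nonneg _ (Nat.cast_nonneg _)),
        hc.map_inv _ (Nat.cast_nonneg _)]
      exact ih.trans h4
    have h6 : min ds t / q ≤ min ds (finv (farChecks C T (r - (s + 1))).card) / q :=
      div_le_div_of_nonneg_right (min_le_min_left _ h5) (Nat.cast_nonneg q)
    rw [h1]
    linarith

/-- A check touched by a correctable region `S` is within reach of `S`, the size of `S` bounding
the distance through `ftilde`. -/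
theorem exists_near_of_mem_codeTouch (hc : SoundCode C q ds f finv) (hq : 0 < q)
    {S : Finset (Fin n)} (hS : (S.card : ℝ) < ds) {j : Fin m} (hj : j ∈ codeTouch C S) :
    ∃ u ∈ pSupp (C j), ∃ i ∈ S, (codeGraph C).Reachable u i ∧
      ((codeGraph C).dist u i = 0 ∨ ftilde f finv ds q ((codeGraph C).dist u i) ≤ S.card) := by
  obtain ⟨-, T, hT, hTS, hjT⟩ := Finset.mem_filter.1 hj
  have hds : 0 < ds := (Nat.cast_nonneg _).trans_lt hS
  have hex := hc.exists_notMem_farChecks hq hds hT j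
  have hnear : ∀ r, j ∉ farChecks C T r → CheckWithin C (pSupp (∑ j ∈ T, C j)) r j := by
    intro r hr
    by_contra h
    exact hr (Finset.mem_filter.2 ⟨hjT, h⟩)
  obtain ⟨u, hu, i, hi, hreach, hdist⟩ := hnear _ (Nat.find_spec hex)
  refine ⟨u, hu, i, hTS hi, hreach, ?_⟩
  rcases Nat.eq_zero_or_pos ((codeGraph C).dist u i) with h0 | hpos
  · exact Or.inl h0
  right
  obtain ⟨r, hr⟩ : ∃ r, (codeGraph C).dist u i = r + 1 := ⟨_, (Nat.succ_pred_eq_of_pos hpos).symm⟩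
  have hfar : j ∈ farChecks C T r := by
    by_contra h
    have h1 := Nat.find_min' hex h
    omega
  have h1 := hc.map_ftilde_le_card hq hds.le hT hfar r le_rfl
  have h2 : (pWeight (∑ j ∈ T, C j) : ℝ) ≤ S.card := by
    exact_mod_cast Finset.card_le_card hTS
  have h3 := hc.card_le_of_minimal hT (h2.trans_lt hS)
  have h4 : ((farChecks C T (r - r)).card : ℝ) ≤ T.card := by
    exact_mod_cast Finset.card_le_card (farChecks_subset T _)
  rw [hr]
  refine le_trans ?_ h2
  rw [← hc.strictMono.le_iff_le (hc.ftilde_nonneg hds.le r)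
    (Set.mem_Ici.2 (Nat.cast_nonneg _))]
  linarith

end SoundCode

theorem card_sphere_le (G : SimpleGraph (Fin n)) (u : Fin n) {r : ℕ} (hr : r ≠ 0) :
    (Finset.univ.filter fun i => G.Reachable u i ∧ G.dist u i = r).card ≤ gammaMax G r := by
  unfold gammaMax
  rw [if_neg hr]
  refine le_trans ?_ (Finset.le_sup (f := fun i : Fin n =>
    (gBall G i r).card - (gBall G i (r - 1)).card) (Finset.mem_univ u))
  have hsub : gBall G u (r - 1) ⊆ gBall G u r := by
    intro i hi
    obtain ⟨-, h1, h2⟩ := Finset.mem_filter.1 hi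
    exact Finset.mem_filter.2 ⟨Finset.mem_univ _, h1, by omega⟩
  rw [← Finset.card_sdiff_of_subset hsub]
  refine Finset.card_le_card fun i hi => ?_
  obtain ⟨-, h1, h2⟩ := Finset.mem_filter.1 hi
  refine Finset.mem_sdiff.2 ⟨Finset.mem_filter.2 ⟨Finset.mem_univ _, h1, h2.le⟩, fun h => ?_⟩
  have := (Finset.mem_filter.1 h).2.2
  omega

/-- The decay of the influence of a region on a check at distance `r`. -/
def reachWeight (f finv : ℝ → ℝ) (ds Δ δ : ℝ) (r : ℕ) : ℝ :=
  if r = 0 then 1 else if ftilde f finv ds Δ r < ds then Real.exp (-(δ * ftilde f finv ds Δ r))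
    else 0

theorem reachWeight_nonneg (f finv : ℝ → ℝ) (ds Δ δ : ℝ) (r : ℕ) :
    0 ≤ reachWeight f finv ds Δ δ r := by
  unfold reachWeight
  split_ifs <;> positivity

theorem sum_reachWeight_le {f finv : ℝ → ℝ} {G : SimpleGraph (Fin n)} {ds Δ c' c'' α δ : ℝ}
    (h : SummabilityCondition G f finv ds Δ c' c'' α) (hδ : 0 < δ) (u : Fin n) :
    (∑ i, if G.Reachable u i then reachWeight f finv ds Δ δ (G.dist u i) else 0) ≤
      1 + c'' * Real.exp (c' * δ ^ (-α)) := by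
  set R := Finset.univ.sup fun i => G.dist u i with hR
  have hmem : ∀ i, G.dist u i ∈ Finset.range (R + 1) := fun i =>
    Finset.mem_range.2 (Nat.lt_succ_of_le (Finset.le_sup (f := fun i => G.dist u i)
      (Finset.mem_univ i)))
  have h1 : (∑ i, if G.Reachable u i then reachWeight f finv ds Δ δ (G.dist u i) else 0) =
      ∑ r ∈ Finset.range (R + 1), ((Finset.univ.filter fun i =>
        G.Reachable u i ∧ G.dist u i = r).card : ℝ) * reachWeight f finv ds Δ δ r := by
    rw [← Finset.sum_fiberwise_of_maps_to (t := Finset.range (R + 1)) (g := fun i => G.dist u i)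
      (fun i _ => hmem i)]
    refine Finset.sum_congr rfl fun r _ => ?_
    rw [← Finset.sum_filter, Finset.filter_filter, ← nsmul_eq_mul, ← Finset.sum_const]
    refine Finset.sum_congr (by ext i; simp [and_comm]) fun i hi => ?_
    rw [(Finset.mem_filter.1 hi).2.2]
  have h2 : ((Finset.univ.filter fun i => G.Reachable u i ∧ G.dist u i = 0).card : ℝ) ≤ 1 := by
    have : (Finset.univ.filter fun i => G.Reachable u i ∧ G.dist u i = 0) ⊆ {u} := by
      intro i hi
      obtain ⟨-, h3, h4⟩ := Finset.mem_filter.1 hi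
      exact Finset.mem_singleton.2 ((h3.dist_eq_zero_iff).1 h4).symm
    exact_mod_cast Finset.card_le_card this
  have h3 : ∑ r ∈ Finset.range (R + 1), ((Finset.univ.filter fun i =>
        G.Reachable u i ∧ G.dist u i = r).card : ℝ) * reachWeight f finv ds Δ δ r ≤
      1 + ∑ r ∈ Finset.Icc 1 R, if ftilde f finv ds Δ r < ds then
        (gammaMax G r : ℝ) * Real.exp (-(δ * ftilde f finv ds Δ r)) else 0 := by
    have hI : Finset.range (R + 1) = insert 0 (Finset.Icc 1 R) := by
      ext r; simp only [Finset.mem_range, Finset.mem_insert, Finset.mem_Icc]; omega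
    rw [hI, Finset.sum_insert (by simp)]
    refine add_le_add (by simpa [reachWeight] using h2) (Finset.sum_le_sum fun r hr => ?_)
    have hr0 : r ≠ 0 := by have := (Finset.mem_Icc.1 hr).1; omega
    rw [reachWeight, if_neg hr0]
    split_ifs with h4
    · refine mul_le_mul_of_nonneg_right ?_ (Real.exp_pos _).le
      exact_mod_cast card_sphere_le G u hr0
    · simp
  rw [h1]
  have := h δ hδ R
  linarith

/-- The total strength of a family on the correctable regions touching a given check. -/
theorem SoundCode.sum_codeTouch_le {q : ℕ} {ds : ℝ} {f finv : ℝ → ℝ}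
    (hc : SoundCode C q ds f finv) (hq : 0 < q) {c' c'' α : ℝ}
    (hsum : SummabilityCondition (codeGraph C) f finv ds q c' c'' α) (hc'' : 0 ≤ c'') {δ B : ℝ}
    {y : PatchLabel n m → ℝ} (hδ : 0 < δ) (hB : 0 ≤ B) (hy : ∀ a, 0 ≤ y a)
    (hsite : ∀ i, siteSum (fun a => y a * Real.exp (δ * a.1.card)) i ≤ B) (j : Fin m) :
    (∑ a : PatchLabel n m, if (a.1.Nonempty ∧ (a.1.card : ℝ) < ds) ∧ j ∈ codeTouch C a.1 then y a
      else 0) ≤ q * (1 + c'' * Real.exp (c' * δ ^ (-α))) * B := by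
  set G := codeGraph C with hG
  let near : PatchLabel n m → Fin n → Fin n → Prop := fun a u i =>
    i ∈ a.1 ∧ (a.1.card : ℝ) < ds ∧ G.Reachable u i ∧
      (G.dist u i = 0 ∨ ftilde f finv ds q (G.dist u i) ≤ a.1.card)
  have hpoint : ∀ a : PatchLabel n m,
      (if (a.1.Nonempty ∧ (a.1.card : ℝ) < ds) ∧ j ∈ codeTouch C a.1 then y a else 0) ≤
        ∑ u ∈ pSupp (C j), ∑ i, if near a u i then y a else 0 := by
    intro a
    have hnn : ∀ u i, 0 ≤ if near a u i then y a else 0 := fun u i => by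
      split_ifs; exacts [hy a, le_rfl]
    split_ifs with h
    · obtain ⟨u, hu, i, hi, h1, h2⟩ := hc.exists_near_of_mem_codeTouch hq h.1.2 h.2
      have hnear : near a u i := ⟨hi, h.1.2, h1, h2⟩
      calc y a = if near a u i then y a else 0 := (if_pos hnear).symm
        _ ≤ ∑ i, if near a u i then y a else 0 :=
          Finset.single_le_sum (f := fun i => if near a u i then y a else 0)
            (fun i _ => hnn u i) (Finset.mem_univ i)
        _ ≤ _ := Finset.single_le_sum (f := fun u => ∑ i, if near a u i then y a else 0)
            (fun u _ => Finset.sum_nonneg fun i _ => hnn u i) hu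
    · exact Finset.sum_nonneg fun u _ => Finset.sum_nonneg fun i _ => hnn u i
  have hpair : ∀ u i, (∑ a : PatchLabel n m, if near a u i then y a else 0) ≤
      (if G.Reachable u i then reachWeight f finv ds q δ (G.dist u i) else 0) * B := by
    intro u i
    by_cases hr : G.Reachable u i
    swap
    · rw [if_neg hr, zero_mul]
      refine (Finset.sum_eq_zero fun a _ => if_neg fun h => hr h.2.2.1).le
    rw [if_pos hr]
    refine le_trans ?_ (mul_le_mul_of_nonneg_left (hsite i) (reachWeight_nonneg _ _ _ _ _ _))
    unfold siteSum
    rw [Finset.mul_sum]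
    refine Finset.sum_le_sum fun a _ => ?_
    by_cases hn : near a u i
    swap
    · rw [if_neg hn]
      refine mul_nonneg (reachWeight_nonneg _ _ _ _ _ _) ?_
      split_ifs
      exacts [mul_nonneg (hy a) (Real.exp_pos _).le, le_rfl]
    rw [if_pos hn, if_pos hn.1]
    have hkey : 1 ≤ reachWeight f finv ds q δ (G.dist u i) * Real.exp (δ * a.1.card) := by
      unfold reachWeight
      by_cases h0 : G.dist u i = 0
      · rw [if_pos h0, one_mul]
        exact Real.one_le_exp (by positivity)
      · have h1 := hn.2.2.2.resolve_left h0
        rw [if_neg h0, if_pos (h1.trans_lt hn.2.1), ← Real.exp_add]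
        refine Real.one_le_exp ?_
        have := mul_le_mul_of_nonneg_left h1 hδ.le
        linarith
    calc y a = y a * 1 := (mul_one _).symm
      _ ≤ y a * (reachWeight f finv ds q δ (G.dist u i) * Real.exp (δ * a.1.card)) :=
        mul_le_mul_of_nonneg_left hkey (hy a)
      _ = _ := by ring
  have hΘ : 0 ≤ (1 + c'' * Real.exp (c' * δ ^ (-α))) * B := by positivity
  calc _ ≤ ∑ a : PatchLabel n m, ∑ u ∈ pSupp (C j), ∑ i, if near a u i then y a else 0 :=
        Finset.sum_le_sum fun a _ => hpoint a
    _ = ∑ u ∈ pSupp (C j), ∑ i, ∑ a : PatchLabel n m, if near a u i then y a else 0 := by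
        rw [Finset.sum_comm]
        exact Finset.sum_congr rfl fun u _ => Finset.sum_comm
    _ ≤ ∑ u ∈ pSupp (C j), (1 + c'' * Real.exp (c' * δ ^ (-α))) * B := by
        refine Finset.sum_le_sum fun u _ => ?_
        refine (Finset.sum_le_sum fun i _ => hpair u i).trans ?_
        rw [← Finset.sum_mul]
        exact mul_le_mul_of_nonneg_right (sum_reachWeight_le hsum hδ u) hB
    _ = ((pSupp (C j)).card : ℝ) * ((1 + c'' * Real.exp (c' * δ ^ (-α))) * B) := by
        rw [Finset.sum_const, nsmul_eq_mul]
    _ ≤ q * ((1 + c'' * Real.exp (c' * δ ^ (-α))) * B) :=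
        mul_le_mul_of_nonneg_right (by exact_mod_cast hc.card_le j) hΘ
    _ = _ := by ring

end Soundness

/-! ### The frame of a stabilizer code -/

section CodeFrame

/-- The Hilbert space of `n` qubits. -/
abbrev QubitSpace (n : ℕ) := EuclideanSpace ℂ (F2vec n)

/-- A matrix as an operator on the Hilbert space. -/
def matrixCLM {n : ℕ} : Matrix (F2vec n) (F2vec n) ℂ →ₗ[ℂ] (QubitSpace n →L[ℂ] QubitSpace n) where
  toFun M := Matrix.toEuclideanCLM (𝕜 := ℂ) M
  map_add' M N := map_add _ M N
  map_smul' c M := map_smul _ c M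

variable {n m : ℕ} {C : Fin m → F2vec n × F2vec n}

theorem matrixCLM_mul (M N : Matrix (F2vec n) (F2vec n) ℂ) :
    matrixCLM (M * N) = matrixCLM M * matrixCLM N :=
  map_mul (Matrix.toEuclideanCLM (𝕜 := ℂ)) M N

theorem matrixCLM_one : matrixCLM (1 : Matrix (F2vec n) (F2vec n) ℂ) = 1 :=
  map_one (Matrix.toEuclideanCLM (𝕜 := ℂ))

theorem matrixCLM_injective : Function.Injective (matrixCLM (n := n)) :=
  (Matrix.toEuclideanCLM (𝕜 := ℂ) (n := F2vec n)).injective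

theorem norm_matrixCLM_pauli_le (p : F2vec n × F2vec n) : ‖matrixCLM (pauli p)‖ ≤ 1 := by
  have h1 : star (matrixCLM (pauli p)) * matrixCLM (pauli p) = 1 := by
    have h2 : star (matrixCLM (pauli p)) = matrixCLM (pauli p).conjTranspose :=
      (map_star (Matrix.toEuclideanCLM (𝕜 := ℂ) (n := F2vec n)) (pauli p)).symm
    rw [h2, pauli_conjTranspose, ← matrixCLM_mul, pauli_mul_self, matrixCLM_one]
  have h2 : ‖matrixCLM (pauli p)‖ * ‖matrixCLM (pauli p)‖ ≤ 1 := by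
    rw [← CStarRing.norm_star_mul_self, h1]
    exact ContinuousLinearMap.norm_id_le
  nlinarith [norm_nonneg (matrixCLM (pauli p))]

variable (C) in
/-- The code Hamiltonian with the given check energies. -/
def codeHam (lam : Fin m → ℝ) : Matrix (F2vec n) (F2vec n) ℂ :=
  ∑ j : Fin m, ((lam j / 2 : ℝ) : ℂ) • (1 - pauli (C j))

theorem codeHam_commutator (lam : Fin m → ℝ) {a : PatchLabel n m}
    {x : Matrix (F2vec n) (F2vec n) ℂ} (hx : x ∈ patchSpace C a) :
    codeHam C lam * x - x * codeHam C lam = ∑ j ∈ a.2, (lam j : ℂ) • (x * pauli (C j)) := by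
  have h1 : ∑ j ∈ a.2, (lam j : ℂ) • (x * pauli (C j)) =
      ∑ j, if j ∈ a.2 then (lam j : ℂ) • (x * pauli (C j)) else 0 := by
    rw [Finset.sum_ite_mem, Finset.univ_inter]
  unfold codeHam
  rw [Finset.sum_mul, Finset.mul_sum, ← Finset.sum_sub_distrib, h1]
  refine Finset.sum_congr rfl fun j _ => ?_
  rw [smul_mul_assoc, mul_smul_comm, ← smul_sub, sub_mul, mul_sub, check_mul_patch hx j, one_mul,
    mul_one, sub_sub_sub_cancel_left]
  unfold sectorSign
  split_ifs
  · rw [neg_one_smul, sub_neg_eq_add, ← two_smul ℂ, smul_smul]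
    push_cast
    congr 1
    ring
  · rw [one_smul, sub_self, smul_zero]

theorem codeHam_mul_proj (P : CodeSectors C) (lam : Fin m → ℝ) (σ : Finset (Fin m)) :
    codeHam C lam * P.proj σ = ((∑ j ∈ σ, lam j : ℝ) : ℂ) • P.proj σ := by
  have h1 : ((∑ j ∈ σ, lam j : ℝ) : ℂ) • P.proj σ =
      ∑ j, if j ∈ σ then (lam j : ℂ) • P.proj σ else 0 := by
    rw [Finset.sum_ite_mem, Finset.univ_inter, ← Finset.sum_smul]
    push_cast
    rfl
  unfold codeHam
  rw [Finset.sum_mul, h1]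
  refine Finset.sum_congr rfl fun j _ => ?_
  rw [smul_mul_assoc, sub_mul, one_mul, P.mul_proj]
  unfold sectorSign
  split_ifs
  · rw [neg_one_smul, sub_neg_eq_add, ← two_smul ℂ, smul_smul]
    push_cast
    congr 1
    ring
  · rw [one_smul, sub_self, smul_zero]

theorem mul_check_mem_patchSpace (hC : ∀ j j', sympl (C j) (C j') = 0) {a : PatchLabel n m}
    {x : Matrix (F2vec n) (F2vec n) ℂ} (hx : x ∈ patchSpace C a) {j : Fin m} (hj : j ∈ a.2) :
    x * pauli (C j) ∈ patchSpace C a := by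
  by_cases ha : ∀ j ∈ a.2, pSupp (C j) ⊆ a.1
  · have h1 := mul_mem_patchSpace hx (check_mem_patchSpace hC j)
    have h2 : a.join (pSupp (C j), ∅) = a := by
      refine Prod.ext (Finset.union_eq_left.2 (ha j hj)) ?_
      exact symmDiff_bot a.2
    rwa [h2] at h1
  · rw [patchSpace, if_neg ha, Submodule.mem_bot] at hx
    rw [hx, zero_mul]
    exact zero_mem _

variable (C) in
/-- The parameters of a stabilizer code entering the stability theorem. -/
structure CodeData (q d : ℕ) (dc : ℝ) (f finv : ℝ → ℝ) (c' c'' α : ℝ) (lam : Fin m → ℝ) :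
    Prop where
  comm : ∀ j j' : Fin m, sympl (C j) (C j') = 0
  q_pos : 0 < q
  dist_le : ∀ p, IsLogical C p → d ≤ pWeight p
  sound : SoundCode C q (min (d : ℝ) dc) f finv
  summable : SummabilityCondition (codeGraph C) f finv (min (d : ℝ) dc) q c' c'' α
  c''_nonneg : 0 ≤ c''
  one_le_lam : ∀ j, 1 ≤ lam j

/-- The frame of a stabilizer code with nonzero code space. -/
def codeFrame {q d : ℕ} {dc : ℝ} {f finv : ℝ → ℝ} {c' c'' α : ℝ} {lam : Fin m → ℝ}
    (hD : CodeData C q d dc f finv c' c'' α lam) (P : CodeSectors C) (hP : P.proj ∅ ≠ 0) :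
    StabFrame n m (QubitSpace n →L[ℂ] QubitSpace n) where
  supp a := (patchSpace C a).map matrixCLM
  proj σ := matrixCLM (P.proj σ)
  ham := matrixCLM (codeHam C lam)
  lam := lam
  ds := min (d : ℝ) dc
  touch := codeTouch C
  Theta δ := q * (1 + c'' * Real.exp (c' * δ ^ (-α)))
  one_le_lam := hD.one_le_lam
  norm_one_le := ContinuousLinearMap.norm_id_le
  one_mem S := ⟨1, one_mem_patchSpace S, matrixCLM_one⟩
  mul_mem := by
    rintro a b _ _ ⟨x, hx, rfl⟩ ⟨y, hy, rfl⟩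
    exact ⟨x * y, mul_mem_patchSpace hx hy, matrixCLM_mul x y⟩
  commute := by
    rintro a b _ _ hab ⟨x, hx, rfl⟩ ⟨y, hy, rfl⟩
    rw [← matrixCLM_mul, ← matrixCLM_mul, commute_of_not_meets hab hx hy]
  mul_proj := by
    rintro a _ σ ⟨x, hx, rfl⟩
    rw [← matrixCLM_mul, ← matrixCLM_mul, P.intertwine (check_mul_patch hx)]
  ham_proj σ := by
    rw [← matrixCLM_mul, codeHam_mul_proj, map_smul]
  ham_mem := by
    rintro a _ ⟨x, hx, rfl⟩
    rw [← matrixCLM_mul, ← matrixCLM_mul, ← map_sub, codeHam_commutator lam hx]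
    exact Submodule.mem_map_of_mem (Submodule.sum_mem _ fun j hj =>
      Submodule.smul_mem _ _ (mul_check_mem_patchSpace hD.comm hx hj))
  ham_norm := by
    rintro a _ ⟨x, hx, rfl⟩
    rw [← matrixCLM_mul, ← matrixCLM_mul, ← map_sub, codeHam_commutator lam hx, map_sum,
      Finset.sum_mul]
    refine (norm_sum_le _ _).trans (Finset.sum_le_sum fun j _ => ?_)
    have hl : 0 ≤ lam j := zero_le_one.trans (hD.one_le_lam j)
    rw [map_smul, norm_smul, Complex.norm_real, Real.norm_of_nonneg hl, matrixCLM_mul]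
    refine mul_le_mul_of_nonneg_left ((norm_mul_le _ _).trans ?_) hl
    exact mul_le_of_le_one_right (norm_nonneg _) (norm_matrixCLM_pauli_le _)
  scalar := by
    rintro S _ hS ⟨x, hx, rfl⟩
    obtain ⟨c, hc⟩ := P.exists_scalar hD.dist_le
      (by exact_mod_cast hS.trans_le (min_le_left _ _)) hx
    have hc' : matrixCLM x * matrixCLM (P.proj ∅) = c • matrixCLM (P.proj ∅) := by
      rw [← matrixCLM_mul, hc, map_smul]
    refine ⟨c, ?_, hc'⟩
    have h1 : 0 < ‖matrixCLM (P.proj ∅)‖ := by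
      refine norm_pos_iff.2 fun h => hP (matrixCLM_injective ?_)
      rw [h, map_zero]
    refine le_of_mul_le_mul_right ?_ h1
    rw [← norm_smul, ← hc']
    exact norm_mul_le _ _
  kill := by
    rintro a _ σ - ⟨x, hx, rfl⟩ h0 hσ
    rw [← matrixCLM_mul] at h0 ⊢
    rw [P.mul_proj_eq_zero hP hx (matrixCLM_injective (h0.trans (map_zero _).symm)) hσ, map_zero]
  Theta_nonneg δ _ := by
    have := hD.c''_nonneg
    positivity
  touch_sum hδ hB hy hsite j :=
    hD.sound.sum_codeTouch_le hD.q_pos hD.summable hD.c''_nonneg hδ hB hy hsite j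

theorem codeFrame_resolved {q d : ℕ} {dc : ℝ} {f finv : ℝ → ℝ} {c' c'' α : ℝ} {lam : Fin m → ℝ}
    (hD : CodeData C q d dc f finv c' c'' α lam) (P : CodeSectors C) (hP : P.proj ∅ ≠ 0) :
    (codeFrame hD P hP).Resolved where
  sum_proj := by
    change ∑ σ, matrixCLM (P.proj σ) = 1
    rw [← map_sum, P.sum_proj, matrixCLM_one]
  mul_self σ := by
    change matrixCLM (P.proj σ) * matrixCLM (P.proj σ) = matrixCLM (P.proj σ)
    rw [← matrixCLM_mul, P.proj_mul_self]
  mul_of_ne σ τ h := by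
    change matrixCLM (P.proj σ) * matrixCLM (P.proj τ) = 0
    rw [← matrixCLM_mul, P.mul_proj_of_ne h, map_zero]

/-- The range of the code projection is the joint `+1` eigenspace of the checks. -/
theorem range_code_proj (P : CodeSectors C) :
    LinearMap.range (Matrix.mulVecLin (P.proj ∅)) =
      ⨅ j : Fin m, LinearMap.ker (Matrix.mulVecLin (pauli (C j) - 1)) := by
  ext v
  simp only [LinearMap.mem_range, Submodule.mem_iInf, LinearMap.mem_ker, Matrix.mulVecLin_apply,
    Matrix.sub_mulVec, Matrix.one_mulVec, sub_eq_zero]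
  constructor
  · rintro ⟨w, rfl⟩ j
    rw [Matrix.mulVec_mulVec, P.mul_proj]
    simp [sectorSign]
  · intro h
    have hzero : ∀ σ, σ ≠ ∅ → (P.proj σ).mulVec v = 0 := by
      intro σ hσ
      obtain ⟨j, hj⟩ := Finset.nonempty_iff_ne_empty.2 hσ
      have h1 : (P.proj σ * pauli (C j)).mulVec v = (P.proj σ).mulVec v := by
        rw [← Matrix.mulVec_mulVec, h j]
      rw [P.proj_mul, sectorSign, if_pos hj, neg_one_smul, Matrix.neg_mulVec] at h1
      have h2 : (2 : ℂ) • (P.proj σ).mulVec v = 0 := by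
        rw [two_smul]
        nth_rewrite 1 [← h1]
        exact neg_add_cancel _
      exact (smul_eq_zero.1 h2).resolve_left two_ne_zero
    refine ⟨v, ?_⟩
    calc (P.proj ∅).mulVec v = ∑ σ, (P.proj σ).mulVec v :=
          (Finset.sum_eq_single _ (fun σ _ hσ => hzero σ hσ) (by simp)).symm
      _ = v := by rw [← Matrix.sum_mulVec, P.sum_proj, Matrix.one_mulVec]

theorem finrank_range_matrixCLM (M : Matrix (F2vec n) (F2vec n) ℂ) :
    Module.finrank ℂ (LinearMap.range (matrixCLM M : QubitSpace n →ₗ[ℂ] QubitSpace n)) =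
      Module.finrank ℂ (LinearMap.range (Matrix.mulVecLin M)) := by
  let e : QubitSpace n ≃ₗ[ℂ] (F2vec n → ℂ) := WithLp.linearEquiv 2 ℂ (F2vec n → ℂ)
  have h1 : LinearMap.range (Matrix.mulVecLin M) =
      (LinearMap.range (matrixCLM M : QubitSpace n →ₗ[ℂ] QubitSpace n)).map (e : _ →ₗ[ℂ] _) := by
    rw [← LinearMap.range_comp, ← LinearMap.range_comp_of_range_eq_top (Matrix.mulVecLin M)
      (LinearEquiv.range e)]
    rfl
  rw [h1]
  exact (LinearEquiv.finrank_map_eq e _).symm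

end CodeFrame

/-! ### Spectral stability -/

section Stability

variable {n m : ℕ}

/-- A local perturbation of the code Hamiltonian can be brought to the form the flow starts from. -/
theorem StabFrame.exists_flowForm {A : Type*} [NormedRing A] [NormedAlgebra ℂ A]
    (F : StabFrame n m A) {X : PatchLabel n m → A} (hX : ∀ a, X a ∈ F.supp a)
    (hX0 : ∀ a, a.1 = ∅ → X a = 0) (c₀ : ℂ) {κ ε δ : ℝ} (hloc : LocLe κ X ε) (hε : 0 ≤ ε)
    (hδ : 0 < δ) :
    ∃ (c : ℂ) (D V R : PatchLabel n m → A), F.FlowForm (F.ham + c₀ • 1 + total X) c D V R (κ - δ)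
      (ε * (2 * F.Theta δ + 2 / δ)) ε ε := by
  obtain ⟨c, D, hD1, hD2, hD3, hD4, hD5⟩ := F.exists_scalar_split
    (Y := famRestrict (fun a => F.Small a ∧ a.2 = ∅) X) (F.famRestrict_mem hX _)
    (fun a ha => if_neg fun h => ha h.1) (fun a => by
      by_cases h : a.2 = ∅
      · exact Or.inl h
      · right
        rw [famRestrict, if_neg fun h' => h h'.2, zero_mul])
  have hDloc : LocLe κ D (2 * ε) := hloc.of_norm_le zero_le_two fun a =>
    (hD5 a).trans (mul_le_mul_of_nonneg_left (norm_famRestrict_le _ _ _) zero_le_two)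
  obtain ⟨htouch, hsite⟩ := F.meanField_of_locLe hδ (by positivity) hD3 hDloc
  have hΘ := F.Theta_nonneg δ hδ
  have hrest : ∀ p : PatchLabel n m → Prop, LocLe (κ - δ) (famRestrict p X) ε := fun p =>
    (hloc.of_norm_le' (norm_famRestrict_le _ _)).mono_rate (by linarith)
  have hε1 : 0 ≤ ε * F.Theta δ := mul_nonneg hε hΘ
  have hε2 : 0 ≤ ε * (2 / δ) := by positivity
  refine ⟨c₀ + c, D, famRestrict (fun a => F.Small a ∧ a.2.Nonempty) X, famRestrict F.Large X,
    ?_, hD2, hD3, hD4, ⟨F.famRestrict_mem hX _, fun a ha => if_neg ha⟩, F.famRestrict_mem hX _,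
    fun a ha => if_neg ha, fun j => (htouch j).trans ?_, fun i => (hsite i).trans ?_,
    hrest _, hrest _⟩
  · rw [F.total_trichotomy hX0, hD1, add_smul]
    abel
  · linarith
  · have : 2 * ε / δ = ε * (2 / δ) := by ring
    linarith

variable {C : Fin m → F2vec n × F2vec n}

/-- Operators supported in the empty region are scalars. -/
theorem exists_eq_smul_one_of_mem_patchSpace {a : PatchLabel n m} (ha : a.1 = ∅)
    {x : Matrix (F2vec n) (F2vec n) ℂ} (hx : x ∈ patchSpace C a) : ∃ c : ℂ, x = c • 1 := by
  refine Submodule.span_induction (p := fun x _ => ∃ c : ℂ, x = c • 1) ?_ ?_ ?_ ?_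
    (patchSpace_le_span a hx)
  · rintro _ ⟨p, rfl, hp, -⟩
    rw [ha, Finset.subset_empty] at hp
    have hp0 : p = 0 := by
      have h1 : ∀ i, p.1 i = 0 ∧ p.2 i = 0 := fun i => notMem_pSupp.1 (by simp [hp])
      exact Prod.ext (funext fun i => (h1 i).1) (funext fun i => (h1 i).2)
    exact ⟨1, by rw [hp0, pauli_zero, one_smul]⟩
  · exact ⟨0, (zero_smul _ _).symm⟩
  · rintro x y _ _ ⟨c, rfl⟩ ⟨c', rfl⟩
    exact ⟨c + c', (add_smul _ _ _).symm⟩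
  · rintro r x _ ⟨c, rfl⟩
    exact ⟨r * c, (mul_smul _ _ _).symm⟩

theorem locLe_of_kappaNorm
    (VF : Finset (Fin n) → Finset (Fin m) → Matrix (F2vec n) (F2vec n) ℂ) (κ : ℝ) :
    LocLe κ (fun a : PatchLabel n m => matrixCLM (VF a.1 a.2)) (kappaNorm VF κ) := by
  intro i
  unfold kappaNorm
  refine le_trans (le_of_eq ?_) (le_ciSup (f := fun i : Fin n =>
    ∑ S ∈ Finset.univ.filter (fun S : Finset (Fin n) => i ∈ S),
      ∑ s : Finset (Fin m), opNorm (VF S s) * Real.exp (κ * S.card))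
    (Set.finite_range _).bddAbove i)
  unfold siteSum
  rw [Fintype.sum_prod_type, Finset.sum_filter]
  refine Finset.sum_congr rfl fun S _ => ?_
  split_ifs
  · rfl
  · simp

theorem kappaNorm_nonneg
    (VF : Finset (Fin n) → Finset (Fin m) → Matrix (F2vec n) (F2vec n) ℂ) (κ : ℝ) :
    0 ≤ kappaNorm VF κ :=
  Real.iSup_nonneg fun _ => Finset.sum_nonneg fun _ _ => Finset.sum_nonneg fun _ _ =>
    mul_nonneg (norm_nonneg _) (Real.exp_pos _).le

theorem codeHam_isHermitian (lam : Fin m → ℝ) : (codeHam C lam).IsHermitian := by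
  unfold codeHam Matrix.IsHermitian
  rw [Matrix.conjTranspose_sum]
  refine Finset.sum_congr rfl fun j _ => ?_
  rw [Matrix.conjTranspose_smul, Matrix.conjTranspose_sub, Matrix.conjTranspose_one,
    pauli_conjTranspose]
  simp

/-- Gapped sectors of a conjugate of a Hermitian matrix determine its low spectrum. -/
theorem eigenvalues_of_gappedSectors {ι : Type*} [Fintype ι]
    {p : ι → QubitSpace n →ₗ[ℂ] QubitSpace n} {o : ι} {En : ι → ℝ} {τ t : ℝ}
    {H : Matrix (F2vec n) (F2vec n) ℂ} {Ω Ω' : QubitSpace n →L[ℂ] QubitSpace n} {c : ℂ}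
    (h1 : Ω' * Ω = 1) (h2 : Ω * Ω' = 1)
    (hgap : GappedSectors p o En ((Ω' * matrixCLM H * Ω - c • 1 : QubitSpace n →L[ℂ] QubitSpace n) :
      QubitSpace n →ₗ[ℂ] QubitSpace n) τ)
    (hortho : ∀ σ, σ ≠ o → ∀ ψ, p σ (p o ψ) = 0) (hτt : τ ≤ t) (ht : t ≤ 1 / 16)
    (hH : (H - (c.re : ℂ) • (1 : Matrix (F2vec n) (F2vec n) ℂ)).IsHermitian) :
    (∀ v, hH.eigenvalues v ∈ Set.Icc (-t) t ∪ Set.Ici (1 / 2 + t)) ∧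
      (Finset.univ.filter fun v => hH.eigenvalues v ∈ Set.Icc (-t) t).card =
        Module.finrank ℂ (LinearMap.range (p o)) := by
  let e : QubitSpace n ≃ₗ[ℂ] QubitSpace n := LinearEquiv.ofLinearMap
    (Ω' : QubitSpace n →ₗ[ℂ] QubitSpace n) (Ω : QubitSpace n →ₗ[ℂ] QubitSpace n)
    (LinearMap.ext fun ψ => DFunLike.congr_fun h1 ψ)
    (LinearMap.ext fun ψ => DFunLike.congr_fun h2 ψ)
  let b : Module.Basis (F2vec n) ℂ (QubitSpace n) := hH.eigenvectorBasis.toBasis.map e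
  let z : F2vec n → ℂ := fun v => (hH.eigenvalues v : ℂ) + (c.re : ℂ) - c
  have hre : ∀ v, (z v).re = hH.eigenvalues v := fun v => by simp [z]
  have hb : ∀ v, b v = Ω' (hH.eigenvectorBasis v) := fun v => by simp [b, e]
  have hHv : ∀ v, matrixCLM H (hH.eigenvectorBasis v) =
      ((hH.eigenvalues v : ℂ) + (c.re : ℂ)) • hH.eigenvectorBasis v := by
    intro v
    have h3 := hH.mulVec_eigenvectorBasis v
    rw [Matrix.sub_mulVec, Matrix.smul_mulVec, Matrix.one_mulVec, sub_eq_iff_eq_add] at h3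
    have h4 : (matrixCLM H (hH.eigenvectorBasis v)).ofLp =
        H.mulVec (hH.eigenvectorBasis v).ofLp := Matrix.ofLp_toEuclideanCLM _ _
    apply (WithLp.linearEquiv 2 ℂ (F2vec n → ℂ)).injective
    change (matrixCLM H (hH.eigenvectorBasis v)).ofLp = _
    rw [h4, h3, add_smul]
    rfl
  have hz : ∀ v, ((Ω' * matrixCLM H * Ω - c • 1 : QubitSpace n →L[ℂ] QubitSpace n) :
      QubitSpace n →ₗ[ℂ] QubitSpace n) (b v) = z v • b v := by
    intro v
    rw [hb]
    change Ω' (matrixCLM H (Ω (Ω' (hH.eigenvectorBasis v)))) -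
      c • Ω' (hH.eigenvectorBasis v) = _
    have h3 : Ω (Ω' (hH.eigenvectorBasis v)) = hH.eigenvectorBasis v :=
      DFunLike.congr_fun h2 _
    rw [h3, hHv, map_smul, ← sub_smul]
  have hlow : ∀ v, hH.eigenvalues v < 3 / 4 → hH.eigenvalues v ∈ Set.Icc (-t) t := by
    intro v hv
    have h3 := hgap.norm_eigenvalue_le (b.ne_zero v) (hz v) (by rwa [hre])
    have h4 := Complex.abs_re_le_norm (z v)
    rw [hre] at h4
    exact abs_le.1 (h4.trans (h3.trans hτt))
  refine ⟨fun v => ?_, ?_⟩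
  · rcases lt_or_ge (hH.eigenvalues v) (3 / 4) with hv | hv
    · exact Or.inl (hlow v hv)
    · right
      rw [Set.mem_Ici]
      linarith
  · rw [← hgap.card_low_eq hortho b hz]
    congr 1
    refine Finset.filter_congr fun v _ => ?_
    rw [hre]
    exact ⟨fun hv => by linarith [hv.2], hlow v⟩

end Stability

section Stability

variable {n m : ℕ} {C : Fin m → F2vec n × F2vec n}

theorem exists_total_eq_smul_one_add {VF : Finset (Fin n) → Finset (Fin m) →
    Matrix (F2vec n) (F2vec n) ℂ} (hVF : ∀ a : PatchLabel n m, VF a.1 a.2 ∈ patchSpace C a) :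
    ∃ c : ℂ, matrixCLM (∑ S, ∑ s, VF S s) = c • (1 : QubitSpace n →L[ℂ] QubitSpace n) +
      total (famRestrict (fun a => a.1.Nonempty)
        fun a : PatchLabel n m => matrixCLM (VF a.1 a.2)) := by
  have h1 : ∀ a : PatchLabel n m, ∃ c : ℂ, matrixCLM (VF a.1 a.2) =
      c • (1 : QubitSpace n →L[ℂ] QubitSpace n) +
        famRestrict (fun a => a.1.Nonempty)
          (fun a : PatchLabel n m => matrixCLM (VF a.1 a.2)) a := by
    intro a
    by_cases ha : a.1.Nonempty
    · refine ⟨0, ?_⟩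
      rw [famRestrict, if_pos ha]
      exact (zero_add _).symm.trans
        (congrArg (· + _) (zero_smul ℂ (1 : QubitSpace n →L[ℂ] QubitSpace n)).symm)
    · obtain ⟨c, hc⟩ := exists_eq_smul_one_of_mem_patchSpace
        (Finset.not_nonempty_iff_eq_empty.1 ha) (hVF a)
      exact ⟨c, by rw [famRestrict, if_neg ha, add_zero, hc, map_smul, matrixCLM_one]⟩
  choose c hc using h1
  refine ⟨∑ a, c a, ?_⟩
  have hsum : (∑ a, c a) • (1 : QubitSpace n →L[ℂ] QubitSpace n) = ∑ a, c a • 1 :=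
    map_sum (LinearMap.toSpanSingleton ℂ (QubitSpace n →L[ℂ] QubitSpace n) 1) c _
  rw [← Fintype.sum_prod_type (f := fun a : PatchLabel n m => VF a.1 a.2), map_sum, hsum,
    total, ← Finset.sum_add_distrib]
  exact Finset.sum_congr rfl fun a _ => hc a

theorem natCast_mul_exp_le_one {c_d κ ds : ℝ} (hcd : 0 < c_d) (hκ : 2 / c_d < κ) (hn : 1 ≤ (n : ℝ))
    (hds : c_d * Real.log n ≤ ds) : n * Real.exp (-(κ * ds / 2)) ≤ 1 := by
  have h1 : 0 ≤ Real.log n := Real.log_nonneg hn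
  have hκ0 : 0 < κ := lt_trans (by positivity) hκ
  have h2 : 2 ≤ κ * c_d := by
    rw [div_lt_iff₀ hcd] at hκ
    exact hκ.le
  have h3 : 2 * Real.log n ≤ κ * ds :=
    calc 2 * Real.log n ≤ κ * c_d * Real.log n := mul_le_mul_of_nonneg_right h2 h1
      _ = κ * (c_d * Real.log n) := mul_assoc _ _ _
      _ ≤ κ * ds := mul_le_mul_of_nonneg_left hds hκ0.le
  calc n * Real.exp (-(κ * ds / 2)) = Real.exp (Real.log n - κ * ds / 2) := by
        rw [sub_eq_add_neg, Real.exp_add, Real.exp_log (by linarith)]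
    _ ≤ 1 := Real.exp_le_one_iff.2 (by linarith)

end Stability

/-- Spectral part of the main stability theorem for quantum LDPC codes
(Theorem 1 of the paper).  For a `(q,q')`-LDPC stabilizer code with `k` logical qubits,
distance `d`, `(d_c, f)`-check-soundness with `d_s = min(d, d_c) ≥ c_d·log n` and the
summability condition, any perturbation `V` with `κ₁`-norm `ε ≤ min(ε₀, 1/(3c₁))`
shifts the spectrum of `H₀ + V` (up to an overall constant `c_*`) into
`[−ε_*, ε_*] ∪ [1/2 + ε_*, ∞)` with exactly `2^k` eigenvalues in the first interval,
where `ε_* = c₂·n·ε·e^{−κ₁·d_s/2}`. -/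
theorem quantum_ldpc_stability_spectral
    (q q' : ℕ) (hq : 2 ≤ q) (hq' : 2 ≤ q')
    (c_d κ₁ : ℝ) (hcd : 0 < c_d) (hκ₁ : 2 / c_d < κ₁)
    (a : ℝ) (ha : 1 ≤ a)
    (c'f c''f α : ℝ) (hc'f : 0 < c'f) (hc''f : 0 < c''f) (hα : 0 < α) :
    ∃ ε₀ c₁ c₂ c₃ : ℝ, 0 < ε₀ ∧ 0 < c₁ ∧ 0 < c₂ ∧ 0 < c₃ ∧
      ∀ (n m k : ℕ) (C : Fin m → F2vec n × F2vec n),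
        -- stabilizer code: pairwise commuting checks
        (∀ j j' : Fin m, sympl (C j) (C j') = 0) →
        -- (q, q')-LDPC
        (∀ j : Fin m, (pSupp (C j)).card ≤ q) →
        (∀ i : Fin n, (Finset.univ.filter fun j : Fin m => i ∈ pSupp (C j)).card ≤ q') →
        -- at least c₃ qubits
        (c₃ ≤ (n : ℝ)) →
        -- k logical qubits: the joint +1 eigenspace of the checks has dimension 2^k
        (Module.finrank ℂ
            ↥(⨅ j : Fin m, LinearMap.ker (Matrix.mulVecLin (pauli (C j) - 1))) = 2 ^ k) →
        ∀ (d : ℕ) (dc : ℝ) (f finv : ℝ → ℝ),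
        -- code distance d
        (∀ p : F2vec n × F2vec n, IsLogical C p → d ≤ pWeight p) →
        -- f is an increasing bijection of [0, ∞), with inverse finv
        StrictMonoOn f (Set.Ici 0) →
        (∀ x : ℝ, 0 ≤ x → 0 ≤ f x) →
        (∀ x : ℝ, 0 ≤ x → 0 ≤ finv x) →
        (∀ x : ℝ, 0 ≤ x → finv (f x) = x) →
        (∀ x : ℝ, 0 ≤ x → f (finv x) = x) →
        -- (d_c, f)-check-soundness
        (∀ T : Finset (Fin m), ((pWeight (∑ j ∈ T, C j) : ℝ) < dc) →
          ∃ T' : Finset (Fin m), (∑ j ∈ T', C j) = ∑ j ∈ T, C j ∧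
            (T'.card : ℝ) ≤ f (pWeight (∑ j ∈ T, C j))) →
        -- d_s = min(d, d_c) ≥ c_d·log n
        (c_d * Real.log n ≤ min (d : ℝ) dc) →
        -- summability condition with constants (c'_f, c''_f, α), Δ := q
        SummabilityCondition (codeGraph C) f finv (min (d : ℝ) dc) (q : ℝ) c'f c''f α →
        -- the code Hamiltonian
        ∀ (lam : Fin m → ℝ), (∀ j, 1 ≤ lam j ∧ lam j ≤ a) →
        ∀ H₀ : Matrix (F2vec n) (F2vec n) ℂ,
        H₀ = (∑ j : Fin m, ((lam j / 2 : ℝ) : ℂ) • ((1 : Matrix (F2vec n) (F2vec n) ℂ) - pauli (C j))) →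
        -- the perturbation, presented as a sum of strongly supported terms
        ∀ (VF : Finset (Fin n) → Finset (Fin m) → Matrix (F2vec n) (F2vec n) ℂ)
          (V : Matrix (F2vec n) (F2vec n) ℂ),
        V = (∑ S : Finset (Fin n), ∑ s : Finset (Fin m), VF S s) →
        V.IsHermitian →
        (∀ S s, VF S s ≠ 0 → StronglySupported C (VF S s) S s) →
        ∀ ε : ℝ, ε = kappaNorm VF κ₁ →
        ε ≤ min ε₀ (1 / (3 * c₁)) →
        -- conclusion
        ∃ cstar : ℝ,
          ∃ hH : (H₀ + V - (cstar : ℂ) • (1 : Matrix (F2vec n) (F2vec n) ℂ)).IsHermitian,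
            (∀ v : F2vec n, hH.eigenvalues v ∈
              Set.Icc (-(c₂ * n * ε * Real.exp (-(κ₁ * min (d : ℝ) dc / 2))))
                      (c₂ * n * ε * Real.exp (-(κ₁ * min (d : ℝ) dc / 2))) ∪
              Set.Ici (1 / 2 + c₂ * n * ε * Real.exp (-(κ₁ * min (d : ℝ) dc / 2)))) ∧
            (Finset.univ.filter fun v : F2vec n => hH.eigenvalues v ∈
              Set.Icc (-(c₂ * n * ε * Real.exp (-(κ₁ * min (d : ℝ) dc / 2))))
                      (c₂ * n * ε * Real.exp (-(κ₁ * min (d : ℝ) dc / 2)))).card = 2 ^ k := by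
  have hκ0 : 0 < κ₁ := lt_trans (by positivity) hκ₁
  obtain ⟨M, e, δ, x, he, hM, hs⟩ := exists_flowSchedule (b := q) (Nat.cast_nonneg q) hc''f.le
    hc'f.le hα hκ0
  have hδ0 := hs.width_pos 0
  set K₀ : ℝ := 2 * (q * (1 + c''f * Real.exp (c'f * (δ 0) ^ (-α)))) + 2 / δ 0 with hK₀
  have hK₀0 : 0 ≤ K₀ := by positivity
  have hL : 0 < 16 * (K₀ + 2 + 2 * M) := by positivity
  refine ⟨min e (1 / (16 * (K₀ + 2 + 2 * M))), 1, 2 + 2 * M, 1, lt_min he (by positivity),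
    one_pos, by positivity, one_pos, ?_⟩
  intro n m k C hC hcard _ hn hk d dc f finv hd hf hf0 hfinv0 _ hffinv hsound hds hsummable lam
    hlam H₀ hH₀ VF V hV hVherm hVF ε hε hεle
  have hε0 : 0 ≤ ε := hε ▸ kappaNorm_nonneg VF κ₁
  have hεe : ε ≤ e := hεle.trans ((min_le_left _ _).trans (min_le_left _ _))
  have hεL : ε * (K₀ + 2 + 2 * M) ≤ 1 / 16 := by
    have h1 := hεle.trans ((min_le_left _ _).trans (min_le_right _ _))
    rw [le_div_iff₀ hL] at h1
    linarith
  have hεK : 0 ≤ ε * K₀ := mul_nonneg hε0 hK₀0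
  have hεM : 0 ≤ ε * M := mul_nonneg hε0 hM
  have hD : CodeData C q d dc f finv c'f c''f α lam :=
    { comm := hC
      q_pos := by omega
      dist_le := hd
      sound := ⟨hcard, hf, hf0, hfinv0, hffinv, fun T hT =>
        hsound T (hT.trans_le (min_le_right _ _))⟩
      summable := hsummable
      c''_nonneg := hc''f.le
      one_le_lam := fun j => (hlam j).1 }
  obtain ⟨P⟩ := nonempty_codeSectors hC
  have hrank : Module.finrank ℂ (LinearMap.range (Matrix.mulVecLin (P.proj ∅))) = 2 ^ k := by
    rw [range_code_proj, hk]
  have hP : P.proj ∅ ≠ 0 := by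
    intro h
    rw [h, Matrix.mulVecLin_zero, LinearMap.range_zero, finrank_bot] at hrank
    exact (pow_pos two_pos k).ne hrank
  let F := codeFrame hD P hP
  have hpatch : ∀ a : PatchLabel n m, VF a.1 a.2 ∈ patchSpace C a := fun a =>
    mem_patchSpace_of_stronglySupported (hVF a.1 a.2)
  obtain ⟨c₀, hc₀⟩ := exists_total_eq_smul_one_add hpatch
  set X : PatchLabel n m → (QubitSpace n →L[ℂ] QubitSpace n) :=
    famRestrict (fun a => a.1.Nonempty) fun a => matrixCLM (VF a.1 a.2) with hX
  have hXloc : LocLe κ₁ X ε := by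
    rw [hε]
    exact (locLe_of_kappaNorm VF κ₁).of_norm_le' (norm_famRestrict_le _ _)
  have hstart := F.exists_flowForm (X := X)
    (F.famRestrict_mem (fun a => Submodule.mem_map_of_mem (hpatch a)) _)
    (fun a ha => if_neg (Finset.not_nonempty_iff_eq_empty.2 ha)) c₀ hXloc hε0 hδ0
  have hham : F.ham + c₀ • 1 + total X = matrixCLM (H₀ + V) := by
    rw [map_add, hV, hc₀, hH₀, ← add_assoc]
    rfl
  rw [hham] at hstart
  set w : ℝ := Real.exp (-(κ₁ * min (d : ℝ) dc / 2)) with hw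
  have hw0 : 0 < w := Real.exp_pos _
  have hnw : n * w ≤ 1 := natCast_mul_exp_le_one hcd hκ₁ hn hds
  have hds0 : 0 ≤ min (d : ℝ) dc :=
    (mul_nonneg hcd.le (Real.log_nonneg hn)).trans hds
  obtain ⟨N, hN⟩ := (hs.strength_tendsto.eventually_lt_const hw0).exists
  obtain ⟨Ω, Ω', hΩ1, hΩ2, c, D, V', R, hflow⟩ := StabFrame.FlowForm.iterate hs
    (F := F) (fun δ' _ => le_rfl) (fun δ' _ => by unfold flowLoss; positivity) hε0 hεe hεK
    (by linarith) (by linarith) hκ0 hstart N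
  have hKx0 : 0 ≤ ∑ i ∈ Finset.range N, flowLoss q c''f c'f α (δ i) * x i :=
    Finset.sum_nonneg fun i _ =>
      mul_nonneg (by unfold flowLoss; positivity) (hs.strength_pos i).le
  have hKx := hs.loss_sum N
  have hεKx0 := mul_nonneg hε0 hKx0
  have hεKx := mul_le_mul_of_nonneg_left hKx hε0
  have hwidth := hs.width_sum N
  have hrate : Real.exp (-((κ₁ - δ 0 - 2 * ∑ i ∈ Finset.range N, δ i) * F.ds)) ≤ w := by
    refine Real.exp_le_exp.2 ?_
    have h1 : κ₁ / 2 * min (d : ℝ) dc ≤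
        (κ₁ - δ 0 - 2 * ∑ i ∈ Finset.range N, δ i) * min (d : ℝ) dc :=
      mul_le_mul_of_nonneg_right (by linarith) hds0
    change -((κ₁ - δ 0 - 2 * ∑ i ∈ Finset.range N, δ i) * min (d : ℝ) dc) ≤ _
    linarith
  have hnε : 0 ≤ n * ε := mul_nonneg (Nat.cast_nonneg n) hε0
  have hτ : n * (ε * x N + ε * (1 + 2 * ∑ i ∈ Finset.range N, flowLoss q c''f c'f α (δ i) * x i)
      * w) ≤ (2 + 2 * M) * n * ε * w :=
    calc _ = n * ε * (x N + (1 + 2 * ∑ i ∈ Finset.range N, flowLoss q c''f c'f α (δ i) * x i)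
          * w) := by ring
      _ ≤ n * ε * (w + (1 + 2 * M) * w) := by gcongr
      _ = _ := by ring
  have hτ' : (2 + 2 * M) * n * ε * w ≤ 1 / 16 :=
    calc (2 + 2 * M) * n * ε * w = ε * (2 + 2 * M) * (n * w) := by ring
      _ ≤ ε * (2 + 2 * M) * 1 := by gcongr
      _ ≤ 1 / 16 := by linarith
  have hgap := hflow.gappedSectors (codeFrame_resolved hD P hP) (by linarith) (by linarith)
    (by linarith) (mul_nonneg hε0 (hs.strength_pos N).le) (by positivity) hrate hτ hτ'
  have hH : (H₀ + V - (c.re : ℂ) • (1 : Matrix (F2vec n) (F2vec n) ℂ)).IsHermitian := by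
    rw [hH₀]
    refine ((codeHam_isHermitian lam).add hVherm).sub ?_
    rw [Matrix.IsHermitian, Matrix.conjTranspose_smul, Matrix.conjTranspose_one]
    simp
  obtain ⟨h1, h2⟩ := eigenvalues_of_gappedSectors hΩ1 hΩ2 hgap (fun σ hσ ψ =>
    DFunLike.congr_fun ((codeFrame_resolved hD P hP).mul_of_ne σ ∅ hσ) ψ) le_rfl hτ' hH
  refine ⟨c.re, hH, h1, h2.trans ?_⟩
  rw [← hrank]
  exact finrank_range_matrixCLM (P.proj ∅)
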